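/- Let A be a normal domain and let m, n, r be nonnegative integers with r < min{m,n}, and suppose that r = 0 or m = n. Set R = R_{r+1}(A;m,n) = A[X_ij]/I_{r+1}(X). Then base change along the natural (faithfully flat) map A → R induces a bijection on isomorphism classes of semidualizing modules: for every semidualizing A-module C, the R-module C ⊗_A R is semidualizing; every semidualizing R-module is isomorphic to C ⊗_A R for some semidualizing A-module C; and if C ⊗_A R ≅ C' ⊗_A R for semidualizing A-modules C, C', then C ≅ C'. -/

import Mathlib

open CategoryTheory

/-- The `i`-th Ext module of two `R`-modules, over a commutative ring `R`. -/
noncomputable def ExtModule (R : Type) [CommRing R] (M N : ModuleCat.{0} R) (i : ℕ) :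
    ModuleCat R :=
  ((Ext R (ModuleCat.{0} R) i).obj (Opposite.op M)).obj N

/-- `C` is a semidualizing `R`-module: it is finitely generated, the homothety map
`R → Hom_R(C,C)` is bijective, and `Ext^i_R(C,C) = 0` for all `i > 0`. -/
def IsSemidualizing (R : Type) [CommRing R] (C : Type) [AddCommGroup C] [Module R C] : Prop :=
  Module.Finite R C ∧
  Function.Bijective (algebraMap R (Module.End R C)) ∧
  ∀ i : ℕ, 0 < i → Subsingleton (ExtModule R (ModuleCat.of R C) (ModuleCat.of R C) i)

/-- `M` has finite injective dimension over `R`: `Ext^i_R(-, M)` vanishes uniformly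
for all large `i`. -/
def HasFiniteInjectiveDimension (R : Type) [CommRing R] (M : Type) [AddCommGroup M]
    [Module R M] : Prop :=
  ∃ n : ℕ, ∀ (N : ModuleCat.{0} R) (i : ℕ), n < i →
    Subsingleton (ExtModule R N (ModuleCat.of R M) i)

/-- A Gorenstein local ring: a commutative Noetherian local ring having finite injective
dimension as a module over itself. -/
def IsGorensteinLocalRing (R : Type) [CommRing R] : Prop :=
  IsNoetherianRing R ∧ IsLocalRing R ∧ HasFiniteInjectiveDimension R R

/-- The length of an `R`-module, i.e. the Krull dimension of its lattice of submodules. -/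
noncomputable def moduleLength (R M : Type) [CommRing R] [AddCommGroup M] [Module R M] :
    WithBot ℕ∞ :=
  Order.krullDim (Submodule R M)

/-- The ideal of the polynomial ring `A[X_ij]` generated by the size `t` minors of the
generic `m × n` matrix `(X_ij)`. -/
noncomputable def minorsIdeal (A : Type) [CommRing A] (m n t : ℕ) :
    Ideal (MvPolynomial (Fin m × Fin n) A) :=
  Ideal.span { d | ∃ (ρ : Fin t → Fin m) (γ : Fin t → Fin n),
    d = (Matrix.of fun i j => MvPolynomial.X (ρ i, γ j)).det }

/-- The determinantal ring `R_t(A; m, n) = A[X_ij]/I_t(X)`. -/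
abbrev DetRing (A : Type) [CommRing A] (m n t : ℕ) : Type :=
  MvPolynomial (Fin m × Fin n) A ⧸ minorsIdeal A m n t

/-- The `R`-linear map `N ^ n → N ^ m` defined by an `m × n` matrix over `R`. -/
def matAct {R : Type} [CommRing R] {m n : ℕ} (M : Matrix (Fin m) (Fin n) R) (N : Type)
    [AddCommGroup N] [Module R N] : (Fin n → N) →ₗ[R] (Fin m → N) :=
  LinearMap.pi fun i => ∑ j, M i j • LinearMap.proj j

lemma matAct_apply {R : Type} [CommRing R] {m n : ℕ} (M : Matrix (Fin m) (Fin n) R) {N : Type}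
    [AddCommGroup N] [Module R N] (v : Fin n → N) (i : Fin m) :
    matAct M N v i = ∑ j, M i j • v j := by
  simp [matAct]

/-- A resolution of `D` by finite free modules, given by matrices. -/
structure FreeRes (R D : Type) [CommRing R] [AddCommGroup D] [Module R D] where
  b : ℕ → ℕ
  M : ∀ i, Matrix (Fin (b i)) (Fin (b (i + 1))) R
  g : Fin (b 0) → D
  surj : Function.Surjective (Fintype.linearCombination R g)
  exact_zero : Function.Exact (matAct (M 0) R) (Fintype.linearCombination R g)
  exact_succ : ∀ i, Function.Exact (matAct (M (i + 1)) R) (matAct (M i) R)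

/-- The dual complex `0 → R → D ^ b₀ → D ^ b₁ → ⋯` of a resolution is exact. -/
structure FreeRes.DualExact {R D : Type} [CommRing R] [AddCommGroup D] [Module R D]
    (F : FreeRes R D) : Prop where
  inj : Function.Injective (LinearMap.toSpanSingleton R (Fin (F.b 0) → D) F.g)
  coexact_zero : Function.Exact (LinearMap.toSpanSingleton R (Fin (F.b 0) → D) F.g)
    (matAct (F.M 0).transpose D)
  coexact_succ : ∀ i, Function.Exact (matAct (F.M i).transpose D)
    (matAct (F.M (i + 1)).transpose D)

/-- Elementary form of the semidualizing property. -/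
def SD (R D : Type) [CommRing R] [AddCommGroup D] [Module R D] : Prop :=
  ∃ F : FreeRes R D, F.DualExact

section Existence

variable {R : Type} [CommRing R]

lemma exists_linearCombination_range [IsNoetherianRing R] {m : ℕ}
    (N : Submodule R (Fin m → R)) :
    ∃ (n : ℕ) (M : Matrix (Fin m) (Fin n) R), LinearMap.range (matAct M R) = N := by
  obtain ⟨n, s, hs⟩ := (Submodule.fg_iff_exists_fin_generating_family (N := N)).1
    (IsNoetherian.noetherian N)
  refine ⟨n, Matrix.of fun i j => s j i, ?_⟩
  rw [← hs, ← Fintype.range_linearCombination]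
  congr 1
  ext v i
  simp [matAct_apply, Fintype.linearCombination_apply]
  grind

/-- Iterated syzygy matrices. -/
noncomputable def syzMat [IsNoetherianRing R] (p q : ℕ) (M : Matrix (Fin p) (Fin q) R) :
    ℕ → Σ p q : ℕ, Matrix (Fin p) (Fin q) R
  | 0 => ⟨p, q, M⟩
  | i + 1 => ⟨(syzMat p q M i).2.1,
      (exists_linearCombination_range (LinearMap.ker (matAct (syzMat p q M i).2.2 R))).choose,
      (exists_linearCombination_range (LinearMap.ker
        (matAct (syzMat p q M i).2.2 R))).choose_spec.choose⟩

lemma exists_freeRes [IsNoetherianRing R] (D : Type) [AddCommGroup D] [Module R D]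
    [Module.Finite R D] : Nonempty (FreeRes R D) := by
  obtain ⟨b₀, g, hg⟩ := Module.Finite.exists_fin (R := R) (M := D)
  obtain ⟨q, M, hM⟩ := exists_linearCombination_range
    (LinearMap.ker (Fintype.linearCombination R g))
  have h1 : ∀ i, (syzMat b₀ q M (i + 1)).1 = (syzMat b₀ q M i).2.1 := fun i => rfl
  refine ⟨⟨fun i => (syzMat b₀ q M i).1, fun i => (syzMat b₀ q M i).2.2, g, ?_, ?_, ?_⟩⟩
  · exact LinearMap.range_eq_top.1 ((Fintype.range_linearCombination R g).trans hg)
  · exact LinearMap.exact_iff.2 hM.symm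
  · intro i
    exact LinearMap.exact_iff.2 (exists_linearCombination_range (LinearMap.ker
        (matAct (syzMat b₀ q M i).2.2 R))).choose_spec.choose_spec.symm

end Existence

namespace FreeRes

variable {R D : Type} [CommRing R] [AddCommGroup D] [Module R D] (F : FreeRes R D)

/-- The chain complex of a matrix resolution. -/
noncomputable def complex : ChainComplex (ModuleCat.{0} R) ℕ :=
  ChainComplex.of (fun i => ModuleCat.of R (Fin (F.b i) → R))
    (fun i => ModuleCat.ofHom (matAct (F.M i) R)) (fun i => by
      rw [← ModuleCat.ofHom_comp, (F.exact_succ i).linearMap_comp_eq_zero]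
      rfl)

lemma complex_d (i : ℕ) : F.complex.d (i + 1) i = ModuleCat.ofHom (matAct (F.M i) R) := by
  unfold complex
  simp

lemma complex_exactAt (i : ℕ) : F.complex.ExactAt (i + 1) := by
  rw [HomologicalComplex.exactAt_iff' _ (i + 1 + 1) (i + 1) i (by simp) (by simp),
    ShortComplex.ShortExact.moduleCat_exact_iff_function_exact]
  have := F.exact_succ i
  dsimp [HomologicalComplex.sc', HomologicalComplex.shortComplexFunctor']
  rw [complex_d, complex_d]
  exact this

/-- The augmentation of the complex of a matrix resolution. -/
noncomputable def augmentation : F.complex.X 0 ⟶ ModuleCat.of R D :=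
  ModuleCat.ofHom (Fintype.linearCombination R F.g)

lemma complex_d_hom (i : ℕ) (x : Fin (F.b (i + 1)) → R) :
    (F.complex.d (i + 1) i).hom x = matAct (F.M i) R x := by
  rw [complex_d]
  rfl

lemma d_comp_augmentation : F.complex.d 1 0 ≫ F.augmentation = 0 := by
  ext x
  change Fintype.linearCombination R F.g ((F.complex.d 1 0).hom x) = 0
  exact (F.exact_zero _).2 ⟨x, (F.complex_d_hom 0 x).symm⟩

lemma augmentation_exact :
    (ShortComplex.mk (F.complex.d 1 0) F.augmentation F.d_comp_augmentation).Exact ∧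
      Epi F.augmentation := by
  constructor
  · rw [ShortComplex.ShortExact.moduleCat_exact_iff_function_exact]
    intro x
    refine (F.exact_zero x).trans ?_
    exact exists_congr fun y => by rw [← F.complex_d_hom 0 y]; rfl
  · rw [ModuleCat.epi_iff_surjective]
    exact F.surj

/-- The projective resolution attached to a matrix resolution. -/
noncomputable def projectiveResolution : ProjectiveResolution (ModuleCat.of R D) where
  complex := F.complex
  projective i := by
    change Projective (ModuleCat.of R (Fin (F.b i) → R))
    infer_instance
  π := (ChainComplex.toSingle₀Equiv F.complex (ModuleCat.of R D)).symm
    ⟨F.augmentation, F.d_comp_augmentation⟩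
  quasiIso := ⟨fun n => by
    cases n
    · rw [ChainComplex.quasiIsoAt₀_iff, ShortComplex.quasiIso_iff_of_zeros']
      · refine (ShortComplex.exact_and_epi_g_iff_of_iso ?_).2 F.augmentation_exact
        exact ShortComplex.isoMk (Iso.refl _) (Iso.refl _) (Iso.refl _)
          (by simp; exact (Category.id_comp _).trans (Category.comp_id _).symm)
          (by simp; exact (Category.id_comp _).trans (Category.comp_id _).symm)
      all_goals rfl
    · rw [quasiIsoAt_iff_exactAt']
      · apply complex_exactAt
      · apply ChainComplex.exactAt_succ_single_obj⟩


/-- A tuple defines a map out of a term of the complex of a matrix resolution. -/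
noncomputable def homOfTuple {i : ℕ} (w : Fin (F.b i) → D) :
    F.complex.X i ⟶ ModuleCat.of R D :=
  ModuleCat.ofHom (Fintype.linearCombination R w)

lemma homOfTuple_injective (i : ℕ) : Function.Injective (F.homOfTuple (i := i)) := by
  intro w w' h
  have h' : Fintype.linearCombination R w = Fintype.linearCombination R w' :=
    congrArg ModuleCat.Hom.hom h
  funext j
  simpa using LinearMap.congr_fun h' (Pi.single j 1)

lemma linearCombination_surjective {k : ℕ} (f : (Fin k → R) →ₗ[R] D) :
    Fintype.linearCombination R (fun j => f (Pi.single j 1)) = f := by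
  ext j
  simp

lemma homOfTuple_surjective (i : ℕ) : Function.Surjective (F.homOfTuple (i := i)) := by
  intro f
  refine ⟨fun j => f.hom (Pi.single j 1 : Fin (F.b i) → R), ?_⟩
  apply ModuleCat.hom_ext
  exact linearCombination_surjective (k := F.b i) f.hom

lemma linearCombination_comp_matAct {k l : ℕ} (M : Matrix (Fin k) (Fin l) R) (w : Fin k → D) :
    Fintype.linearCombination R w ∘ₗ matAct M R =
      Fintype.linearCombination R (matAct M.transpose D w) := by
  ext j
  simp [Fintype.linearCombination_apply, matAct_apply, Pi.single_apply]

lemma d_comp_homOfTuple (i : ℕ) (w : Fin (F.b i) → D) :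
    F.complex.d (i + 1) i ≫ F.homOfTuple w =
      F.homOfTuple (matAct (F.M i).transpose D w) := by
  rw [complex_d]
  apply ModuleCat.hom_ext
  exact linearCombination_comp_matAct _ _

lemma homOfTuple_zero (i : ℕ) : F.homOfTuple (0 : Fin (F.b i) → D) = 0 := by
  apply ModuleCat.hom_ext
  apply LinearMap.ext
  intro x
  change ∑ j : Fin (F.b i), x j • (0 : D) = 0
  simp

lemma subsingleton_ext_iff (i : ℕ) :
    Subsingleton (ExtModule R (ModuleCat.of R D) (ModuleCat.of R D) (i + 1)) ↔
      Function.Exact (matAct (F.M i).transpose D) (matAct (F.M (i + 1)).transpose D) := by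
  rw [← ModuleCat.isZero_iff_subsingleton, ExtModule]
  refine (Iso.isZero_iff (F.projectiveResolution.isoExt (i + 1) (ModuleCat.of R D))).trans ?_
  rw [← HomologicalComplex.exactAt_iff_isZero_homology,
    HomologicalComplex.exactAt_iff' _ i (i + 1) (i + 1 + 1) (by simp) (by simp),
    ShortComplex.ShortExact.moduleCat_exact_iff_function_exact]
  constructor
  · intro h w
    have h1 := h (F.homOfTuple w)
    have e1 : F.homOfTuple (matAct (F.M (i + 1)).transpose D w) = 0 ↔
        matAct (F.M (i + 1)).transpose D w = 0 := by
      rw [← F.homOfTuple_zero, (F.homOfTuple_injective _).eq_iff]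
    rw [← e1, ← d_comp_homOfTuple]
    refine h1.trans ?_
    constructor
    · rintro ⟨f, hf⟩
      obtain ⟨v, rfl⟩ := F.homOfTuple_surjective _ f
      refine ⟨v, F.homOfTuple_injective _ ?_⟩
      rw [← d_comp_homOfTuple]
      exact hf
    · rintro ⟨v, rfl⟩
      exact ⟨F.homOfTuple v, F.d_comp_homOfTuple i v⟩
  · intro h f
    obtain ⟨w, rfl⟩ := F.homOfTuple_surjective _ f
    have h1 := h w
    have e1 : F.homOfTuple (matAct (F.M (i + 1)).transpose D w) = 0 ↔
        matAct (F.M (i + 1)).transpose D w = 0 := by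
      rw [← F.homOfTuple_zero, (F.homOfTuple_injective _).eq_iff]
    rw [← e1, ← d_comp_homOfTuple] at h1
    refine h1.trans ?_
    constructor
    · rintro ⟨v, rfl⟩
      exact ⟨F.homOfTuple v, F.d_comp_homOfTuple i v⟩
    · rintro ⟨f, hf⟩
      obtain ⟨v, rfl⟩ := F.homOfTuple_surjective _ f
      refine ⟨v, F.homOfTuple_injective _ ?_⟩
      rw [← d_comp_homOfTuple]
      exact hf

lemma exists_end_iff (w : Fin (F.b 0) → D) :
    matAct (F.M 0).transpose D w = 0 ↔ ∃ φ : Module.End R D, (fun j => φ (F.g j)) = w := by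
  constructor
  · intro h
    have hk : LinearMap.ker (Fintype.linearCombination R F.g) ≤
        LinearMap.ker (Fintype.linearCombination R w) := by
      intro v hv
      obtain ⟨u, rfl⟩ := (F.exact_zero v).1 hv
      have := LinearMap.congr_fun (linearCombination_comp_matAct (F.M 0) w) u
      rw [h] at this
      simpa [Fintype.linearCombination_apply] using this
    refine ⟨(LinearMap.ker (Fintype.linearCombination R F.g)).liftQ _ hk ∘ₗ
      ((Fintype.linearCombination R F.g).quotKerEquivOfSurjective F.surj).symm.toLinearMap, ?_⟩
    funext j
    have : F.g j = (Fintype.linearCombination R F.g).quotKerEquivOfSurjective F.surj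
        (Submodule.Quotient.mk (Pi.single j 1)) := by
      simp
    rw [this]
    simp only [LinearMap.comp_apply, LinearEquiv.coe_coe, LinearEquiv.symm_apply_apply]
    simp
  · rintro ⟨φ, rfl⟩
    have h0 : Fintype.linearCombination R (matAct (F.M 0).transpose D fun j => φ (F.g j)) = 0 := by
      rw [← linearCombination_comp_matAct]
      have : Fintype.linearCombination R (fun j => φ (F.g j)) =
          φ ∘ₗ Fintype.linearCombination R F.g := by
        ext j
        simp
      rw [this, LinearMap.comp_assoc, F.exact_zero.linearMap_comp_eq_zero, LinearMap.comp_zero]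
    funext j
    simpa using LinearMap.congr_fun h0 (Pi.single j 1)

lemma end_ext {φ ψ : Module.End R D} (h : ∀ j, φ (F.g j) = ψ (F.g j)) : φ = ψ := by
  apply LinearMap.ext_on_range (v := F.g) _ h
  rw [← Fintype.range_linearCombination, LinearMap.range_eq_top.2 F.surj]

lemma bijective_homothety_iff :
    Function.Bijective (algebraMap R (Module.End R D)) ↔
      Function.Injective (LinearMap.toSpanSingleton R (Fin (F.b 0) → D) F.g) ∧
      Function.Exact (LinearMap.toSpanSingleton R (Fin (F.b 0) → D) F.g)
        (matAct (F.M 0).transpose D) := by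
  have key : ∀ r : R, LinearMap.toSpanSingleton R (Fin (F.b 0) → D) F.g r =
      fun j => algebraMap R (Module.End R D) r (F.g j) := fun r => by
    funext j
    simp
  refine and_congr ⟨fun h r s hrs => h (F.end_ext fun j => ?_), fun h r s hrs => h ?_⟩ ?_
  · rw [key, key] at hrs
    exact congr_fun hrs j
  · rw [key, key, hrs]
  · constructor
    · intro h w
      rw [F.exists_end_iff]
      constructor
      · rintro ⟨φ, rfl⟩
        obtain ⟨r, rfl⟩ := h φ
        exact ⟨r, key r⟩
      · rintro ⟨r, rfl⟩
        exact ⟨_, (key r).symm⟩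
    · intro h φ
      obtain ⟨r, hr⟩ := (h fun j => φ (F.g j)).1 ((F.exists_end_iff _).2 ⟨φ, rfl⟩)
      refine ⟨r, F.end_ext fun j => ?_⟩
      rw [key] at hr
      exact congr_fun hr j

lemma moduleFinite (F : FreeRes R D) : Module.Finite R D :=
  Module.Finite.of_surjective _ F.surj

lemma isSemidualizing_iff : IsSemidualizing R D ↔ F.DualExact := by
  rw [IsSemidualizing, F.bijective_homothety_iff]
  constructor
  · rintro ⟨-, ⟨h1, h2⟩, h3⟩
    exact ⟨h1, h2, fun i => (F.subsingleton_ext_iff i).1 (h3 (i + 1) i.succ_pos)⟩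
  · rintro ⟨h1, h2, h3⟩
    refine ⟨F.moduleFinite, ⟨h1, h2⟩, fun i hi => ?_⟩
    obtain ⟨i, rfl⟩ := Nat.exists_eq_succ_of_ne_zero hi.ne'
    exact (F.subsingleton_ext_iff i).2 (h3 i)

end FreeRes

lemma isSemidualizing_iff_sd {R D : Type} [CommRing R] [IsNoetherianRing R] [AddCommGroup D]
    [Module R D] : IsSemidualizing R D ↔ SD R D := by
  constructor
  · intro h
    have := h.1
    obtain ⟨F⟩ := exists_freeRes (R := R) D
    exact ⟨F, F.isSemidualizing_iff.1 h⟩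
  · rintro ⟨F, hF⟩
    exact F.isSemidualizing_iff.2 hF

open TensorProduct in
/-- Commutation of `matAct` with base change. -/
lemma piRight_lTensor_matAct {R : Type} [CommRing R] (R' : Type) [CommRing R'] [Algebra R R']
    {k l : ℕ} (M : Matrix (Fin k) (Fin l) R) (N : Type) [AddCommGroup N] [Module R N]
    (x : R' ⊗[R] (Fin l → N)) :
    TensorProduct.piRight R R' R' (fun _ : Fin k => N) ((matAct M N).lTensor R' x) =
      matAct (M.map (algebraMap R R')) (R' ⊗[R] N)
        (TensorProduct.piRight R R' R' (fun _ : Fin l => N) x) := by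
  induction x using TensorProduct.induction_on with
  | zero => simp
  | tmul r v =>
    funext i
    simp [matAct_apply, TensorProduct.tmul_sum]
  | add x y hx hy => simp only [map_add, hx, hy]

open TensorProduct in
lemma piScalarRight_lTensor_matAct {R : Type} [CommRing R] (R' : Type) [CommRing R'] [Algebra R R']
    {k l : ℕ} (M : Matrix (Fin k) (Fin l) R) (x : R' ⊗[R] (Fin l → R)) :
    TensorProduct.piScalarRight R R' R' (Fin k) ((matAct M R).lTensor R' x) =
      matAct (M.map (algebraMap R R')) R'
        (TensorProduct.piScalarRight R R' R' (Fin l) x) := by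
  induction x using TensorProduct.induction_on with
  | zero => simp
  | tmul r v =>
    funext i
    simp [matAct_apply, Algebra.smul_def, Finset.sum_mul, mul_assoc]
  | add x y hx hy => simp only [map_add, hx, hy]

open TensorProduct in
lemma lTensor_linearCombination {R D : Type} [CommRing R] (R' : Type) [CommRing R'] [Algebra R R']
    [AddCommGroup D] [Module R D] {k : ℕ} (g : Fin k → D) (x : R' ⊗[R] (Fin k → R)) :
    (Fintype.linearCombination R g).lTensor R' x =
      Fintype.linearCombination R' (fun j => (1 : R') ⊗ₜ[R] g j)
        (TensorProduct.piScalarRight R R' R' (Fin k) x) := by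
  induction x using TensorProduct.induction_on with
  | zero => simp
  | tmul r v =>
    simp [Fintype.linearCombination_apply, TensorProduct.tmul_sum, TensorProduct.smul_tmul']
  | add x y hx hy => simp only [map_add, hx, hy]

open TensorProduct in
lemma piRight_lTensor_toSpanSingleton {R D : Type} [CommRing R] (R' : Type) [CommRing R']
    [Algebra R R'] [AddCommGroup D] [Module R D] {k : ℕ} (g : Fin k → D) (x : R' ⊗[R] R) :
    TensorProduct.piRight R R' R' (fun _ : Fin k => D)
      ((LinearMap.toSpanSingleton R (Fin k → D) g).lTensor R' x) =
      LinearMap.toSpanSingleton R' (Fin k → R' ⊗[R] D) (fun j => (1 : R') ⊗ₜ[R] g j)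
        (TensorProduct.rid R R' x) := by
  induction x using TensorProduct.induction_on with
  | zero => simp
  | tmul r v =>
    funext i
    simp [TensorProduct.smul_tmul']
  | add x y hx hy => simp only [map_add, hx, hy, LinearMap.toSpanSingleton_apply]

lemma exact_congr {A B C A' B' C' : Type*} [Zero C] [Zero C'] {f : A → B} {g : B → C} {f' : A' → B'}
    {g' : B' → C'} (e₁ : A ≃ A') (e₂ : B ≃ B') (e₃ : C ≃ C') (h₀ : e₃ 0 = 0)
    (h₁ : ∀ x, e₂ (f x) = f' (e₁ x)) (h₂ : ∀ x, e₃ (g x) = g' (e₂ x)) :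
    Function.Exact f g ↔ Function.Exact f' g' := by
  have key : ∀ y, (g y = 0 ↔ y ∈ Set.range f) ↔ (g' (e₂ y) = 0 ↔ e₂ y ∈ Set.range f') := by
    intro y
    refine iff_congr ?_ ?_
    · rw [← h₂, ← h₀, e₃.apply_eq_iff_eq]
    · constructor
      · rintro ⟨x, rfl⟩
        exact ⟨e₁ x, (h₁ x).symm⟩
      · rintro ⟨x, hx⟩
        refine ⟨e₁.symm x, e₂.injective ?_⟩
        rw [h₁, Equiv.apply_symm_apply, hx]
  constructor
  · intro h y
    obtain ⟨y, rfl⟩ := e₂.surjective y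
    exact (key y).1 (h y)
  · intro h y
    exact (key y).2 (h _)

namespace FreeRes

open TensorProduct

variable {R D : Type} [CommRing R] [AddCommGroup D] [Module R D]

/-- Flat base change of a matrix resolution. -/
noncomputable def baseChange (F : FreeRes R D) (R' : Type) [CommRing R'] [Algebra R R']
    [Module.Flat R R'] : FreeRes R' (R' ⊗[R] D) where
  b := F.b
  M i := (F.M i).map (algebraMap R R')
  g j := 1 ⊗ₜ[R] F.g j
  surj := by
    intro d
    obtain ⟨x, rfl⟩ := LinearMap.lTensor_surjective R' F.surj d
    exact ⟨_, (lTensor_linearCombination R' F.g x).symm⟩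
  exact_zero := by
    refine (exact_congr (TensorProduct.piScalarRight R R' R' (Fin _)).toEquiv
      (TensorProduct.piScalarRight R R' R' (Fin _)).toEquiv (Equiv.refl _) rfl ?_ ?_).1
      (Module.Flat.lTensor_exact R' F.exact_zero)
    · exact piScalarRight_lTensor_matAct R' _
    · exact lTensor_linearCombination R' _
  exact_succ i := by
    refine (exact_congr (TensorProduct.piScalarRight R R' R' (Fin _)).toEquiv
      (TensorProduct.piScalarRight R R' R' (Fin _)).toEquiv
      (TensorProduct.piScalarRight R R' R' (Fin _)).toEquiv (by simp) ?_ ?_).1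
      (Module.Flat.lTensor_exact R' (F.exact_succ i))
    · exact piScalarRight_lTensor_matAct R' _
    · exact piScalarRight_lTensor_matAct R' _

variable (F : FreeRes R D) (R' : Type) [CommRing R'] [Algebra R R']

lemma inj_baseChange_iff [Module.Flat R R'] :
    Function.Injective (LinearMap.toSpanSingleton R' (Fin (F.b 0) → R' ⊗[R] D)
      (F.baseChange R').g) ↔
    Function.Injective ((LinearMap.toSpanSingleton R (Fin (F.b 0) → D) F.g).lTensor R') := by
  have h : (TensorProduct.piRight R R' R' (fun _ : Fin (F.b 0) => D)) ∘
      ((LinearMap.toSpanSingleton R (Fin (F.b 0) → D) F.g).lTensor R') =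
      (LinearMap.toSpanSingleton R' (Fin (F.b 0) → R' ⊗[R] D)
      (F.baseChange R').g) ∘ (TensorProduct.rid R R') :=
    funext (piRight_lTensor_toSpanSingleton R' F.g)
  constructor
  · intro hi
    apply Function.Injective.of_comp (f := TensorProduct.piRight R R' R' (fun _ : Fin (F.b 0) => D))
    rw [h]
    exact hi.comp (TensorProduct.rid R R').injective
  · intro hi
    rw [← Function.Injective.of_comp_iff' _ (TensorProduct.rid R R').bijective, ← h]
    exact (LinearEquiv.injective _).comp hi

lemma coexact_zero_baseChange_iff [Module.Flat R R'] :
    Function.Exact (LinearMap.toSpanSingleton R' (Fin (F.b 0) → R' ⊗[R] D) (F.baseChange R').g)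
      (matAct ((F.baseChange R').M 0).transpose (R' ⊗[R] D)) ↔
    Function.Exact ((LinearMap.toSpanSingleton R (Fin (F.b 0) → D) F.g).lTensor R')
      ((matAct (F.M 0).transpose D).lTensor R') := by
  refine (exact_congr (TensorProduct.rid R R').toEquiv
    (TensorProduct.piRight R R' R' (fun _ : Fin _ => D)).toEquiv
    (TensorProduct.piRight R R' R' (fun _ : Fin _ => D)).toEquiv (by simp) ?_ ?_).symm
  · exact piRight_lTensor_toSpanSingleton R' F.g
  · exact piRight_lTensor_matAct R' (F.M 0).transpose D

lemma coexact_succ_baseChange_iff [Module.Flat R R'] (i : ℕ) :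
    Function.Exact (matAct ((F.baseChange R').M i).transpose (R' ⊗[R] D))
      (matAct ((F.baseChange R').M (i + 1)).transpose (R' ⊗[R] D)) ↔
    Function.Exact ((matAct (F.M i).transpose D).lTensor R')
      ((matAct (F.M (i + 1)).transpose D).lTensor R') := by
  refine (exact_congr (TensorProduct.piRight R R' R' (fun _ : Fin _ => D)).toEquiv
    (TensorProduct.piRight R R' R' (fun _ : Fin _ => D)).toEquiv
    (TensorProduct.piRight R R' R' (fun _ : Fin _ => D)).toEquiv (by simp) ?_ ?_).symm
  · exact piRight_lTensor_matAct R' (F.M i).transpose D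
  · exact piRight_lTensor_matAct R' (F.M (i + 1)).transpose D

variable {F}

lemma DualExact.baseChange [Module.Flat R R'] (h : F.DualExact) : (F.baseChange R').DualExact where
  inj := (F.inj_baseChange_iff R').2 (Module.Flat.lTensor_preserves_injective_linearMap _ h.inj)
  coexact_zero := (F.coexact_zero_baseChange_iff R').2 (Module.Flat.lTensor_exact R' h.coexact_zero)
  coexact_succ i := (F.coexact_succ_baseChange_iff R' i).2
    (Module.Flat.lTensor_exact R' (h.coexact_succ i))

lemma DualExact.of_baseChange [Module.FaithfullyFlat R R'] (h : (F.baseChange R').DualExact) :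
    F.DualExact where
  inj := (Module.FaithfullyFlat.lTensor_injective_iff_injective R R' _).1
    ((F.inj_baseChange_iff R').1 h.inj)
  coexact_zero := (Module.FaithfullyFlat.lTensor_exact_iff_exact R R' _ _).1
    ((F.coexact_zero_baseChange_iff R').1 h.coexact_zero)
  coexact_succ i := (Module.FaithfullyFlat.lTensor_exact_iff_exact R R' _ _).1
    ((F.coexact_succ_baseChange_iff R' i).1 (h.coexact_succ i))

end FreeRes

open TensorProduct in
lemma SD.baseChange {R D : Type} [CommRing R] [AddCommGroup D] [Module R D] (h : SD R D)
    (R' : Type) [CommRing R'] [Algebra R R'] [Module.Flat R R'] : SD R' (R' ⊗[R] D) := by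
  obtain ⟨F, hF⟩ := h
  exact ⟨F.baseChange R', hF.baseChange R'⟩

open TensorProduct in
lemma SD.of_baseChange {R D : Type} [CommRing R] [IsNoetherianRing R] [AddCommGroup D] [Module R D]
    [Module.Finite R D] (R' : Type) [CommRing R'] [IsNoetherianRing R'] [Algebra R R']
    [Module.FaithfullyFlat R R'] (h : SD R' (R' ⊗[R] D)) : SD R D := by
  obtain ⟨F⟩ := exists_freeRes (R := R) D
  rw [← isSemidualizing_iff_sd, (F.baseChange R').isSemidualizing_iff] at h
  exact ⟨F, h.of_baseChange R'⟩

lemma SD.of_linearEquiv {R D D' : Type} [CommRing R] [AddCommGroup D] [Module R D]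
    [AddCommGroup D'] [Module R D'] (h : SD R D) (e : D ≃ₗ[R] D') : SD R D' := by
  obtain ⟨F, hF⟩ := h
  have hm : ∀ {k l : ℕ} (M : Matrix (Fin k) (Fin l) R) (x : Fin l → D),
      (LinearEquiv.piCongrRight fun _ : Fin k => e) (matAct M D x) =
      matAct M D' ((LinearEquiv.piCongrRight fun _ : Fin l => e) x) := by
    intro k l M x
    funext i
    simp [matAct_apply]
  have hs : ∀ r, (LinearEquiv.piCongrRight fun _ : Fin (F.b 0) => e)
      (LinearMap.toSpanSingleton R (Fin (F.b 0) → D) F.g r) =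
      LinearMap.toSpanSingleton R (Fin (F.b 0) → D') (fun j => e (F.g j)) r := by
    intro r
    funext j
    simp
  have hl : ∀ x, e (Fintype.linearCombination R F.g x) =
      Fintype.linearCombination R (fun j => e (F.g j)) x := by
    intro x
    simp [Fintype.linearCombination_apply]
  refine ⟨⟨F.b, F.M, fun j => e (F.g j), ?_, ?_, F.exact_succ⟩, ?_, ?_, ?_⟩
  · intro d
    obtain ⟨x, hx⟩ := F.surj (e.symm d)
    exact ⟨x, by rw [← hl, hx, e.apply_symm_apply]⟩
  · exact (exact_congr (f' := matAct (F.M 0) R) (Equiv.refl _) (Equiv.refl _) e.toEquiv (by simp)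
      (fun _ => rfl) hl).1 F.exact_zero
  · intro r s hrs
    apply hF.inj
    apply (LinearEquiv.piCongrRight fun _ : Fin (F.b 0) => e).injective
    rw [hs, hs]
    exact hrs
  · exact (exact_congr (Equiv.refl _) (LinearEquiv.piCongrRight fun _ => e).toEquiv
      (LinearEquiv.piCongrRight fun _ => e).toEquiv (by simp) hs (hm _)).1 hF.coexact_zero
  · exact fun i => (exact_congr (LinearEquiv.piCongrRight fun _ => e).toEquiv
      (LinearEquiv.piCongrRight fun _ => e).toEquiv
      (LinearEquiv.piCongrRight fun _ => e).toEquiv (by simp) (hm _) (hm _)).1 (hF.coexact_succ i)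

lemma SD.smul_eq_zero {R D : Type} [CommRing R] [IsNoetherianRing R] [AddCommGroup D] [Module R D]
    (h : SD R D) {x : R} (hx : ∀ r, x * r = 0 → r = 0) {d : D} (hd : x • d = 0) : d = 0 := by
  obtain ⟨hf, ⟨hinj, hsurj⟩, -⟩ := isSemidualizing_iff_sd.2 h
  have hann : ∀ r : R, (∀ d : D, r • d = 0) → r = 0 := fun r hr => hinj (by
    ext d
    simp [hr])
  have hsub : Subsingleton ((D ⧸ (Ideal.span {x} • ⊤ : Submodule R D)) →ₗ[R] D) := by
    refine ⟨fun f g => sub_eq_zero.1 ?_⟩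
    generalize f - g = f
    obtain ⟨r, hr⟩ := hsurj (f ∘ₗ Submodule.mkQ _)
    have hr' : ∀ d, r • d = f (Submodule.Quotient.mk d) := fun d => LinearMap.congr_fun hr d
    have h0 : r = 0 := by
      apply hx
      apply hann
      intro d
      rw [mul_smul, hr', ← map_smul, ← Submodule.Quotient.mk_smul,
        (Submodule.Quotient.mk_eq_zero _).2, map_zero]
      exact Submodule.smul_mem_smul (Ideal.mem_span_singleton_self x) trivial
    apply LinearMap.ext
    intro y
    obtain ⟨d, rfl⟩ := Submodule.Quotient.mk_surjective _ y
    rw [← hr', h0, zero_smul, LinearMap.zero_apply]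
  obtain ⟨r, hrann, hreg⟩ := IsSMulRegular.subsingleton_linearMap_iff.1 hsub
  have hrange : LinearMap.range (algebraMap R (Module.End R D) r) ≤
      Ideal.span {x} • (⊤ : Submodule R D) := by
    rintro _ ⟨d, rfl⟩
    have := Module.mem_annihilator.1 hrann (Submodule.Quotient.mk d)
    rwa [← Submodule.Quotient.mk_smul, Submodule.Quotient.mk_eq_zero] at this
  obtain ⟨p, hmonic, -, hcoeff, hp⟩ :=
    LinearMap.exists_monic_and_natDegree_eq_and_coeff_mem_pow_and_aeval_eq_zero
      R _ (Ideal.span {x}) hrange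
  have hp0 : p.eval r = 0 := by
    apply hinj
    rw [map_zero, ← hp, Polynomial.aeval_algebraMap_apply, Polynomial.coe_aeval_eq_eval]
  have hmem : r ^ p.natDegree ∈ Ideal.span {x} := by
    rw [Polynomial.eval_eq_sum_range, Finset.sum_range_succ, hmonic.coeff_natDegree, one_mul] at hp0
    rw [eq_neg_of_add_eq_zero_right hp0]
    refine neg_mem (sum_mem fun i hi => Ideal.mul_mem_right _ _ ?_)
    have := hcoeff i
    refine Ideal.pow_le_self ?_ this
    have := Finset.mem_range.1 hi
    omega
  obtain ⟨s, hs⟩ := Ideal.mem_span_singleton'.1 hmem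
  apply (hreg.pow p.natDegree)
  simp only [smul_zero]
  rw [← hs, mul_smul, hd, smul_zero]

lemma exact_mod {R A B C A' B' C' : Type} [CommRing R] [AddCommGroup A] [Module R A]
    [AddCommGroup B] [Module R B] [AddCommGroup C] [Module R C] [AddCommGroup A'] [Module R A']
    [AddCommGroup B'] [Module R B'] [AddCommGroup C'] [Module R C'] (x : R)
    {f : A →ₗ[R] B} {g : B →ₗ[R] C} {f' : A' → B'} {g' : B' → C'}
    (pA : A →ₗ[R] A') (pB : B →ₗ[R] B') (pC : C →ₗ[R] C')
    (hA : Function.Surjective pA) (hB : Function.Surjective pB) (hBx : ∀ b, pB (x • b) = 0)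
    (hC : ∀ c, pC c = 0 → ∃ c', c = x • c') (h : Function.Exact f g)
    (hstar : ∀ c b, g b = x • c → ∃ b', c = g b')
    (h₁ : ∀ a, pB (f a) = f' (pA a)) (h₂ : ∀ b, pC (g b) = g' (pB b)) :
    Function.Exact f' g' := by
  intro b'
  obtain ⟨b, rfl⟩ := hB b'
  constructor
  · intro hb
    rw [← h₂] at hb
    obtain ⟨c, hc⟩ := hC _ hb
    obtain ⟨b₂, rfl⟩ := hstar c b hc
    obtain ⟨a, ha⟩ := (h (b - x • b₂)).1 (by rw [map_sub, map_smul, hc, sub_self])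
    refine ⟨pA a, ?_⟩
    rw [← h₁, ha, map_sub, hBx, sub_zero]
  · rintro ⟨a', ha⟩
    obtain ⟨a, rfl⟩ := hA a'
    rw [← ha, ← h₁, ← h₂, h.apply_apply_eq_zero, map_zero]

lemma exact_star {R B C E : Type} [CommRing R] [AddCommGroup B] [Module R B] [AddCommGroup C]
    [Module R C] [AddCommGroup E] [Module R E] {x : R} {g : B →ₗ[R] C} {k : C →ₗ[R] E}
    (h : Function.Exact g k) (hx : ∀ e : E, x • e = 0 → e = 0) (c : C) (b : B)
    (hb : g b = x • c) : ∃ b', c = g b' := by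
  obtain ⟨b', hb'⟩ := (h c).1 (hx _ (by rw [← map_smul, ← hb, h.apply_apply_eq_zero]))
  exact ⟨b', hb'.symm⟩

/-- Reduction of a semidualizing module modulo a regular element. -/
lemma SD.reduction {R D R' D' : Type} [CommRing R] [IsNoetherianRing R] [AddCommGroup D]
    [Module R D] [CommRing R'] [Algebra R R'] [AddCommGroup D'] [Module R D'] [Module R' D']
    [IsScalarTower R R' D'] (h : SD R D) {x : R} (hx : ∀ r, x * r = 0 → r = 0)
    (hR : Function.Surjective (algebraMap R R'))
    (hRx : ∀ r, algebraMap R R' r = 0 ↔ ∃ s, r = x * s)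
    (π : D →ₗ[R] D') (hπ : Function.Surjective π) (hπx : ∀ d, π d = 0 ↔ ∃ d', d = x • d') :
    SD R' D' := by
  have hD : ∀ d : D, x • d = 0 → d = 0 := fun d => h.smul_eq_zero hx
  obtain ⟨F, hF⟩ := h
  have hDn : ∀ n (d : Fin n → D), x • d = 0 → d = 0 := fun n d hd =>
    funext fun j => hD _ (congr_fun hd j)
  have hRn : ∀ n (d : Fin n → R), x • d = 0 → d = 0 := fun n d hd =>
    funext fun j => hx _ (congr_fun hd j)
  have sD : ∀ n, Function.Surjective (π.compLeft (Fin n)) := fun n v => by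
    choose w hw using fun j => hπ (v j)
    exact ⟨w, funext hw⟩
  have kD : ∀ n (v : Fin n → D), π.compLeft (Fin n) v = 0 → ∃ w, v = x • w := fun n v hv => by
    choose w hw using fun j => (hπx (v j)).1 (congr_fun hv j)
    exact ⟨w, funext hw⟩
  have zD : ∀ n (v : Fin n → D), π.compLeft (Fin n) (x • v) = 0 := fun n v =>
    funext fun j => (hπx _).2 ⟨v j, rfl⟩
  let ρ : R →ₗ[R] R' := Algebra.linearMap R R'
  have sR : ∀ n, Function.Surjective (ρ.compLeft (Fin n)) := fun n v => by
    choose w hw using fun j => hR (v j)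
    exact ⟨w, funext hw⟩
  have kR : ∀ n (v : Fin n → R), ρ.compLeft (Fin n) v = 0 → ∃ w, v = x • w := fun n v hv => by
    choose w hw using fun j => (hRx (v j)).1 (congr_fun hv j)
    exact ⟨w, funext hw⟩
  have zR : ∀ n (v : Fin n → R), ρ.compLeft (Fin n) (x • v) = 0 := fun n v =>
    funext fun j => (hRx _).2 ⟨v j, rfl⟩
  have cD : ∀ {k l} (M : Matrix (Fin k) (Fin l) R) (v : Fin l → D),
      π.compLeft (Fin k) (matAct M D v) =
        matAct (M.map (algebraMap R R')) D' (π.compLeft (Fin l) v) := fun M v => by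
    funext i
    simp [matAct_apply]
  have cR : ∀ {k l} (M : Matrix (Fin k) (Fin l) R) (v : Fin l → R),
      ρ.compLeft (Fin k) (matAct M R v) =
        matAct (M.map (algebraMap R R')) R' (ρ.compLeft (Fin l) v) := fun M v => by
    funext i
    simp [matAct_apply, ρ]
  have cl : ∀ v, π (Fintype.linearCombination R F.g v) =
      Fintype.linearCombination R' (fun j => π (F.g j)) (ρ.compLeft _ v) := fun v => by
    simp [Fintype.linearCombination_apply, ρ]
  have cs : ∀ r, π.compLeft (Fin (F.b 0)) (LinearMap.toSpanSingleton R (Fin (F.b 0) → D) F.g r) =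
      LinearMap.toSpanSingleton R' (Fin (F.b 0) → D') (fun j => π (F.g j)) (ρ r) := fun r => by
    funext j
    simp [ρ]
  refine ⟨⟨F.b, fun i => (F.M i).map (algebraMap R R'), fun j => π (F.g j), ?_, ?_, ?_⟩, ?_, ?_, ?_⟩
  · intro d'
    obtain ⟨d, rfl⟩ := hπ d'
    obtain ⟨v, rfl⟩ := F.surj d
    exact ⟨_, (cl v).symm⟩
  · exact exact_mod x (ρ.compLeft _) (ρ.compLeft _) π (sR _) (sR _) (zR _)
      (fun d => (hπx d).1) F.exact_zero (fun d _ _ => (F.surj d).imp fun _ h => h.symm) (cR _) cl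
  · intro i
    refine exact_mod x (ρ.compLeft _) (ρ.compLeft _) (ρ.compLeft _) (sR _) (sR _) (zR _)
      (kR _) (F.exact_succ i) ?_ (cR _) (cR _)
    cases i with
    | zero => exact exact_star F.exact_zero hD
    | succ i => exact exact_star (F.exact_succ i) (hRn _)
  · intro r' s' hrs
    rw [← sub_eq_zero, ← map_sub] at hrs
    rw [← sub_eq_zero]
    generalize r' - s' = t' at hrs ⊢
    obtain ⟨t, rfl⟩ := hR t'
    have h0 : π.compLeft (Fin (F.b 0))
        (LinearMap.toSpanSingleton R (Fin (F.b 0) → D) F.g t) = 0 := (cs t).trans hrs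
    obtain ⟨w, hw⟩ := kD _ _ h0
    obtain ⟨s, rfl⟩ := exact_star hF.coexact_zero (hDn _) w t hw
    refine (hRx t).2 ⟨s, hF.inj ?_⟩
    rw [hw, ← map_smul, smul_eq_mul]
  · exact exact_mod x ρ (π.compLeft _) (π.compLeft _) hR (sD _) (zD _) (kD _)
      hF.coexact_zero (exact_star (hF.coexact_succ 0) (hDn _)) cs (cD _)
  · intro i
    exact exact_mod x (π.compLeft _) (π.compLeft _) (π.compLeft _) (sD _) (sD _) (zD _) (kD _)
      (hF.coexact_succ i) (exact_star (hF.coexact_succ (i + 1)) (hDn _)) (cD _) (cD _)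

/-- The list is a weakly regular sequence modulo `I`. -/
def WReg {R : Type} [CommRing R] : Ideal R → List R → Prop
  | _, [] => True
  | I, x :: t => (∀ f, x * f ∈ I → f ∈ I) ∧ WReg (I ⊔ Ideal.span {x}) t

lemma SD.mem_of_forall_smul_mem_aux {R D : Type} [CommRing R] [IsNoetherianRing R] [AddCommGroup D]
    [Module R D] (t : List R) : ∀ (I : Ideal R), SD (R ⧸ I) (D ⧸ (I • ⊤ : Submodule R D)) →
    WReg I t → ∀ w : R, (∀ d : D, w • d ∈ ((I ⊔ Ideal.span {x | x ∈ t}) • ⊤ : Submodule R D)) →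
    w ∈ I ⊔ Ideal.span {x | x ∈ t} := by
  induction t with
  | nil =>
    intro I ⟨F, hF⟩ _ w hw
    simp only [List.not_mem_nil, Set.ofPred_false, Ideal.span_empty, sup_bot_eq] at hw ⊢
    rw [← Ideal.Quotient.eq_zero_iff_mem]
    apply hF.inj
    rw [map_zero]
    funext j
    obtain ⟨d, hd⟩ := Submodule.Quotient.mk_surjective _ (F.g j)
    simp only [LinearMap.toSpanSingleton_apply, Pi.smul_apply, Pi.zero_apply, ← hd]
    exact (Submodule.Quotient.mk_eq_zero _).2 (hw d)
  | cons x t ih =>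
    intro I hI hreg w hw
    have hI' : I ⊔ Ideal.span {y | y ∈ x :: t} =
        (I ⊔ Ideal.span {x}) ⊔ Ideal.span {y | y ∈ t} := by
      rw [sup_assoc, ← Ideal.span_union]
      congr 2
      ext y
      simp
    rw [hI'] at hw ⊢
    refine ih _ ?_ hreg.2 w hw
    set I' := I ⊔ Ideal.span {x} with hI'def
    have hle : I ≤ I' := le_sup_left
    let _ : Algebra (R ⧸ I) (R ⧸ I') := (Ideal.Quotient.factor hle).toAlgebra
    let _ : Module (R ⧸ I) (D ⧸ (I' • ⊤ : Submodule R D)) :=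
      Module.compHom _ (Ideal.Quotient.factor hle)
    have _ : IsScalarTower (R ⧸ I) (R ⧸ I') (D ⧸ (I' • ⊤ : Submodule R D)) :=
      ⟨fun a b c => by
        change (Ideal.Quotient.factor hle a * b) • c = Ideal.Quotient.factor hle a • b • c
        rw [mul_smul]⟩
    have hsup : ∀ d : D, d ∈ (I' • ⊤ : Submodule R D) ↔
        ∃ d', d - x • d' ∈ (I • ⊤ : Submodule R D) := by
      intro d
      rw [hI'def, Submodule.sup_smul, Submodule.mem_sup]
      constructor
      · rintro ⟨y, hy, z, hz, rfl⟩
        rw [Submodule.ideal_span_singleton_smul] at hz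
        obtain ⟨d', -, rfl⟩ := (Submodule.mem_smul_pointwise_iff_exists _ _ _).1 hz
        exact ⟨d', by simpa using hy⟩
      · rintro ⟨d', hd'⟩
        exact ⟨_, hd', x • d', Submodule.smul_mem_smul (Ideal.mem_span_singleton_self x) trivial,
          by simp⟩
    refine hI.reduction (x := Ideal.Quotient.mk I x) ?_ ?_ ?_
      { toFun := Submodule.mapQ (I • ⊤ : Submodule R D) (I' • ⊤ : Submodule R D) LinearMap.id
          (Submodule.smul_mono_left hle)
        map_add' := fun a b => map_add _ a b
        map_smul' := ?_ } ?_ ?_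
    · intro r hr
      obtain ⟨r, rfl⟩ := Ideal.Quotient.mk_surjective r
      rw [← map_mul, Ideal.Quotient.eq_zero_iff_mem] at hr
      exact Ideal.Quotient.eq_zero_iff_mem.2 (hreg.1 r hr)
    · exact Ideal.Quotient.factor_surjective hle
    · intro r
      obtain ⟨r, rfl⟩ := Ideal.Quotient.mk_surjective r
      change Ideal.Quotient.mk I' r = 0 ↔ _
      rw [Ideal.Quotient.eq_zero_iff_mem, hI'def]
      constructor
      · intro h
        obtain ⟨y, hy, z, hz, rfl⟩ := Submodule.mem_sup.1 h
        obtain ⟨s, rfl⟩ := Ideal.mem_span_singleton'.1 hz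
        refine ⟨Ideal.Quotient.mk I s, ?_⟩
        rw [map_add, Ideal.Quotient.eq_zero_iff_mem.2 hy, zero_add, mul_comm, map_mul]
      · rintro ⟨s, hs⟩
        obtain ⟨s, rfl⟩ := Ideal.Quotient.mk_surjective s
        rw [← map_mul, Ideal.Quotient.eq] at hs
        rw [← sub_add_cancel r (x * s)]
        exact add_mem (Ideal.mem_sup_left hs)
          (Ideal.mem_sup_right (Ideal.mul_mem_right _ _ (Ideal.mem_span_singleton_self x)))
    · intro r d
      obtain ⟨r, rfl⟩ := Ideal.Quotient.mk_surjective r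
      obtain ⟨d, rfl⟩ := Submodule.Quotient.mk_surjective _ d
      rfl
    · intro d
      obtain ⟨d, rfl⟩ := Submodule.Quotient.mk_surjective _ d
      exact ⟨Submodule.Quotient.mk d, rfl⟩
    · intro d
      obtain ⟨d, rfl⟩ := Submodule.Quotient.mk_surjective _ d
      change (Submodule.Quotient.mk d : D ⧸ (I' • ⊤ : Submodule R D)) = 0 ↔ _
      rw [Submodule.Quotient.mk_eq_zero, hsup]
      constructor
      · rintro ⟨d', hd'⟩
        exact ⟨Submodule.Quotient.mk d', (Submodule.Quotient.eq _).2 hd'⟩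
      · rintro ⟨d', hd'⟩
        obtain ⟨d', rfl⟩ := Submodule.Quotient.mk_surjective _ d'
        exact ⟨d', (Submodule.Quotient.eq _).1 hd'⟩

lemma SD.mem_of_forall_smul_mem {R D : Type} [CommRing R] [IsNoetherianRing R] [AddCommGroup D]
    [Module R D] (h : SD R D) {t : List R} (ht : WReg ⊥ t) {w : R}
    (hw : ∀ d : D, w • d ∈ (Ideal.span {x | x ∈ t} • ⊤ : Submodule R D)) :
    w ∈ Ideal.span {x | x ∈ t} := by
  have hflat : Module.Flat R (R ⧸ (⊥ : Ideal R)) :=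
    Module.Flat.of_linearEquiv (Submodule.quotEquivOfEqBot ⊥ rfl)
  have h1 := (h.baseChange (R ⧸ (⊥ : Ideal R))).of_linearEquiv
    ((TensorProduct.quotTensorEquivQuotSMul D (⊥ : Ideal R)).extendScalarsOfSurjective
      (S := R ⧸ (⊥ : Ideal R)) Ideal.Quotient.mk_surjective)
  have := SD.mem_of_forall_smul_mem_aux t ⊥ h1 ht w (by simpa only [bot_sup_eq] using hw)
  simpa only [bot_sup_eq] using this

lemma SD.finrank_eq_one {K V : Type} [Field K] [AddCommGroup V] [Module K V] (h : SD K V) :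
    Module.finrank K V = 1 := by
  obtain ⟨hf, hb, -⟩ := isSemidualizing_iff_sd.2 h
  have := (LinearEquiv.ofBijective (Algebra.linearMap K (Module.End K V)) hb).finrank_eq
  rw [Module.finrank_self, Module.finrank_linearMap] at this
  exact Nat.eq_one_of_mul_eq_one_right this.symm

/-- A semidualizing module over a domain is isomorphic to a nonzero ideal. -/
lemma SD.exists_ideal {R D : Type} [CommRing R] [IsDomain R] [IsNoetherianRing R]
    [AddCommGroup D] [Module R D] (h : SD R D) :
    ∃ J : Ideal R, J ≠ ⊥ ∧ Nonempty (D ≃ₗ[R] J) := by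
  have hfin : Module.Finite R D := (isSemidualizing_iff_sd.2 h).1
  have hfr := (h.baseChange (FractionRing R)).finrank_eq_one
  let e : TensorProduct R (FractionRing R) D ≃ₗ[FractionRing R] FractionRing R :=
    LinearEquiv.ofFinrankEq _ _ (by rw [hfr, Module.finrank_self])
  let φ : D →ₗ[R] FractionRing R :=
    (e.toLinearMap.restrictScalars R) ∘ₗ TensorProduct.mk R (FractionRing R) D 1
  have hφ : Function.Injective φ := by
    rw [injective_iff_map_eq_zero]
    intro d hd
    have h0 : TensorProduct.mk R (FractionRing R) D 1 d = 0 := e.map_eq_zero_iff.1 hd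
    rw [IsLocalizedModule.eq_zero_iff (nonZeroDivisors R)] at h0
    obtain ⟨c, hc⟩ := h0
    refine h.smul_eq_zero (x := c) (fun r hr => ?_) hc
    exact (mul_eq_zero.1 hr).resolve_left (nonZeroDivisors.ne_zero c.2)
  obtain ⟨a, ha, hN⟩ := FractionalIdeal.isFractional_of_fg (S := nonZeroDivisors R)
    (I := LinearMap.range φ) (Module.Finite.iff_fg.1 inferInstance)
  have ha0 : algebraMap R (FractionRing R) a ≠ 0 := by
    simpa using nonZeroDivisors.ne_zero ha
  have hinj : Function.Injective (Algebra.linearMap R (FractionRing R)) :=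
    IsFractionRing.injective R (FractionRing R)
  let ψ₀ : D →ₗ[R] LinearMap.range (Algebra.linearMap R (FractionRing R)) :=
    LinearMap.codRestrict _ (a • φ) fun d => by
      obtain ⟨r, hr⟩ := hN (φ d) ⟨d, rfl⟩
      exact ⟨r, hr⟩
  let ψ : D →ₗ[R] R := (LinearEquiv.ofInjective _ hinj).symm.toLinearMap ∘ₗ ψ₀
  have hψ : Function.Injective ψ := by
    refine (LinearEquiv.ofInjective _ hinj).symm.injective.comp ?_
    intro d d' hd
    have : a • φ d = a • φ d' := congrArg Subtype.val hd
    rw [Algebra.smul_def, Algebra.smul_def] at this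
    exact hφ (mul_left_cancel₀ ha0 this)
  refine ⟨LinearMap.range ψ, ?_, ⟨LinearEquiv.ofInjective ψ hψ⟩⟩
  intro hbot
  have hz : ∀ d : D, d = 0 := fun d => hψ (by
    rw [map_zero]
    have : ψ d ∈ LinearMap.range ψ := ⟨d, rfl⟩
    rwa [hbot] at this)
  have : Subsingleton (TensorProduct R (FractionRing R) D) := by
    have : Subsingleton D := ⟨fun a b => (hz a).trans (hz b).symm⟩
    infer_instance
  rw [Module.finrank_zero_of_subsingleton] at hfr
  exact zero_ne_one hfr

/-- An ideal `J` is divisorially saturated: `y f ∈ J` implies `f ∈ J` if `y` is regular modulo a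
nonzero element of `J`. -/
def DivSat {R : Type} [CommRing R] (J : Ideal R) : Prop :=
  ∀ x ∈ J, x ≠ 0 → ∀ y : R, (∀ g, y * g ∈ Ideal.span {x} → g ∈ Ideal.span {x}) →
    ∀ f, y * f ∈ J → f ∈ J

lemma SD.divSat {R : Type} [CommRing R] [IsDomain R] [IsNoetherianRing R] {J : Ideal R}
    (h : SD R J) : DivSat J := by
  intro x hxJ hx y hy f hf
  let I : Ideal R := Ideal.span {x}
  have hred : SD (R ⧸ I) (J ⧸ (I • ⊤ : Submodule R J)) := by
    refine h.reduction (x := x) (fun r hr => (mul_eq_zero.1 hr).resolve_left hx)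
      Ideal.Quotient.mk_surjective (fun r => ?_) (Submodule.mkQ _) (Submodule.mkQ_surjective _)
      (fun d => ?_)
    · rw [Ideal.Quotient.algebraMap_eq, Ideal.Quotient.eq_zero_iff_mem, Ideal.mem_span_singleton]
      rfl
    · rw [Submodule.mkQ_apply, Submodule.Quotient.mk_eq_zero, Submodule.ideal_span_singleton_smul,
        Submodule.mem_smul_pointwise_iff_exists]
      simp [eq_comm]
  have hfx : x * f ∈ J := Ideal.mul_mem_right _ _ hxJ
  have h0 : (Submodule.Quotient.mk ⟨x * f, hfx⟩ : J ⧸ (I • ⊤ : Submodule R J)) = 0 := by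
    refine hred.smul_eq_zero (x := Ideal.Quotient.mk I y) (fun r hr => ?_) ?_
    · obtain ⟨r, rfl⟩ := Ideal.Quotient.mk_surjective r
      rw [← map_mul, Ideal.Quotient.eq_zero_iff_mem] at hr
      exact Ideal.Quotient.eq_zero_iff_mem.2 (hy r hr)
    · change (Submodule.Quotient.mk (y • ⟨x * f, hfx⟩) : J ⧸ (I • ⊤ : Submodule R J)) = 0
      rw [Submodule.Quotient.mk_eq_zero]
      have : (y • ⟨x * f, hfx⟩ : J) = x • ⟨y * f, hf⟩ := by
        ext
        simp [mul_left_comm]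
      rw [this]
      exact Submodule.smul_mem_smul (Ideal.mem_span_singleton_self x) trivial
  rw [Submodule.Quotient.mk_eq_zero, Submodule.ideal_span_singleton_smul,
    Submodule.mem_smul_pointwise_iff_exists] at h0
  obtain ⟨⟨b, hb⟩, -, hbx⟩ := h0
  have : x * b = x * f := congrArg Subtype.val hbx
  rwa [← mul_left_cancel₀ hx this]

/-- Multiplication by a nonzero element `p` identifies `J'` with `J = p J'`. -/
noncomputable def Ideal.mulEquiv {R : Type} [CommRing R] [IsDomain R] {p : R} (hp : p ≠ 0)
    {J J' : Ideal R} (h : ∀ f, f ∈ J ↔ ∃ g ∈ J', f = p * g) : J' ≃ₗ[R] J :=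
  LinearEquiv.ofBijective
    (LinearMap.codRestrict J (LinearMap.lsmul R R p ∘ₗ J'.subtype)
      fun g => (h _).2 ⟨g, g.2, rfl⟩)
    ⟨fun a b hab => Subtype.ext (mul_left_cancel₀ hp (congrArg Subtype.val hab)),
      fun ⟨f, hf⟩ => by
        obtain ⟨g, hg, rfl⟩ := (h f).1 hf
        exact ⟨⟨g, hg⟩, rfl⟩⟩

lemma Ideal.exists_mulEquiv {R : Type} [CommRing R] [IsDomain R] {p : R} (hp : p ≠ 0)
    {J : Ideal R} (h : J ≤ Ideal.span {p}) :
    ∃ J' : Ideal R, (∀ g, g ∈ J' ↔ p * g ∈ J) ∧ Nonempty (J' ≃ₗ[R] J) := by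
  refine ⟨Submodule.comap (LinearMap.lsmul R R p) J, fun g => Iff.rfl,
    ⟨Ideal.mulEquiv hp fun f => ⟨fun hf => ?_, ?_⟩⟩⟩
  · obtain ⟨g, rfl⟩ := Ideal.mem_span_singleton.1 (h hf)
    exact ⟨g, hf, rfl⟩
  · rintro ⟨g, hg, rfl⟩
    exact hg

lemma SD.nonempty_equiv_of_ufd {R D : Type} [CommRing R] [IsDomain R]
    [UniqueFactorizationMonoid R] [IsNoetherianRing R] [AddCommGroup D] [Module R D] (h : SD R D) :
    Nonempty (D ≃ₗ[R] R) := by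
  obtain ⟨J, hJ, ⟨e⟩⟩ := h.exists_ideal
  obtain ⟨x, hxJ, hx⟩ := Submodule.exists_mem_ne_zero_of_ne_bot hJ
  have hS := h.of_linearEquiv e
  suffices Nonempty (J ≃ₗ[R] R) by
    obtain ⟨e'⟩ := this
    exact ⟨e.trans e'⟩
  clear e h hJ
  induction x using (wellFounded_dvdNotUnit (α := R)).induction generalizing J with
  | _ x ih =>
  classical
  let P : Finset R := (UniqueFactorizationMonoid.factors x).toFinset
  have hP : ∀ p ∈ P, Prime p := fun p hp =>
    UniqueFactorizationMonoid.prime_of_factor p (Multiset.mem_toFinset.1 hp)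
  by_cases hsub : ∃ p ∈ P, J ≤ Ideal.span {p}
  · obtain ⟨p, hp, hJp⟩ := hsub
    obtain ⟨J', hJ', ⟨e⟩⟩ := Ideal.exists_mulEquiv (hP p hp).ne_zero hJp
    obtain ⟨x', rfl⟩ := Ideal.mem_span_singleton.1 (hJp hxJ)
    have hx' : x' ≠ 0 := right_ne_zero_of_mul hx
    obtain ⟨e'⟩ := ih x' ⟨hx', p, (hP p hp).not_isUnit, mul_comm _ _⟩ J' ((hJ' _).2 hxJ) hx'
      (hS.of_linearEquiv e.symm)
    exact ⟨e.symm.trans e'⟩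
  · have : ¬ ((J : Set R) ⊆ ⋃ p ∈ (P : Set R), (Ideal.span {p} : Ideal R)) := by
      rw [Ideal.subset_union_prime 0 0]
      · exact hsub
      · intro p hp _ _
        exact (Ideal.span_singleton_prime (hP p hp).ne_zero).2 (hP p hp)
    obtain ⟨y, hyJ, hy⟩ := Set.not_subset.1 this
    have hrel : IsRelPrime x y := by
      refine (UniqueFactorizationMonoid.isRelPrime_iff_no_prime_factors hx).2 fun d hdx hdy hd => ?_
      obtain ⟨p, hp, hdp⟩ :=
        UniqueFactorizationMonoid.exists_mem_factors_of_dvd hx hd.irreducible hdx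
      apply hy
      simp only [Set.mem_iUnion]
      exact ⟨p, Multiset.mem_toFinset.2 hp, Ideal.mem_span_singleton.2 (hdp.symm.dvd.trans hdy)⟩
    have h1 : (1 : R) ∈ J := by
      refine hS.divSat x hxJ hx y (fun g hg => ?_) 1 (by simpa using hyJ)
      rw [Ideal.mem_span_singleton] at hg ⊢
      exact hrel.dvd_of_dvd_mul_left hg
    rw [← Ideal.eq_top_iff_one] at h1
    subst h1
    exact ⟨Submodule.topEquiv⟩

section Combinatorics

/-- A finite set without chains of length `r + 1` can be coloured with `r` colours such that
comparable elements have different colours. -/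
lemma exists_colouring {α : Type} (lt : α → α → Prop) (htrans : ∀ a b c, lt a b → lt b c → lt a c)
    (r : ℕ) : ∀ T : Finset α,
    (∀ f : Fin (r + 1) → α, (∀ i j, i < j → lt (f i) (f j)) → ¬ ∀ i, f i ∈ T) →
    ∃ l : α → ℕ, (∀ p ∈ T, l p < r) ∧ ∀ p ∈ T, ∀ q ∈ T, lt p q → l p ≠ l q := by
  classical
  induction r with
  | zero =>
    intro T hT
    have : ∀ p, p ∉ T := fun p hp => hT (fun _ => p) (fun i j h => by omega) fun _ => hp
    exact ⟨fun _ => 0, fun p hp => (this p hp).elim, fun p hp => (this p hp).elim⟩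
  | succ r ih =>
    intro T hT
    obtain ⟨l, hl, hl'⟩ := ih (T.filter fun q => ∃ p ∈ T, lt p q) (by
      intro f hf hfT
      obtain ⟨p, hp, hpf⟩ := (Finset.mem_filter.1 (hfT 0)).2
      refine hT (Fin.cons p f) (fun i j hij => ?_) (fun i => ?_)
      · induction j using Fin.cases with
        | zero => exact absurd hij (Fin.not_lt_zero _)
        | succ j =>
          induction i using Fin.cases with
          | zero =>
            rw [Fin.cons_zero, Fin.cons_succ]
            rcases Fin.eq_zero_or_eq_succ j with rfl | ⟨j', rfl⟩
            · exact hpf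
            · exact htrans _ _ _ hpf (hf _ _ (Fin.succ_pos _))
          | succ i => simpa using hf i j (Fin.succ_lt_succ_iff.1 hij)
      · induction i using Fin.cases with
        | zero => simpa using hp
        | succ i => simpa using (Finset.mem_filter.1 (hfT i)).1)
    refine ⟨fun q => if ∃ p ∈ T, lt p q then l q + 1 else 0, fun p hp => ?_,
      fun p hp q hq hpq => ?_⟩
    · dsimp only
      split_ifs with h
      · have := hl p (Finset.mem_filter.2 ⟨hp, h⟩)
        omega
      · omega
    · have hq' : ∃ p ∈ T, lt p q := ⟨p, hp, hpq⟩
      dsimp only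
      rw [if_pos hq']
      split_ifs with h
      · have := hl' p (Finset.mem_filter.2 ⟨hp, h⟩) q (Finset.mem_filter.2 ⟨hq, hq'⟩) hpq
        omega
      · omega

variable {m n : ℕ}

/-- The weight of the variable with index `p`. -/
def cellWt (p : Fin m × Fin n) : ℕ := p.1 * (n - p.2)

/-- Partial sums of a table of natural numbers over a south-west quadrant. -/
def quadSum (w : Fin m × Fin n → ℕ) (a b : ℕ) : ℕ :=
  ∑ p, if a ≤ (p.1 : ℕ) ∧ (p.2 : ℕ) < b then w p else 0

lemma sum_quadSum (w : Fin m × Fin n → ℕ) :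
    ∑ a ∈ Finset.range m, ∑ b ∈ Finset.range n, quadSum w (a + 1) (b + 1) =
      ∑ p, cellWt p * w p := by
  have hcard1 : ∀ i : Fin m, ((Finset.range m).filter fun a => a + 1 ≤ (i : ℕ)).card = i := by
    intro i
    have : ((Finset.range m).filter fun a => a + 1 ≤ (i : ℕ)) = Finset.range i := by
      ext a
      simp only [Finset.mem_filter, Finset.mem_range]
      omega
    rw [this, Finset.card_range]
  have hcard2 : ∀ j : Fin n, ((Finset.range n).filter fun b => (j : ℕ) < b + 1).card = n - j := by
    intro j
    have : ((Finset.range n).filter fun b => (j : ℕ) < b + 1) = Finset.Ico (j : ℕ) n := by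
      ext a
      simp only [Finset.mem_filter, Finset.mem_range, Finset.mem_Ico]
      omega
    rw [this, Nat.card_Ico]
  simp only [quadSum]
  calc _ = ∑ a ∈ Finset.range m, ∑ p : Fin m × Fin n, ∑ b ∈ Finset.range n,
        (if a + 1 ≤ (p.1 : ℕ) ∧ (p.2 : ℕ) < b + 1 then w p else 0) :=
        Finset.sum_congr rfl fun _ _ => Finset.sum_comm
    _ = ∑ p : Fin m × Fin n, ∑ a ∈ Finset.range m, ∑ b ∈ Finset.range n,
        (if a + 1 ≤ (p.1 : ℕ) ∧ (p.2 : ℕ) < b + 1 then w p else 0) := Finset.sum_comm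
    _ = _ := by
      refine Finset.sum_congr rfl fun p _ => ?_
      simp only [ite_and]
      have : ∀ a, (∑ b ∈ Finset.range n,
          if a + 1 ≤ (p.1 : ℕ) then (if (p.2 : ℕ) < b + 1 then w p else 0) else 0) =
          if a + 1 ≤ (p.1 : ℕ) then (n - p.2) * w p else 0 := by
        intro a
        split_ifs
        · rw [← Finset.sum_filter, Finset.sum_const, hcard2, smul_eq_mul]
        · simp
      simp only [this]
      rw [← Finset.sum_filter, Finset.sum_const, hcard1, smul_eq_mul, cellWt, mul_assoc]

/-- Among the tables with given margins, one supported on an antichain has minimal weight. -/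
lemma antichain_weight (w u : Fin m × Fin n → ℕ)
    (hrow : ∀ i, ∑ j, w (i, j) = ∑ j, u (i, j)) (hcol : ∀ j, ∑ i, w (i, j) = ∑ i, u (i, j))
    (hu : ∀ p q, u p ≠ 0 → u q ≠ 0 → p.1 < q.1 → ¬ q.2 < p.2) :
    (∑ p, cellWt p * u p ≤ ∑ p, cellWt p * w p) ∧
      (∑ p, cellWt p * u p = ∑ p, cellWt p * w p → w = u) := by
  have hR : ∀ a : ℕ, (∑ p : Fin m × Fin n, if a ≤ (p.1 : ℕ) then w p else 0) =
      ∑ p : Fin m × Fin n, if a ≤ (p.1 : ℕ) then u p else 0 := fun a => by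
    simp only [Fintype.sum_prod_type]
    refine Finset.sum_congr rfl fun i _ => ?_
    split_ifs
    · exact hrow i
    · rfl
  have hC : ∀ b : ℕ, (∑ p : Fin m × Fin n, if b ≤ (p.2 : ℕ) then w p else 0) =
      ∑ p : Fin m × Fin n, if b ≤ (p.2 : ℕ) then u p else 0 := fun a => by
    simp only [Fintype.sum_prod_type_right]
    refine Finset.sum_congr rfl fun i _ => ?_
    split_ifs
    · exact hcol i
    · rfl
  -- `quadSum - (opposite quadrant)` depends only on the margins
  have key : ∀ (v : Fin m × Fin n → ℕ) (a b : ℕ),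
      quadSum v a b + (∑ p : Fin m × Fin n, if b ≤ (p.2 : ℕ) then v p else 0) =
      (∑ p : Fin m × Fin n, if a ≤ (p.1 : ℕ) then v p else 0) +
        ∑ p : Fin m × Fin n, if ¬ a ≤ (p.1 : ℕ) ∧ b ≤ (p.2 : ℕ) then v p else 0 := by
    intro v a b
    rw [quadSum, ← Finset.sum_add_distrib, ← Finset.sum_add_distrib]
    refine Finset.sum_congr rfl fun p _ => ?_
    split_ifs <;> omega
  have hle : ∀ a b, quadSum u a b ≤ quadSum w a b := by
    intro a b
    by_cases h0 : quadSum u a b = 0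
    · omega
    · have h1 : (∑ p : Fin m × Fin n, if ¬ a ≤ (p.1 : ℕ) ∧ b ≤ (p.2 : ℕ) then u p else 0) = 0 := by
        obtain ⟨q, -, hq⟩ := Finset.exists_ne_zero_of_sum_ne_zero h0
        refine Finset.sum_eq_zero fun p _ => ?_
        split_ifs with hp
        · by_contra hup
          have hq' : a ≤ (q.1 : ℕ) ∧ (q.2 : ℕ) < b := by
            by_contra h
            exact hq (if_neg h)
          rw [if_pos hq'] at hq
          refine hu p q hup hq ?_ ?_
          · rw [Fin.lt_def]; omega
          · rw [Fin.lt_def]; omega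
        · rfl
      have := key u a b
      have := key w a b
      rw [hR, hC] at this
      omega
  rw [← sum_quadSum, ← sum_quadSum]
  refine ⟨Finset.sum_le_sum fun a _ => Finset.sum_le_sum fun b _ => hle _ _, fun heq => ?_⟩
  have heq1 : ∀ a < m, ∀ b < n, quadSum u (a + 1) (b + 1) = quadSum w (a + 1) (b + 1) := by
    have h1 := (Finset.sum_eq_sum_iff_of_le
      (fun a _ => Finset.sum_le_sum fun b _ => hle (a + 1) (b + 1))).1 heq
    intro a ha b hb
    exact (Finset.sum_eq_sum_iff_of_le (fun b _ => hle (a + 1) (b + 1))).1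
      (h1 a (Finset.mem_range.2 ha)) b (Finset.mem_range.2 hb)
  have heq2 : ∀ a ≤ m, ∀ b ≤ n, quadSum u a b = quadSum w a b := by
    intro a ha b hb
    rcases b with _ | b
    · simp [quadSum]
    rcases a with _ | a
    · have := key u 0 (b + 1)
      have := key w 0 (b + 1)
      rw [hR, hC] at this
      simp only [zero_le, not_true_eq_false, false_and, if_false, Finset.sum_const_zero] at *
      omega
    · exact heq1 a (by omega) b (by omega)
  have hrec : ∀ (v : Fin m × Fin n → ℕ) (i : Fin m) (j : Fin n),
      v (i, j) + quadSum v (i + 1) (j + 1) + quadSum v i j =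
        quadSum v i (j + 1) + quadSum v (i + 1) j := by
    intro v i j
    have : v (i, j) = ∑ p, if p = (i, j) then v p else 0 := by simp
    rw [this, quadSum, quadSum, quadSum, quadSum, ← Finset.sum_add_distrib,
      ← Finset.sum_add_distrib, ← Finset.sum_add_distrib]
    refine Finset.sum_congr rfl fun p _ => ?_
    have : p = (i, j) ↔ (p.1 : ℕ) = i ∧ (p.2 : ℕ) = j := by
      rw [Prod.ext_iff, Fin.ext_iff, Fin.ext_iff]
    rw [if_congr this rfl rfl]
    split_ifs <;> omega
  funext ⟨i, j⟩
  have h1 := hrec w i j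
  have h2 := hrec u i j
  rw [heq2 _ (by omega) _ (by omega), heq2 _ (by omega) _ (by omega),
    heq2 _ (by omega) _ (by omega),
    heq2 _ (by omega) _ (by omega)] at h2
  omega

end Combinatorics

section LeadingExponents

variable {m n r : ℕ}

/-- The weight of an exponent. -/
def expWt (u : Fin m × Fin n →₀ ℕ) : ℕ := ∑ p, cellWt p * u p

lemma expWt_add (u v : Fin m × Fin n →₀ ℕ) : expWt (u + v) = expWt u + expWt v := by
  simp [expWt, mul_add, Finset.sum_add_distrib]

/-- The index set of the variables `y i k` and `z k j`. -/
abbrev YZIdx (m n r : ℕ) : Type := (Fin m × Fin r) ⊕ (Fin r × Fin n)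

/-- `e` is the exponent of the product of the `(y i k * z k j) ^ w (i, j) k`. -/
def IsProdExp (w : Fin m × Fin n → Fin r → ℕ) (e : YZIdx m n r →₀ ℕ) : Prop :=
  (∀ i k, e (Sum.inl (i, k)) = ∑ j, w (i, j) k) ∧ ∀ k j, e (Sum.inr (k, j)) = ∑ i, w (i, j) k

/-- The table obtained by spreading the exponent `u` according to the colouring `l`. -/
def spread (r : ℕ) (l : Fin m × Fin n → ℕ) (u : Fin m × Fin n →₀ ℕ) (p : Fin m × Fin n)
    (k : Fin r) : ℕ :=
  if l p = k then u p else 0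

/-- The exponent of the leading monomial. -/
noncomputable def leadExp (r : ℕ) (l : Fin m × Fin n → ℕ) (u : Fin m × Fin n →₀ ℕ) :
    YZIdx m n r →₀ ℕ :=
  Finsupp.equivFunOnFinite.symm (Sum.elim (fun x => ∑ j, spread r l u (x.1, j) x.2)
    fun x => ∑ i, spread r l u (i, x.2) x.1)

lemma isProdExp_leadExp (l : Fin m × Fin n → ℕ) (u : Fin m × Fin n →₀ ℕ) :
    IsProdExp (spread r l u) (leadExp r l u) :=
  ⟨fun _ _ => rfl, fun _ _ => rfl⟩

lemma IsProdExp.add {w w' : Fin m × Fin n → Fin r → ℕ} {e e' : YZIdx m n r →₀ ℕ}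
    (h : IsProdExp w e) (h' : IsProdExp w' e') : IsProdExp (w + w') (e + e') := by
  constructor
  · intro i k
    simp [h.1, h'.1, Finset.sum_add_distrib]
  · intro i k
    simp [h.2, h'.2, Finset.sum_add_distrib]

lemma IsProdExp.ext {w : Fin m × Fin n → Fin r → ℕ} {e e' : YZIdx m n r →₀ ℕ}
    (h : IsProdExp w e) (h' : IsProdExp w e') : e = e' := by
  ext (⟨i, k⟩ | ⟨k, j⟩)
  · rw [h.1, h'.1]
  · rw [h.2, h'.2]

/-- The exponent of `y i k * z k j`. -/
noncomputable def unitExp (p : Fin m × Fin n) (k : Fin r) : YZIdx m n r →₀ ℕ :=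
  Finsupp.single (Sum.inl (p.1, k)) 1 + Finsupp.single (Sum.inr (k, p.2)) 1

/-- The table with a single entry equal to one. -/
def unitTab (p : Fin m × Fin n) (k : Fin r) (q : Fin m × Fin n) (k' : Fin r) : ℕ :=
  if q.1 = p.1 ∧ q.2 = p.2 ∧ k' = k then 1 else 0

lemma isProdExp_unitExp (p : Fin m × Fin n) (k : Fin r) :
    IsProdExp (unitTab p k) (unitExp p k) := by
  constructor
  · intro i k'
    simp only [unitExp, unitTab, Finsupp.add_apply, Finsupp.single_apply, Sum.inl.injEq,
      Prod.mk.injEq, reduceCtorEq, if_false, add_zero]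
    by_cases h : p.1 = i <;> by_cases h' : k = k' <;>
      simp [h, h', eq_comm (b := p.1), eq_comm (b := k)]
  · intro k' j
    simp only [unitExp, unitTab, Finsupp.add_apply, Finsupp.single_apply, Sum.inr.injEq,
      Prod.mk.injEq, reduceCtorEq, if_false, zero_add]
    by_cases h : p.2 = j <;> by_cases h' : k = k' <;>
      simp [h, h', eq_comm (b := p.2), eq_comm (b := k)]

lemma sum_unitTab (p : Fin m × Fin n) (k : Fin r) (q : Fin m × Fin n) :
    ∑ k', unitTab p k q k' = Finsupp.single p 1 q := by
  simp only [unitTab, Finsupp.single_apply, Prod.ext_iff]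
  by_cases h : p.1 = q.1 <;> by_cases h' : p.2 = q.2 <;>
    simp [h, h', eq_comm (b := p.1), eq_comm (b := p.2)]

/-- `l` is a colouring of the support of `u` by `r` antichains. -/
structure IsColouring (r : ℕ) (l : Fin m × Fin n → ℕ) (u : Fin m × Fin n →₀ ℕ) : Prop where
  lt : ∀ p, u p ≠ 0 → l p < r
  ne : ∀ p q, u p ≠ 0 → u q ≠ 0 → p.1 < q.1 → q.2 < p.2 → l p ≠ l q

lemma IsColouring.sum_spread {l : Fin m × Fin n → ℕ} {u : Fin m × Fin n →₀ ℕ}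
    (h : IsColouring r l u) (p : Fin m × Fin n) : ∑ k, spread r l u p k = u p := by
  simp only [spread]
  by_cases hp : u p = 0
  · simp [hp]
  · rw [Finset.sum_eq_single ⟨l p, h.lt p hp⟩]
    · simp
    · rintro k - hk
      rw [if_neg]
      intro h
      exact hk (Fin.ext h.symm)
    · simp

lemma IsColouring.unique {l : Fin m × Fin n → ℕ} {u v : Fin m × Fin n →₀ ℕ}
    (h : IsColouring r l u) {w : Fin m × Fin n → Fin r → ℕ} (hv : ∀ p, ∑ k, w p k = v p)
    (hw : IsProdExp w (leadExp r l u)) :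
    expWt u ≤ expWt v ∧ (expWt u = expWt v → w = spread r l u) := by
  have hexp : ∀ (t : Fin m × Fin n →₀ ℕ) (w : Fin m × Fin n → Fin r → ℕ),
      (∀ p, ∑ k, w p k = t p) → expWt t = ∑ k, ∑ p, cellWt p * w p k := by
    intro t w ht
    rw [Finset.sum_comm]
    simp only [expWt, ← ht, Finset.mul_sum]
  have hk := fun k : Fin r => antichain_weight (fun p => w p k) (fun p => spread r l u p k)
    (fun i => by rw [← hw.1, ← (isProdExp_leadExp l u).1])
    (fun j => by rw [← hw.2, ← (isProdExp_leadExp l u).2])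
    (fun p q hp hq h1 h2 => by
      simp only [spread, ne_eq, ite_eq_right_iff, Classical.not_imp] at hp hq
      exact h.ne p q hp.2 hq.2 h1 h2 (hp.1.trans hq.1.symm))
  rw [hexp u _ h.sum_spread, hexp v _ hv]
  refine ⟨Finset.sum_le_sum fun k _ => (hk k).1, fun heq => ?_⟩
  have := (Finset.sum_eq_sum_iff_of_le fun k _ => (hk k).1).1 heq
  funext p k
  exact congr_fun ((hk k).2 (this k (Finset.mem_univ k))) p

/-- The exponents of standard monomials. -/
def IsStd (r : ℕ) (u : Fin m × Fin n →₀ ℕ) : Prop :=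
  ∀ (ρ : Fin (r + 1) → Fin m) (γ : Fin (r + 1) → Fin n), StrictMono ρ → StrictAnti γ →
    ¬ ∀ k, u (ρ k, γ k) ≠ 0

lemma IsStd.exists_isColouring {u : Fin m × Fin n →₀ ℕ} (h : IsStd r u) :
    ∃ l, IsColouring r l u := by
  obtain ⟨l, hl, hl'⟩ := exists_colouring
    (fun p q : Fin m × Fin n => p.1 < q.1 ∧ q.2 < p.2)
    (fun a b c hab hbc => ⟨hab.1.trans hbc.1, hbc.2.trans hab.2⟩) r u.support
    (fun f hf hT => h (fun k => (f k).1) (fun k => (f k).2) (fun i j hij => (hf i j hij).1)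
      (fun i j hij => (hf i j hij).2) fun k => Finsupp.mem_support_iff.1 (hT k))
  exact ⟨l, fun p hp => hl p (Finsupp.mem_support_iff.2 hp), fun p q hp hq h1 h2 =>
    hl' p (Finsupp.mem_support_iff.2 hp) q (Finsupp.mem_support_iff.2 hq) ⟨h1, h2⟩⟩

end LeadingExponents

section GenericProduct

open MvPolynomial

variable (A : Type) [CommRing A] (m n r : ℕ)

/-- The polynomial ring in the entries of a generic `m × r` and a generic `r × n` matrix. -/
abbrev YZPoly : Type := MvPolynomial (YZIdx m n r) A

/-- The map sending the generic matrix to the product of two generic matrices. -/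
noncomputable def prodMap : MvPolynomial (Fin m × Fin n) A →ₐ[A] YZPoly A m n r :=
  aeval fun p => ∑ k, X (Sum.inl (p.1, k)) * X (Sum.inr (k, p.2))

variable {A m n r}

lemma X_mul_X_eq (p : Fin m × Fin n) (k : Fin r) :
    (X (Sum.inl (p.1, k)) * X (Sum.inr (k, p.2)) : YZPoly A m n r) = monomial (unitExp p k) 1 := by
  rw [X, X, monomial_mul, one_mul]
  rfl

lemma prodMap_X (p : Fin m × Fin n) :
    prodMap A m n r (X p) = ∑ k, monomial (unitExp p k) 1 := by
  rw [prodMap, aeval_X]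
  exact Finset.sum_congr rfl fun k _ => X_mul_X_eq p k

lemma coeff_prodMap_ne_zero (v : Fin m × Fin n →₀ ℕ) :
    ∀ e, coeff e (prodMap A m n r (monomial v 1)) ≠ 0 →
      ∃ w : Fin m × Fin n → Fin r → ℕ, (∀ p, ∑ k, w p k = v p) ∧ IsProdExp w e := by
  classical
  have hzero : ∀ e, coeff e (prodMap A m n r (monomial 0 1)) ≠ 0 →
      ∃ w : Fin m × Fin n → Fin r → ℕ,
        (∀ p, ∑ k, w p k = (0 : Fin m × Fin n →₀ ℕ) p) ∧ IsProdExp w e := by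
    intro e he
    rw [show (monomial (0 : Fin m × Fin n →₀ ℕ) (1 : A)) = 1 from rfl, map_one, coeff_one] at he
    have : e = 0 := by
      by_contra h
      exact he (if_neg (Ne.symm h))
    subst this
    exact ⟨0, by simp, by simp [IsProdExp]⟩
  have hadd : ∀ v v' : Fin m × Fin n →₀ ℕ,
      (∀ e, coeff e (prodMap A m n r (monomial v 1)) ≠ 0 →
        ∃ w : Fin m × Fin n → Fin r → ℕ, (∀ p, ∑ k, w p k = v p) ∧ IsProdExp w e) →
      (∀ e, coeff e (prodMap A m n r (monomial v' 1)) ≠ 0 →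
        ∃ w : Fin m × Fin n → Fin r → ℕ, (∀ p, ∑ k, w p k = v' p) ∧ IsProdExp w e) →
      ∀ e, coeff e (prodMap A m n r (monomial (v + v') 1)) ≠ 0 →
        ∃ w : Fin m × Fin n → Fin r → ℕ, (∀ p, ∑ k, w p k = (v + v') p) ∧ IsProdExp w e := by
    intro v v' h h' e he
    rw [show (monomial (v + v') (1 : A)) = monomial v 1 * monomial v' 1 by
      rw [monomial_mul, one_mul], map_mul, coeff_mul] at he
    obtain ⟨⟨a, b⟩, hab, hne⟩ := Finset.exists_ne_zero_of_sum_ne_zero he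
    obtain ⟨w, hw, hw'⟩ := h a (left_ne_zero_of_mul hne)
    obtain ⟨x, hx, hx'⟩ := h' b (right_ne_zero_of_mul hne)
    refine ⟨w + x, fun p => ?_, ?_⟩
    · simp [Finset.sum_add_distrib, hw, hx]
    · rw [← Finset.HasAntidiagonal.mem_antidiagonal.1 hab]
      exact hw'.add hx'
  induction v using Finsupp.induction_linear with
  | zero => exact hzero
  | add v v' h h' => exact hadd v v' h h'
  | single p c =>
    induction c with
    | zero => simpa using hzero
    | succ c ih =>
      rw [Finsupp.single_add]
      refine hadd _ _ ih ?_
      intro e he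
      rw [show monomial (Finsupp.single p 1) (1 : A) = X p from rfl, prodMap_X, coeff_sum] at he
      obtain ⟨k, -, hk⟩ := Finset.exists_ne_zero_of_sum_ne_zero he
      rw [coeff_monomial] at hk
      have : unitExp p k = e := by
        by_contra h
        exact hk (if_neg h)
      subst this
      exact ⟨unitTab p k, sum_unitTab p k, isProdExp_unitExp p k⟩

lemma coeff_leadExp {l : Fin m × Fin n → ℕ} (N : ℕ) : ∀ {u : Fin m × Fin n →₀ ℕ},
    IsColouring r l u → (∑ p, u p = N) →
    coeff (leadExp r l u) (prodMap A m n r (monomial u 1)) = 1 := by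
  classical
  induction N with
  | zero =>
    intro u _ hN
    have : u = 0 := by
      ext p
      exact (Finset.sum_eq_zero_iff.1 hN) p (Finset.mem_univ p)
    subst this
    have h0 : leadExp r l (0 : Fin m × Fin n →₀ ℕ) = 0 := by
      refine (isProdExp_leadExp l 0).ext ?_
      simp [IsProdExp, spread]
    rw [h0, show (monomial (0 : Fin m × Fin n →₀ ℕ) (1 : A)) = 1 from rfl, map_one, coeff_zero_one]
  | succ N ih =>
    intro u hu hN
    obtain ⟨p, -, hp⟩ := Finset.exists_ne_zero_of_sum_ne_zero (hN.trans_ne (Nat.succ_ne_zero N))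
    obtain ⟨u', rfl⟩ : ∃ u', u = u' + Finsupp.single p 1 :=
      ⟨u - Finsupp.single p 1, (tsub_add_cancel_of_le (by
        rw [Finsupp.single_le_iff]; omega)).symm⟩
    have hu' : IsColouring r l u' :=
      ⟨fun q hq => hu.lt q (by simp [hq]),
        fun q q' hq hq' => hu.ne q q' (by simp [hq]) (by simp [hq'])⟩
    have hN' : ∑ q, u' q = N := by
      have : ∑ q, (Finsupp.single p 1 : Fin m × Fin n →₀ ℕ) q = 1 := by
        simp [Finsupp.single_apply]
      simp only [Finsupp.add_apply, Finset.sum_add_distrib, this] at hN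
      omega
    let k₀ : Fin r := ⟨l p, hu.lt p hp⟩
    have hlead : leadExp r l (u' + Finsupp.single p 1) = leadExp r l u' + unitExp p k₀ := by
      refine (isProdExp_leadExp l _).ext ?_
      convert (isProdExp_leadExp l u').add (isProdExp_unitExp p k₀) using 1
      funext q k
      simp only [spread, Pi.add_apply, unitTab, Finsupp.add_apply, Finsupp.single_apply]
      by_cases hq : p = q
      · subst hq
        have : (k = k₀) ↔ l p = k := by rw [Fin.ext_iff, eq_comm]
        by_cases hk : l p = k <;> simp [hk, this]
      · have : ¬ (q.1 = p.1 ∧ q.2 = p.2 ∧ k = k₀) := fun h => hq (Prod.ext h.1.symm h.2.1.symm)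
        simp [hq, this]
    rw [show (monomial (u' + Finsupp.single p 1) (1 : A)) = monomial u' 1 * X p by
      rw [X, monomial_mul, one_mul], map_mul, prodMap_X, Finset.mul_sum, coeff_sum,
      Finset.sum_eq_single k₀]
    · rw [hlead, coeff_mul_monomial, ih hu' hN', mul_one]
    · intro k _ hk
      rw [coeff_mul_monomial', mul_one]
      split_ifs with hle
      · by_contra hne
        obtain ⟨w, hw, hw'⟩ := coeff_prodMap_ne_zero u' _ hne
        have h1 := hw'.add (isProdExp_unitExp p k)
        rw [tsub_add_cancel_of_le hle] at h1
        have h2 := (hu.unique (v := u' + Finsupp.single p 1) (fun q => by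
          simp [Finset.sum_add_distrib, hw, sum_unitTab]) h1).2 rfl
        have h3 := congr_fun (congr_fun h2 p) k
        have : l p ≠ k := fun h => hk (Fin.ext h.symm)
        simp [unitTab, spread, this] at h3
      · rfl
    · simp

/-- Every standard monomial has an image with a distinguished term. -/
lemma IsStd.exists_lead {u : Fin m × Fin n →₀ ℕ} (h : IsStd r u) :
    ∃ e : YZIdx m n r →₀ ℕ, coeff e (prodMap A m n r (monomial u 1)) = 1 ∧
      (∀ v, v ≠ u → coeff e (prodMap A m n r (monomial v 1)) ≠ 0 → expWt u < expWt v) ∧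
      ∀ (i : Fin m) (j : Fin n), (i : ℕ) = 0 → (j : ℕ) = 0 → u (i, j) = 0 →
        ∀ k, ¬ unitExp (i, j) k ≤ e := by
  obtain ⟨l, hl⟩ := h.exists_isColouring
  refine ⟨leadExp r l u, coeff_leadExp _ hl rfl, fun v hv hne => ?_, fun i j hi hj hij k hk => ?_⟩
  · obtain ⟨w, hw, hw'⟩ := coeff_prodMap_ne_zero v _ hne
    obtain ⟨h1, h2⟩ := hl.unique hw hw'
    refine lt_of_le_of_ne h1 fun h3 => hv ?_
    ext p
    rw [← hw, h2 h3, hl.sum_spread]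
  · have hy := hk (Sum.inl (i, k))
    have hz := hk (Sum.inr (k, j))
    rw [(isProdExp_leadExp l u).1] at hy
    rw [(isProdExp_leadExp l u).2] at hz
    simp only [unitExp, Finsupp.add_apply, Finsupp.single_eq_same, Finsupp.single_apply,
      reduceCtorEq, if_false, add_zero, zero_add] at hy hz
    obtain ⟨j', -, hj'⟩ := Finset.exists_ne_zero_of_sum_ne_zero (by omega :
      ∑ j, spread r l u (i, j) k ≠ 0)
    obtain ⟨i', -, hi'⟩ := Finset.exists_ne_zero_of_sum_ne_zero (by omega :
      ∑ i, spread r l u (i, j) k ≠ 0)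
    simp only [spread, ne_eq, ite_eq_right_iff, Classical.not_imp] at hi' hj'
    refine hl.ne (i, j') (i', j) hj'.2 hi'.2 ?_ ?_ (hj'.1.trans hi'.1.symm)
    · have : i' ≠ i := by
        rintro rfl
        exact hi'.2 hij
      have : (i' : ℕ) ≠ i := fun h => this (Fin.ext h)
      change (_ : ℕ) < _
      dsimp only
      omega
    · have : j' ≠ j := by
        rintro rfl
        exact hj'.2 hij
      have : (j' : ℕ) ≠ j := fun h => this (Fin.ext h)
      change (_ : ℕ) < _
      dsimp only
      omega

/-- If the distinguished coefficients of the image of a standard polynomial lie in an ideal, so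
do its coefficients. -/
lemma coeff_mem_of_lead {f : MvPolynomial (Fin m × Fin n) A} (I : Ideal A)
    (hstd : ∀ u ∈ f.support, IsStd r u)
    (h : ∀ u ∈ f.support, ∀ e : YZIdx m n r →₀ ℕ,
      (∀ (i : Fin m) (j : Fin n), (i : ℕ) = 0 → (j : ℕ) = 0 → u (i, j) = 0 →
        ∀ k, ¬ unitExp (i, j) k ≤ e) → coeff e (prodMap A m n r f) ∈ I) (u) :
    coeff u f ∈ I := by
  classical
  by_contra hu
  obtain ⟨u, hu, hmax⟩ := Finset.exists_max_image (f.support.filter fun u => coeff u f ∉ I) expWt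
    ⟨u, Finset.mem_filter.2 ⟨mem_support_iff.2 (fun h => hu (h ▸ I.zero_mem)), hu⟩⟩
  rw [Finset.mem_filter] at hu
  obtain ⟨e, he, hev, hcorner⟩ := (hstd u hu.1).exists_lead (A := A)
  have h1 := h u hu.1 e hcorner
  have h2 : prodMap A m n r f = ∑ v ∈ f.support, coeff v f • prodMap A m n r (monomial v 1) := by
    conv_lhs => rw [f.as_sum]
    rw [map_sum]
    refine Finset.sum_congr rfl fun v _ => ?_
    rw [← map_smul, smul_monomial, smul_eq_mul, mul_one]
  rw [h2, coeff_sum, ← Finset.add_sum_erase _ _ hu.1, coeff_smul, he, smul_eq_mul, mul_one] at h1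
  refine hu.2 ((I.add_mem_iff_left (sum_mem fun v hv => ?_)).1 h1)
  rw [Finset.mem_erase] at hv
  rw [coeff_smul, smul_eq_mul]
  by_cases h0 : coeff e (prodMap A m n r (monomial v 1)) = 0
  · rw [h0, mul_zero]
    exact I.zero_mem
  · refine I.mul_mem_right _ ?_
    by_contra hvI
    have := hmax v (Finset.mem_filter.2 ⟨hv.2, hvI⟩)
    have := hev v hv.1 h0
    omega

end GenericProduct

section Straightening

open MvPolynomial

variable {A : Type} [CommRing A] {m n r : ℕ}

lemma expWt_sum_single {ι : Type} [Fintype ι] (p : ι → Fin m × Fin n) :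
    expWt (∑ i, Finsupp.single (p i) 1) = ∑ i, cellWt (p i) := by
  simp only [expWt, Finsupp.finsetSum_apply, Finset.mul_sum]
  rw [Finset.sum_comm]
  refine Finset.sum_congr rfl fun i _ => ?_
  simp [Finsupp.single_apply]

lemma expWt_perm_lt {ρ : Fin (r + 1) → Fin m} {γ : Fin (r + 1) → Fin n} (hρ : StrictMono ρ)
    (hγ : StrictAnti γ) {σ : Equiv.Perm (Fin (r + 1))} (hσ : σ ≠ 1) :
    ∑ i, cellWt (ρ (σ i), γ i) < ∑ i, cellWt (ρ i, γ i) := by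
  have hg : StrictMono fun i => n - (γ i : ℕ) := fun i j hij => by
    have : (γ j : ℕ) < γ i := hγ hij
    dsimp only
    omega
  have hf : StrictMono fun i => (ρ i : ℕ) := fun i j hij => hρ hij
  have := (Monovary.sum_comp_perm_mul_lt_sum_mul_iff (σ := σ) (hf.monotone.monovary hg.monotone)).2
  refine this fun hmono => hσ ?_
  have h1 : StrictMono σ := by
    refine Monotone.strictMono_of_injective (fun i j hij => ?_) σ.injective
    rcases hij.eq_or_lt with rfl | hij
    · exact le_rfl
    · exact hf.le_iff_le.1 (hmono (hg hij))
  ext i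
  simp [h1.eq_id]

lemma monomial_mem_std_sup (r : ℕ) (u : Fin m × Fin n →₀ ℕ) :
    monomial u (1 : A) ∈ restrictSupport A {u | IsStd r u} ⊔
      (minorsIdeal A m n (r + 1)).restrictScalars A := by
  classical
  induction hN : expWt u using Nat.strong_induction_on generalizing u with
  | _ N ih =>
  subst hN
  by_cases hu : IsStd r u
  · exact Submodule.mem_sup_left ((monomial_mem_restrictSupport A).2 (Or.inl hu))
  · unfold IsStd at hu
    push Not at hu
    obtain ⟨ρ, γ, hρ, hγ, hu⟩ := hu
    let s := fun σ : Equiv.Perm (Fin (r + 1)) =>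
      ∑ i, (Finsupp.single (ρ (σ i), γ i) 1 : Fin m × Fin n →₀ ℕ)
    have hle : s 1 ≤ u := by
      intro q
      by_cases hq : ∃ i, (ρ i, γ i) = q
      · obtain ⟨i, rfl⟩ := hq
        have h1 : s 1 (ρ i, γ i) = 1 := by
          simp only [s, Finsupp.finsetSum_apply, Finsupp.single_apply, Equiv.Perm.one_apply]
          rw [Finset.sum_eq_single i]
          · simp
          · intro j _ hj
            rw [if_neg]
            intro h
            exact hj (hρ.injective (congrArg Prod.fst h))
          · simp
        have := hu i
        omega
      · have h1 : s 1 q = 0 := by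
          simp only [s, Finsupp.finsetSum_apply, Finsupp.single_apply, Equiv.Perm.one_apply]
          refine Finset.sum_eq_zero fun i _ => if_neg fun h => hq ⟨i, h⟩
        omega
    obtain ⟨u', rfl⟩ : ∃ u', u = u' + s 1 := ⟨u - s 1, (tsub_add_cancel_of_le hle).symm⟩
    have hdet : monomial u' (1 : A) *
        (Matrix.of fun i j => (X (ρ i, γ j) : MvPolynomial (Fin m × Fin n) A)).det =
        ∑ σ : Equiv.Perm (Fin (r + 1)),
          ((Equiv.Perm.sign σ : ℤ) : A) • monomial (u' + s σ) (1 : A) := by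
      rw [Matrix.det_apply', Finset.mul_sum]
      refine Finset.sum_congr rfl fun σ _ => ?_
      rw [show monomial (u' + s σ) (1 : A) = monomial u' 1 * monomial (s σ) 1 by
        rw [monomial_mul, one_mul], monomial_sum_one, smul_eq_C_mul]
      simp only [Matrix.of_apply]
      rw [map_intCast]
      simp only [X]
      ring
    have hmem : (∑ σ : Equiv.Perm (Fin (r + 1)),
          ((Equiv.Perm.sign σ : ℤ) : A) • monomial (u' + s σ) (1 : A)) ∈
        restrictSupport A {u | IsStd r u} ⊔ (minorsIdeal A m n (r + 1)).restrictScalars A := by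
      rw [← hdet]
      exact Submodule.mem_sup_right (Ideal.mul_mem_left _ _ (Ideal.subset_span ⟨ρ, γ, rfl⟩))
    rw [← Finset.add_sum_erase _ _ (Finset.mem_univ 1), Equiv.Perm.sign_one, Units.val_one,
      Int.cast_one, one_smul] at hmem
    refine (Submodule.add_mem_iff_left _ (sum_mem fun σ hσ => Submodule.smul_mem _ _ ?_)).1 hmem
    refine ih _ ?_ _ rfl
    rw [expWt_add, expWt_add]
    refine Nat.add_lt_add_left ?_ _
    rw [expWt_sum_single, expWt_sum_single]
    exact expWt_perm_lt hρ hγ (Finset.mem_erase.1 hσ).1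

lemma exists_std (r : ℕ) (f : MvPolynomial (Fin m × Fin n) A) :
    ∃ g : MvPolynomial (Fin m × Fin n) A, (∀ u ∈ g.support, IsStd r u) ∧
      f - g ∈ minorsIdeal A m n (r + 1) := by
  have : f ∈ restrictSupport A {u | IsStd r u} ⊔
      (minorsIdeal A m n (r + 1)).restrictScalars A := by
    rw [f.as_sum]
    refine sum_mem fun u _ => ?_
    rw [show monomial u (coeff u f) = coeff u f • monomial u (1 : A) by
      rw [smul_monomial, smul_eq_mul, mul_one]]
    exact Submodule.smul_mem _ _ (monomial_mem_std_sup r u)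
  obtain ⟨g, hg, h, hh, rfl⟩ := Submodule.mem_sup.1 this
  exact ⟨g, fun u hu => hg hu, by simpa using hh⟩

lemma det_mul_of_lt {B : Type} [CommRing B] {r : ℕ} (U : Matrix (Fin (r + 1)) (Fin r) B)
    (V : Matrix (Fin r) (Fin (r + 1)) B) : (U * V).det = 0 := by
  have : U * V = (Matrix.of fun i => (Fin.snoc (U i) 0 : Fin (r + 1) → B)) *
      (Matrix.of (Fin.snoc (α := fun _ => Fin (r + 1) → B) V 0)) := by
    ext i j
    have h (x : Fin r) : Fin.snoc (α := fun _ => Fin (r + 1) → B) V 0 x.castSucc j = V x j :=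
      congrFun (Fin.snoc_castSucc (α := fun _ => Fin (r + 1) → B) _ _ _) j
    simp [Matrix.mul_apply, Fin.sum_univ_castSucc, h]
  rw [this, Matrix.det_mul, Matrix.det_eq_zero_of_column_eq_zero (Fin.last r), zero_mul]
  simp

lemma prodMap_minor {f : MvPolynomial (Fin m × Fin n) A} (hf : f ∈ minorsIdeal A m n (r + 1)) :
    prodMap A m n r f = 0 := by
  suffices minorsIdeal A m n (r + 1) ≤ RingHom.ker (prodMap A m n r) from this hf
  rw [minorsIdeal, Ideal.span_le]
  rintro _ ⟨ρ, γ, rfl⟩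
  rw [SetLike.mem_coe, RingHom.mem_ker, AlgHom.map_det]
  convert det_mul_of_lt (Matrix.of fun i k => X (Sum.inl (ρ i, k)))
    (Matrix.of fun k j => (X (Sum.inr (k, γ j)) : YZPoly A m n r)) using 2
  ext i j : 1
  simp [Matrix.mul_apply, prodMap]

variable (A m n r) in
/-- The embedding of the determinantal ring in a polynomial ring. -/
noncomputable def detMap : DetRing A m n (r + 1) →ₐ[A] YZPoly A m n r :=
  Ideal.Quotient.liftₐ _ (prodMap A m n r) fun _ hf => prodMap_minor hf

lemma detMap_mk (f : MvPolynomial (Fin m × Fin n) A) :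
    detMap A m n r (Ideal.Quotient.mk _ f) = prodMap A m n r f := rfl

lemma DetRing.exists_std (f : DetRing A m n (r + 1)) :
    ∃ g : MvPolynomial (Fin m × Fin n) A, (∀ u ∈ g.support, IsStd r u) ∧
      f = Ideal.Quotient.mk _ g := by
  obtain ⟨f, rfl⟩ := Ideal.Quotient.mk_surjective f
  obtain ⟨g, hg, hfg⟩ := _root_.exists_std r f
  exact ⟨g, hg, Ideal.Quotient.eq.2 hfg⟩

lemma std_eq_zero {g : MvPolynomial (Fin m × Fin n) A} (hg : ∀ u ∈ g.support, IsStd r u)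
    (h : prodMap A m n r g = 0) : g = 0 := by
  ext u
  have := coeff_mem_of_lead (r := r) (⊥ : Ideal A) hg (fun u _ e _ => by rw [h, coeff_zero]; rfl) u
  simpa using this

variable (A m n r) in
lemma detMap_injective : Function.Injective (detMap A m n r) := by
  rw [injective_iff_map_eq_zero]
  intro f hf
  obtain ⟨g, hg, rfl⟩ := DetRing.exists_std f
  rw [std_eq_zero hg hf, map_zero]

instance DetRing.isDomain [IsDomain A] : IsDomain (DetRing A m n (r + 1)) :=
  (detMap_injective A m n r).isDomain (detMap A m n r).toRingHom

variable (A m n r) in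
/-- Standard polynomials represent the elements of the determinantal ring. -/
noncomputable def DetRing.stdEquiv :
    restrictSupport A {u : Fin m × Fin n →₀ ℕ | IsStd r u} ≃ₗ[A] DetRing A m n (r + 1) :=
  LinearEquiv.ofBijective
    ((Ideal.Quotient.mkₐ A (minorsIdeal A m n (r + 1))).toLinearMap ∘ₗ
      (restrictSupport A {u | IsStd r u}).subtype) (by
    constructor
    · rw [injective_iff_map_eq_zero]
      rintro ⟨g, hg⟩ h
      have h : (Ideal.Quotient.mk (minorsIdeal A m n (r + 1))) g = 0 := h
      exact Subtype.ext (std_eq_zero (fun u hu => hg hu) (by rw [← detMap_mk, h, map_zero]))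
    · intro f
      obtain ⟨g, hg, rfl⟩ := DetRing.exists_std f
      exact ⟨⟨g, fun u hu => hg u hu⟩, rfl⟩)

instance DetRing.free : Module.Free A (DetRing A m n (r + 1)) :=
  Module.Free.of_basis ((basisRestrictSupport A _).map (DetRing.stdEquiv A m n r))

lemma corner_dvd_of_detMap {i : Fin m} {j : Fin n} (hi : (i : ℕ) = 0) (hj : (j : ℕ) = 0)
    {f : DetRing A m n (r + 1)}
    (h : detMap A m n r (Ideal.Quotient.mk _ (X (i, j))) ∣ detMap A m n r f) :
    Ideal.Quotient.mk _ (X (i, j)) ∣ f := by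
  classical
  obtain ⟨g, hg, rfl⟩ := DetRing.exists_std f
  obtain ⟨t, ht⟩ := h
  set s : Fin m × Fin n →₀ ℕ := Finsupp.single (i, j) 1
  have hsplit : X (i, j) * g.divMonomial s + g.modMonomial s = g :=
    divMonomial_add_modMonomial_single g (i, j)
  have hmod : g.modMonomial s = 0 := by
    have hcoef : ∀ u ∈ (g.modMonomial s).support, IsStd r u ∧ u (i, j) = 0 := by
      intro u hu
      rw [mem_support_iff] at hu
      have hle : ¬ s ≤ u := fun hle => hu (coeff_modMonomial_of_le g hle)
      rw [coeff_modMonomial_of_not_le g hle] at hu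
      refine ⟨hg u (mem_support_iff.2 hu), ?_⟩
      rw [Finsupp.single_le_iff] at hle
      omega
    ext u
    rw [coeff_zero]
    refine coeff_mem_of_lead (r := r) (⊥ : Ideal A) (fun u hu => (hcoef u hu).1)
      (fun u hu e he => ?_) u
    have h1 : prodMap A m n r (g.modMonomial s) =
        prodMap A m n r (X (i, j)) * (t - prodMap A m n r (g.divMonomial s)) := by
      have ht' : prodMap A m n r g = prodMap A m n r (X (i, j)) * t := ht
      rw [mul_sub, ← map_mul, ← ht', eq_sub_iff_add_eq, ← map_add, add_comm, hsplit]
    rw [h1, prodMap_X, Finset.sum_mul, coeff_sum, Finset.sum_eq_zero]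
    · exact Submodule.zero_mem _
    · intro k _
      rw [coeff_monomial_mul', if_neg (he i j hi hj (hcoef u hu).2 k)]
  rw [hmod, add_zero] at hsplit
  rw [← hsplit, map_mul]
  exact dvd_mul_right _ _

end Straightening

section Corner

open MvPolynomial

variable {K : Type} [Field K] {m n r : ℕ}

lemma prime_prodMap_X (p : Fin m × Fin n) : Prime (prodMap K m n (r + 2) (X p)) := by
  classical
  rw [← irreducible_iff_prime, prodMap, aeval_X, Fin.sum_univ_succ, mul_comm (X _)]
  set g : YZPoly K m n (r + 2) := ∑ k : Fin (r + 1), X (Sum.inl (p.1, k.succ)) *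
    X (Sum.inr (k.succ, p.2)) with hgdef
  have hvars : ∀ v ∈ g.vars, v ≠ Sum.inl (p.1, 0) := by
    intro v hv
    have h1 := vars_sum_subset _ _ hv
    rw [Finset.mem_biUnion] at h1
    obtain ⟨k, -, hk⟩ := h1
    have h2 := vars_mul _ _ hk
    rw [vars_X, vars_X] at h2
    simp only [Finset.mem_union, Finset.mem_singleton] at h2
    rcases h2 with rfl | rfl
    · simp [Fin.succ_ne_zero]
    · simp
  refine irreducible_mul_X_add _ _ _ (X_ne_zero _) ?_ (fun h => hvars _ h rfl) ?_
  · simp [vars_X]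
  · refine (X_prime.irreducible.isRelPrime_iff_not_dvd).2 fun hdvd => ?_
    let φ : YZPoly K m n (r + 2) →ₐ[K] K := aeval fun v =>
      if v = Sum.inl (p.1, 1) ∨ v = Sum.inr (1, p.2) then 1 else 0
    have h1 := map_dvd φ hdvd
    have h2 : φ g = 1 := by
      rw [hgdef, map_sum, Finset.sum_eq_single 0]
      · simp [φ]
      · intro k _ hk
        have : k.succ ≠ 1 := fun h => hk (Fin.succ_injective _ (by simpa using h))
        simp [φ, this]
      · simp
    rw [h2] at h1
    simp [φ] at h1

lemma prime_corner {i : Fin m} {j : Fin n} (hi : (i : ℕ) = 0) (hj : (j : ℕ) = 0) :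
    Prime (Ideal.Quotient.mk _ (X (i, j)) : DetRing K m n (r + 2 + 1)) := by
  have h := prime_prodMap_X (K := K) (r := r) (i, j)
  refine ⟨fun h0 => h.ne_zero ?_, fun hu => h.not_isUnit ?_, fun a b hab => ?_⟩
  · rw [← detMap_mk, h0, map_zero]
  · exact hu.map (detMap K m n (r + 2))
  · have := map_dvd (detMap K m n (r + 2)) hab
    rw [map_mul] at this
    exact (h.dvd_or_dvd this).imp (corner_dvd_of_detMap hi hj) (corner_dvd_of_detMap hi hj)

end Corner

section Homogeneous

open MvPolynomial

variable {σ K : Type} [CommRing K] {wt : σ → ℤ}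

lemma weightedHomogeneousComponent_mul {p : MvPolynomial σ K} {d : ℤ}
    (hp : IsWeightedHomogeneous wt p d) (a : ℤ) (f : MvPolynomial σ K) :
    weightedHomogeneousComponent wt a (p * f) =
      p * weightedHomogeneousComponent wt (a - d) f := by
  classical
  induction f using MvPolynomial.induction_on' with
  | monomial u c =>
    have h1 := isWeightedHomogeneous_monomial wt u c rfl
    rw [weightedHomogeneousComponent_of_mem (hp.mul h1), weightedHomogeneousComponent_of_mem h1]
    have : a = d + Finsupp.weight wt u ↔ a - d = Finsupp.weight wt u := by omega
    simp [this]
  | add f g hf hg => rw [mul_add, map_add, hf, hg, map_add, mul_add]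

/-- An ideal containing the weighted homogeneous components of its elements. -/
def IsWeightedIdeal (wt : σ → ℤ) (I : Ideal (MvPolynomial σ K)) : Prop :=
  ∀ f ∈ I, ∀ a, weightedHomogeneousComponent wt a f ∈ I

lemma IsWeightedIdeal.sup_span {I : Ideal (MvPolynomial σ K)} (hI : IsWeightedIdeal wt I)
    {p : MvPolynomial σ K} {d : ℤ} (hp : IsWeightedHomogeneous wt p d) :
    IsWeightedIdeal wt (I ⊔ Ideal.span {p}) := by
  intro f hf a
  obtain ⟨i, hi, q, hq, rfl⟩ := Submodule.mem_sup.1 hf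
  obtain ⟨h, rfl⟩ := Ideal.mem_span_singleton.1 hq
  rw [map_add, weightedHomogeneousComponent_mul hp]
  exact add_mem (Ideal.mem_sup_left (hI i hi a))
    (Ideal.mem_sup_right (Ideal.mem_span_singleton.2 (dvd_mul_right _ _)))

lemma IsWeightedIdeal.exists_add_mul {I : Ideal (MvPolynomial σ K)} (hI : IsWeightedIdeal wt I)
    {p : MvPolynomial σ K} {d : ℤ} (hp : IsWeightedHomogeneous wt p d) {f : MvPolynomial σ K}
    {a : ℤ} (hf : IsWeightedHomogeneous wt f a) (hmem : f ∈ I ⊔ Ideal.span {p}) :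
    ∃ i ∈ I, ∃ h, IsWeightedHomogeneous wt h (a - d) ∧ f = i + p * h := by
  obtain ⟨i, hi, q, hq, rfl⟩ := Submodule.mem_sup.1 hmem
  obtain ⟨h, rfl⟩ := Ideal.mem_span_singleton.1 hq
  refine ⟨_, hI i hi a, _, weightedHomogeneousComponent_isWeightedHomogeneous (a - d) h, ?_⟩
  rw [← weightedHomogeneousComponent_mul hp, ← map_add,
    hf.weightedHomogeneousComponent_same]

/-- Weak regularity of a sequence on the part of weight `a` of the quotient by `I`. -/
def RegOn (wt : σ → ℤ) (a : ℤ) : Ideal (MvPolynomial σ K) → List (MvPolynomial σ K) → Prop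
  | _, [] => True
  | I, x :: t => (∀ f, IsWeightedHomogeneous wt f a → x * f ∈ I → f ∈ I) ∧
      RegOn wt a (I ⊔ Ideal.span {x}) t

lemma regOn_of_forall_mem {a : ℤ} (l : List (MvPolynomial σ K)) :
    ∀ {I : Ideal (MvPolynomial σ K)}, (∀ f, IsWeightedHomogeneous wt f a → f ∈ I) →
      RegOn wt a I l := by
  induction l with
  | nil => intros; trivial
  | cons x t ih =>
    intro I h
    exact ⟨fun f hf _ => h f hf, ih fun f hf => Ideal.mem_sup_left (h f hf)⟩

lemma mem_colon_step {I I' : Ideal (MvPolynomial σ K)} (hI : IsWeightedIdeal wt I)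
    (hI' : IsWeightedIdeal wt I') {z x : MvPolynomial σ K} {a c : ℤ}
    (hz : IsWeightedHomogeneous wt z c) (hx : IsWeightedHomogeneous wt x 0)
    (hcol : ∀ h, IsWeightedHomogeneous wt h (a - c) → (z * h ∈ I ↔ h ∈ I'))
    (hreg : ∀ f, IsWeightedHomogeneous wt f a → x * f ∈ I ⊔ Ideal.span {z} →
      f ∈ I ⊔ Ideal.span {z}) :
    ∀ h, IsWeightedHomogeneous wt h (a - c) →
      (z * h ∈ I ⊔ Ideal.span {x} ↔ h ∈ I' ⊔ Ideal.span {x}) := by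
  intro h hh
  constructor
  · intro hmem
    have hzh : IsWeightedHomogeneous wt (z * h) a := by simpa using hz.mul hh
    obtain ⟨i, hi, s, hs, he⟩ := hI.exists_add_mul hx hzh hmem
    rw [sub_zero] at hs
    have h1 : x * s ∈ I ⊔ Ideal.span {z} := by
      rw [show x * s = z * h - i by rw [he]; ring]
      exact sub_mem (Ideal.mem_sup_right (Ideal.mem_span_singleton.2 (dvd_mul_right _ _)))
        (Ideal.mem_sup_left hi)
    obtain ⟨i', hi', q, hq, rfl⟩ := hI.exists_add_mul hz hs (hreg s hs h1)
    have hxq : IsWeightedHomogeneous wt (x * q) (a - c) := by simpa using hx.mul hq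
    have h2 : h - x * q ∈ I' := by
      rw [← hcol _ (hh.sub hxq), show z * (h - x * q) = i + x * i' by
        linear_combination he]
      exact add_mem hi (I.mul_mem_left _ hi')
    rw [← sub_add_cancel h (x * q)]
    exact add_mem (Ideal.mem_sup_left h2)
      (Ideal.mem_sup_right (Ideal.mem_span_singleton.2 (dvd_mul_right _ _)))
  · intro hmem
    obtain ⟨i, hi, s, hs, he⟩ := hI'.exists_add_mul hx hh hmem
    rw [sub_zero] at hs
    have hxs : IsWeightedHomogeneous wt (x * s) (a - c) := by simpa using hx.mul hs
    have hi2 : IsWeightedHomogeneous wt i (a - c) := by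
      rw [show i = h - x * s by rw [he]; ring]
      exact hh.sub hxs
    rw [he, mul_add]
    refine add_mem (Ideal.mem_sup_left ((hcol i hi2).2 hi)) (Ideal.mem_sup_right ?_)
    exact Ideal.mem_span_singleton.2 ⟨z * s, by ring⟩

/-- The ideal generated by `I` and the members of a list. -/
noncomputable def addList (I : Ideal (MvPolynomial σ K)) (l : List (MvPolynomial σ K)) :
    Ideal (MvPolynomial σ K) :=
  l.foldl (fun I x => I ⊔ Ideal.span {x}) I

lemma addList_cons (I : Ideal (MvPolynomial σ K)) (x : MvPolynomial σ K)
    (l : List (MvPolynomial σ K)) : addList I (x :: l) = addList (I ⊔ Ideal.span {x}) l := rfl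

lemma mul_mem_addList_iff {z : MvPolynomial σ K} {a c : ℤ}
    (hz : IsWeightedHomogeneous wt z c) (l : List (MvPolynomial σ K))
    (hl : ∀ x ∈ l, IsWeightedHomogeneous wt x 0) :
    ∀ {I I' : Ideal (MvPolynomial σ K)}, IsWeightedIdeal wt I → IsWeightedIdeal wt I' →
      (∀ h, IsWeightedHomogeneous wt h (a - c) → (z * h ∈ I ↔ h ∈ I')) →
      RegOn wt a (I ⊔ Ideal.span {z}) l →
      ∀ h, IsWeightedHomogeneous wt h (a - c) → (z * h ∈ addList I l ↔ h ∈ addList I' l) := by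
  induction l with
  | nil => exact fun _ _ hcol _ => hcol
  | cons x t ih =>
    intro I I' hI hI' hcol hreg
    have hx := hl x List.mem_cons_self
    refine ih (fun y hy => hl y (List.mem_cons_of_mem _ hy)) (hI.sup_span hx) (hI'.sup_span hx)
      (mem_colon_step hI hI' hz hx hcol hreg.1) ?_
    rw [sup_right_comm]
    exact hreg.2

lemma regOn_of_colon {z : MvPolynomial σ K} {a c : ℤ}
    (hz : IsWeightedHomogeneous wt z c) (l : List (MvPolynomial σ K))
    (hl : ∀ x ∈ l, IsWeightedHomogeneous wt x 0) :
    ∀ {I I' : Ideal (MvPolynomial σ K)}, IsWeightedIdeal wt I → IsWeightedIdeal wt I' →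
      (∀ h, IsWeightedHomogeneous wt h (a - c) → (z * h ∈ I ↔ h ∈ I')) →
      RegOn wt a (I ⊔ Ideal.span {z}) l → RegOn wt (a - c) I' l → RegOn wt a I l := by
  induction l with
  | nil => intros; trivial
  | cons x t ih =>
    intro I I' hI hI' hcol hreg hreg'
    have hx := hl x List.mem_cons_self
    refine ⟨fun f hf hxf => ?_, ih (fun y hy => hl y (List.mem_cons_of_mem _ hy))
      (hI.sup_span hx) (hI'.sup_span hx) (mem_colon_step hI hI' hz hx hcol hreg.1) ?_ hreg'.2⟩
    · obtain ⟨i, hi, h, hh, rfl⟩ := hI.exists_add_mul hz hf (hreg.1 f hf (Ideal.mem_sup_left hxf))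
      have hxh : IsWeightedHomogeneous wt (x * h) (a - c) := by simpa using hx.mul hh
      have h1 : z * (x * h) ∈ I := by
        rw [show z * (x * h) = x * (i + z * h) - x * i by ring]
        exact sub_mem hxf (I.mul_mem_left _ hi)
      exact add_mem hi ((hcol h hh).2 (hreg'.1 h hh ((hcol _ hxh).1 h1)))
    · rw [sup_right_comm]
      exact hreg.2

lemma isWeightedIdeal_span_X (s : Set σ) :
    IsWeightedIdeal wt (Ideal.span (X '' s : Set (MvPolynomial σ K))) := by
  classical
  intro f hf a
  rw [mem_ideal_span_X_image] at hf ⊢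
  intro u hu
  rw [support_weightedHomogeneousComponent] at hu
  exact hf u (Finset.mem_filter.1 hu).1

lemma mem_span_X_of_X_mul_mem {s : Set σ} {k : σ} (hk : k ∉ s) {f : MvPolynomial σ K}
    (h : X k * f ∈ Ideal.span (X '' s : Set (MvPolynomial σ K))) :
    f ∈ Ideal.span (X '' s : Set (MvPolynomial σ K)) := by
  classical
  rw [mem_ideal_span_X_image] at h ⊢
  intro u hu
  obtain ⟨i, hi, hui⟩ := h (Finsupp.single k 1 + u) (by
    rw [mem_support_iff, coeff_X_mul]
    exact mem_support_iff.1 hu)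
  refine ⟨i, hi, ?_⟩
  have hik : i ≠ k := fun h => hk (h ▸ hi)
  simpa [Finsupp.single_apply, hik.symm] using hui

lemma X_mul_mem_iff {s : Set σ} {j k : σ} (hk : k ∉ s) {f : MvPolynomial σ K} :
    X k * f ∈ Ideal.span (X '' s) ⊔ Ideal.span {X k * X j} ↔
      f ∈ Ideal.span (X '' (insert j s) : Set (MvPolynomial σ K)) := by
  rw [Set.image_insert_eq, Ideal.span_insert, sup_comm (Ideal.span {X j})]
  constructor
  · intro h
    obtain ⟨i, hi, q, hq, he⟩ := Submodule.mem_sup.1 h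
    obtain ⟨g, rfl⟩ := Ideal.mem_span_singleton.1 hq
    have : X k * (f - X j * g) ∈ Ideal.span (X '' s : Set (MvPolynomial σ K)) := by
      rw [show X k * (f - X j * g) = i by linear_combination -he]
      exact hi
    rw [← sub_add_cancel f (X j * g)]
    exact add_mem (Ideal.mem_sup_left (mem_span_X_of_X_mul_mem hk this))
      (Ideal.mem_sup_right (Ideal.mem_span_singleton.2 (dvd_mul_right _ _)))
  · intro h
    obtain ⟨i, hi, q, hq, rfl⟩ := Submodule.mem_sup.1 h
    obtain ⟨g, rfl⟩ := Ideal.mem_span_singleton.1 hq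
    rw [mul_add]
    exact add_mem (Ideal.mem_sup_left (Ideal.mul_mem_left _ _ hi))
      (Ideal.mem_sup_right (Ideal.mem_span_singleton.2 ⟨g, by ring⟩))

lemma span_X_sup_span_mul (s : Set σ) (j k : σ) :
    Ideal.span (X '' s) ⊔ Ideal.span {X k * X j} ⊔ Ideal.span {X k} =
      Ideal.span (X '' (insert k s) : Set (MvPolynomial σ K)) := by
  rw [Set.image_insert_eq, Ideal.span_insert, sup_assoc, sup_comm]
  congr 1
  exact sup_eq_right.2 (Ideal.span_singleton_le_span_singleton.2 (dvd_mul_right _ _))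

end Homogeneous

section Segre

open MvPolynomial

variable {K : Type} [Field K]

/-- The weights on the polynomial ring in two sequences of variables. -/
def segreWt : ℕ ⊕ ℕ → ℤ := Sum.elim (fun _ => -1) (fun _ => 1)

/-- The variables with index beyond `(m, n)`. -/
def segreVars (m n : ℕ) : Set (ℕ ⊕ ℕ) := {v | Sum.elim (fun i => m ≤ i) (fun j => n ≤ j) v}

variable (K) in
/-- The ideal generated by the variables with index beyond `(m, n)`. -/
noncomputable abbrev segreIdeal (m n : ℕ) : Ideal (MvPolynomial (ℕ ⊕ ℕ) K) :=
  Ideal.span (X '' segreVars m n)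

lemma insert_inl_segreVars (m n : ℕ) :
    insert (Sum.inl m) (segreVars (m + 1) n) = segreVars m n := by
  ext (i | j)
  · simp only [segreVars, Set.mem_insert_iff, Sum.inl.injEq, Set.mem_ofPred_eq, Sum.elim_inl]
    omega
  · simp [segreVars]

lemma insert_inr_segreVars (m n : ℕ) :
    insert (Sum.inr n) (segreVars m (n + 1)) = segreVars m n := by
  ext (i | j)
  · simp [segreVars]
  · simp only [segreVars, Set.mem_insert_iff, Sum.inr.injEq, Set.mem_ofPred_eq, Sum.elim_inr]
    omega

lemma inl_notMem_segreVars (m n : ℕ) : Sum.inl m ∉ segreVars (m + 1) n := by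
  simp [segreVars]

lemma inr_notMem_segreVars (m n : ℕ) : Sum.inr n ∉ segreVars m (n + 1) := by
  simp [segreVars]

lemma isWeightedHomogeneous_inl (i : ℕ) :
    IsWeightedHomogeneous segreWt (X (Sum.inl i) : MvPolynomial (ℕ ⊕ ℕ) K) (-1) :=
  isWeightedHomogeneous_X _ _ _

lemma isWeightedHomogeneous_inr (j : ℕ) :
    IsWeightedHomogeneous segreWt (X (Sum.inr j) : MvPolynomial (ℕ ⊕ ℕ) K) 1 :=
  isWeightedHomogeneous_X _ _ _

variable (K) in
/-- The coefficients of the product of two generic power series. -/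
noncomputable def segreSum (s : ℕ) : MvPolynomial (ℕ ⊕ ℕ) K :=
  ∑ p ∈ Finset.HasAntidiagonal.antidiagonal s, X (Sum.inl p.1) * X (Sum.inr p.2)

lemma isWeightedHomogeneous_segreSum (s : ℕ) :
    IsWeightedHomogeneous segreWt (segreSum K s) 0 :=
  IsWeightedHomogeneous.sum _ _ _ fun p _ => by
    simpa using (isWeightedHomogeneous_inl p.1).mul (isWeightedHomogeneous_inr (K := K) p.2)

variable (K) in
/-- The first `N` coefficients of the product, in decreasing order. -/
noncomputable def segreList : ℕ → List (MvPolynomial (ℕ ⊕ ℕ) K)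
  | 0 => []
  | N + 1 => segreSum K N :: segreList N

lemma isWeightedHomogeneous_of_mem_segreList {N : ℕ} {x : MvPolynomial (ℕ ⊕ ℕ) K}
    (hx : x ∈ segreList K N) : IsWeightedHomogeneous segreWt x 0 := by
  induction N with
  | zero => simp [segreList] at hx
  | succ N ih =>
    rcases List.mem_cons.1 hx with rfl | h
    · exact isWeightedHomogeneous_segreSum N
    · exact ih h

lemma segreSum_sub_mem (m n : ℕ) :
    segreSum K (m + n) - X (Sum.inl m) * X (Sum.inr n) ∈ segreIdeal K (m + 1) (n + 1) := by
  rw [segreSum, ← Finset.add_sum_erase _ _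
    (Finset.HasAntidiagonal.mem_antidiagonal.2 (rfl : (m, n).1 + (m, n).2 = _)),
    add_sub_cancel_left]
  refine sum_mem fun p hp => ?_
  rw [Finset.mem_erase, Finset.HasAntidiagonal.mem_antidiagonal] at hp
  obtain ⟨hne, hp⟩ := hp
  have : m + 1 ≤ p.1 ∨ n + 1 ≤ p.2 := by
    by_contra! h
    exact hne (Prod.ext (by dsimp only; omega) (by dsimp only; omega))
  rcases this with h | h
  · exact Ideal.mul_mem_right _ _ (Ideal.subset_span ⟨_, h, rfl⟩)
  · exact Ideal.mul_mem_left _ _ (Ideal.subset_span ⟨_, h, rfl⟩)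

lemma segreIdeal_sup_span_segreSum (m n : ℕ) :
    segreIdeal K (m + 1) (n + 1) ⊔ Ideal.span {segreSum K (m + n)} =
      segreIdeal K (m + 1) (n + 1) ⊔ Ideal.span {X (Sum.inl m) * X (Sum.inr n)} := by
  have h := segreSum_sub_mem (K := K) m n
  refine le_antisymm (sup_le le_sup_left ?_) (sup_le le_sup_left ?_) <;>
    rw [Ideal.span_singleton_le_iff_mem]
  · rw [← sub_add_cancel (segreSum K (m + n))]
    exact add_mem (Ideal.mem_sup_left h) (Ideal.mem_sup_right (Ideal.mem_span_singleton_self _))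
  · rw [← sub_sub_cancel (segreSum K (m + n)) (X (Sum.inl m) * X (Sum.inr n))]
    exact sub_mem (Ideal.mem_sup_right (Ideal.mem_span_singleton_self _)) (Ideal.mem_sup_left h)

lemma weight_segreWt_eq_zero_of_inl {u : ℕ ⊕ ℕ →₀ ℕ} (h : ∀ i, u (Sum.inl i) = 0) :
    0 ≤ Finsupp.weight segreWt u := by
  rw [Finsupp.weight_apply]
  refine Finset.sum_nonneg fun v _ => ?_
  rcases v with i | j
  · simp [h]
  · simp [segreWt]

lemma weight_segreWt_eq_zero_of_inr {u : ℕ ⊕ ℕ →₀ ℕ} (h : ∀ j, u (Sum.inr j) = 0) :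
    Finsupp.weight segreWt u ≤ 0 := by
  rw [Finsupp.weight_apply]
  refine Finset.sum_nonpos fun v _ => ?_
  rcases v with i | j
  · simp [segreWt]
  · simp [h]

lemma mem_span_inl {a : ℤ} (ha : a < 0) {f : MvPolynomial (ℕ ⊕ ℕ) K}
    (hf : IsWeightedHomogeneous segreWt f a) :
    f ∈ Ideal.span (X '' Set.range Sum.inl : Set (MvPolynomial (ℕ ⊕ ℕ) K)) := by
  rw [mem_ideal_span_X_image]
  intro u hu
  by_contra! h
  have h1 := hf (mem_support_iff.1 hu)
  have h2 := weight_segreWt_eq_zero_of_inl fun i => h _ ⟨i, rfl⟩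
  omega

lemma mem_span_inr {a : ℤ} (ha : 0 < a) {f : MvPolynomial (ℕ ⊕ ℕ) K}
    (hf : IsWeightedHomogeneous segreWt f a) :
    f ∈ Ideal.span (X '' Set.range Sum.inr : Set (MvPolynomial (ℕ ⊕ ℕ) K)) := by
  rw [mem_ideal_span_X_image]
  intro u hu
  by_contra! h
  have h1 := hf (mem_support_iff.1 hu)
  have h2 := weight_segreWt_eq_zero_of_inr fun i => h _ ⟨i, rfl⟩
  omega

lemma isWeightedIdeal_segre (m n : ℕ) : IsWeightedIdeal segreWt (segreIdeal K (m + 1) (n + 1) ⊔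
    Ideal.span {X (Sum.inl m) * X (Sum.inr n)}) :=
  (isWeightedIdeal_span_X _).sup_span
    ((isWeightedHomogeneous_inl m).mul (isWeightedHomogeneous_inr n))

lemma regOn_segre (N : ℕ) : ∀ (m n : ℕ) (a : ℤ), m + n = N + 1 → -(n : ℤ) < a → a < m →
    RegOn segreWt a (segreIdeal K m n) (segreList K N) := by
  induction N with
  | zero => intros; trivial
  | succ N ih =>
    intro m n a hN hna ham
    rcases m with _ | m
    · refine regOn_of_forall_mem _ fun f hf => ?_
      refine Ideal.span_mono (Set.image_mono ?_) (mem_span_inl (by simpa using ham) hf)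
      rintro _ ⟨i, rfl⟩
      simp [segreVars]
    rcases n with _ | n
    · refine regOn_of_forall_mem _ fun f hf => ?_
      refine Ideal.span_mono (Set.image_mono ?_) (mem_span_inr (by simpa using hna) hf)
      rintro _ ⟨i, rfl⟩
      simp [segreVars]
    obtain rfl : N = m + n := by omega
    push_cast at hna ham
    refine ⟨fun f _ hf => ?_, ?_⟩
    · have h : X (Sum.inl m) * (X (Sum.inr n) * f) ∈ segreIdeal K (m + 1) (n + 1) := by
        rw [show X (Sum.inl m) * (X (Sum.inr n) * f) = segreSum K (m + n) * f -
          (segreSum K (m + n) - X (Sum.inl m) * X (Sum.inr n)) * f by ring]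
        exact sub_mem hf (Ideal.mul_mem_right _ _ (segreSum_sub_mem m n))
      exact mem_span_X_of_X_mul_mem (inr_notMem_segreVars _ _)
        (mem_span_X_of_X_mul_mem (inl_notMem_segreVars _ _) h)
    · rw [segreIdeal_sup_span_segreSum]
      by_cases h0 : m + n = 0
      · rw [h0]
        trivial
      by_cases ha : -(n : ℤ) < a
      · refine regOn_of_colon (isWeightedHomogeneous_inr n) _
          (fun _ => isWeightedHomogeneous_of_mem_segreList) (isWeightedIdeal_segre m n)
          (isWeightedIdeal_span_X (segreVars m (n + 1))) (fun h _ => ?_) ?_ ?_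
        · rw [mul_comm (X (Sum.inl m)), X_mul_mem_iff (inr_notMem_segreVars _ _),
            insert_inl_segreVars]
        · rw [mul_comm (X (Sum.inl m)), span_X_sup_span_mul, insert_inr_segreVars]
          exact ih _ _ _ (by omega) ha (by push_cast; omega)
        · exact ih _ _ _ (by omega) (by push_cast; omega) (by omega)
      · refine regOn_of_colon (isWeightedHomogeneous_inl m) _
          (fun _ => isWeightedHomogeneous_of_mem_segreList) (isWeightedIdeal_segre m n)
          (isWeightedIdeal_span_X (segreVars (m + 1) n)) (fun h _ => ?_) ?_ ?_
        · rw [X_mul_mem_iff (inl_notMem_segreVars _ _), insert_inr_segreVars]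
        · rw [span_X_sup_span_mul, insert_inl_segreVars]
          exact ih _ _ _ (by omega) (by push_cast; omega) (by omega)
        · exact ih _ _ _ (by omega) (by omega) (by push_cast; omega)

lemma addList_le {σ R : Type} [CommRing R] {T : Ideal (MvPolynomial σ R)}
    (l : List (MvPolynomial σ R)) (hl : ∀ x ∈ l, x ∈ T) :
    ∀ {I : Ideal (MvPolynomial σ R)}, I ≤ T → addList I l ≤ T := by
  induction l with
  | nil => exact fun h => h
  | cons x t ih =>
    intro I hI
    exact ih (fun y hy => hl y (List.mem_cons_of_mem _ hy))
      (sup_le hI (by simpa using hl x List.mem_cons_self))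

lemma pow_mul_pow_notMem (m n : ℕ) :
    X (Sum.inl m) ^ n * X (Sum.inr 0) ^ m ∉
      addList (segreIdeal K (m + 1) (n + 1)) (segreList K (m + n + 1)) := by
  induction n with
  | zero =>
    intro h
    let φ : MvPolynomial (ℕ ⊕ ℕ) K →ₐ[K] K := aeval (Pi.single (Sum.inr 0) 1)
    have hle : addList (segreIdeal K (m + 1) (0 + 1)) (segreList K (m + 0 + 1)) ≤
        RingHom.ker φ := by
      refine addList_le _ (fun x hx => ?_) ?_
      · have hsum (s : ℕ) : segreSum K s ∈ RingHom.ker φ := by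
          rw [RingHom.mem_ker, segreSum, map_sum]
          exact Finset.sum_eq_zero fun p _ => by simp [φ]
        generalize m + 0 + 1 = N at hx
        induction N with
        | zero => simp [segreList] at hx
        | succ N ih =>
          rcases List.mem_cons.1 hx with rfl | h
          · exact hsum N
          · exact ih h
      · rw [segreIdeal, Ideal.span_le]
        rintro _ ⟨v, hv, rfl⟩
        have : v ≠ Sum.inr 0 := by
          rintro rfl
          simp [segreVars] at hv
        simp [φ, this]
    have := hle h
    simp [φ] at this
  | succ n ih =>
    intro h
    refine ih ?_
    have hhom : IsWeightedHomogeneous segreWt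
        (X (Sum.inl m) ^ n * X (Sum.inr 0) ^ m : MvPolynomial (ℕ ⊕ ℕ) K)
        ((m : ℤ) - n - 1 - (-1)) := by
      have := ((isWeightedHomogeneous_inl (K := K) m).pow n).mul
        ((isWeightedHomogeneous_inr (K := K) 0).pow m)
      convert this using 1
      simp
      ring
    rw [show m + (n + 1) + 1 = (m + (n + 1)) + 1 from rfl, segreList, addList_cons,
      segreIdeal_sup_span_segreSum, pow_succ', mul_assoc,
      mul_mem_addList_iff (isWeightedHomogeneous_inl m) _
        (fun _ => isWeightedHomogeneous_of_mem_segreList) (isWeightedIdeal_segre m (n + 1))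
          (isWeightedIdeal_span_X (segreVars (m + 1) (n + 1))) (fun h _ => ?_) ?_ _ hhom] at h
    · exact h
    · rw [span_X_sup_span_mul, insert_inl_segreVars]
      exact regOn_segre _ _ _ _ (by omega) (by push_cast; omega) (by omega)
    · rw [X_mul_mem_iff (inl_notMem_segreVars _ _), insert_inr_segreVars]

end Segre

namespace Polynomial

variable {B : Type} [CommRing B]

lemma contentIdeal_le_iff {p : B[X]} {I : Ideal B} : p.contentIdeal ≤ I ↔ ∀ j, p.coeff j ∈ I := by
  rw [contentIdeal_def, Ideal.span_le]
  constructor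
  · intro h j
    by_cases hj : p.coeff j = 0
    · rw [hj]
      exact I.zero_mem
    · exact h (coeff_mem_coeffs hj)
  · intro h c hc
    obtain ⟨j, -, rfl⟩ := mem_coeffs_iff.1 hc
    exact h j

lemma mul_contentIdeal_le_of_forall {p : B[X]} {I T : Ideal B}
    (h : ∀ x ∈ I, ∀ j, x * p.coeff j ∈ T) : I * p.contentIdeal ≤ T := by
  rw [Ideal.mul_le]
  intro x hx
  have : p.contentIdeal ≤ (Submodule.comap (LinearMap.mulLeft B x) T : Ideal B) :=
    contentIdeal_le_iff.2 fun j => h x hx j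
  exact fun y hy => this hy

/-- The Dedekind–Mertens lemma. -/
theorem contentIdeal_pow_mul_le (F : B[X]) (N : ℕ) : ∀ G : B[X], G.natDegree ≤ N →
    F.contentIdeal ^ (N + 1) * G.contentIdeal ≤ F.contentIdeal ^ N * (F * G).contentIdeal := by
  induction N with
  | zero =>
    intro G hG
    rw [eq_C_of_natDegree_le_zero hG, zero_add, pow_one, pow_zero, one_mul, contentIdeal_C,
      mul_comm, Ideal.span_singleton_mul_le_iff]
    intro x hx
    have : F.contentIdeal ≤ Submodule.comap (LinearMap.mulLeft B (G.coeff 0))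
        (F * C (G.coeff 0)).contentIdeal := contentIdeal_le_iff.2 fun j => by
      rw [Submodule.mem_comap, LinearMap.mulLeft_apply, mul_comm (G.coeff 0), ← coeff_mul_C]
      exact coeff_mem_contentIdeal (F * C (G.coeff 0)) j
    exact this hx
  | succ N ih =>
    intro G hG
    set T := F.contentIdeal ^ (N + 1) * (F * G).contentIdeal with hT
    have key : ∀ d k, F.natDegree < k + d → ∀ P ∈ F.contentIdeal ^ (N + 1), ∀ j,
        P * (F.coeff k * G.coeff j) ∈ T := by
      intro d
      induction d with
      | zero =>
        intro k hk P _ j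
        rw [coeff_eq_zero_of_natDegree_lt (by omega), zero_mul, mul_zero]
        exact T.zero_mem
      | succ d ihd =>
        intro k hk
        have top : ∀ P ∈ F.contentIdeal ^ (N + 1),
            P * (F.coeff k * G.coeff (N + 1)) ∈ T := by
          intro P hP
          have h1 : P * (F * G).coeff (k + (N + 1)) ∈ T :=
            Ideal.mul_mem_mul hP (coeff_mem_contentIdeal _ _)
          rw [coeff_mul, ← Finset.add_sum_erase _ _ (Finset.HasAntidiagonal.mem_antidiagonal.2
            (rfl : (k, N + 1).1 + (k, N + 1).2 = _)), mul_add, Finset.mul_sum] at h1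
          refine (Submodule.add_mem_iff_left _ (sum_mem fun p hp => ?_)).1 h1
          rw [Finset.mem_erase, Finset.HasAntidiagonal.mem_antidiagonal] at hp
          by_cases hp2 : N + 1 < p.2
          · rw [coeff_eq_zero_of_natDegree_lt (hG.trans_lt hp2), mul_zero, mul_zero]
            exact T.zero_mem
          · refine ihd p.1 ?_ P hP p.2
            have : p.1 ≠ k := fun h => hp.1 (Prod.ext h (by have := hp.2; dsimp only; omega))
            omega
        intro P hP j
        rcases lt_trichotomy j (N + 1) with hj | rfl | hj
        · set G' : B[X] := C (F.coeff k) * (G - monomial (N + 1) (G.coeff (N + 1))) with hG'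
          have hdeg : G'.natDegree ≤ N := by
            rw [natDegree_le_iff_coeff_eq_zero]
            intro i hi
            rw [hG', coeff_C_mul, coeff_sub, coeff_monomial]
            split_ifs with h
            · rw [h, sub_self, mul_zero]
            · rw [coeff_eq_zero_of_natDegree_lt (p := G) (by omega), sub_zero, mul_zero]
          have hle : F.contentIdeal ^ N * (F * G').contentIdeal ≤ T := by
            refine mul_contentIdeal_le_of_forall fun Q hQ s => ?_
            have he : F * G' = C (F.coeff k) * (F * G) -
                C (F.coeff k * G.coeff (N + 1)) * (F * X ^ (N + 1)) := by
              rw [hG', ← C_mul_X_pow_eq_monomial, C_mul]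
              ring
            rw [he, coeff_sub, coeff_C_mul, coeff_C_mul, coeff_mul_X_pow', mul_sub]
            refine sub_mem ?_ ?_
            · rw [← mul_assoc]
              refine Ideal.mul_mem_mul ?_ (coeff_mem_contentIdeal _ _)
              rw [pow_succ]
              exact Ideal.mul_mem_mul hQ (coeff_mem_contentIdeal _ _)
            · split_ifs with hs
              · rw [mul_comm (F.coeff k * _), ← mul_assoc]
                refine top _ ?_
                rw [pow_succ]
                exact Ideal.mul_mem_mul hQ (coeff_mem_contentIdeal _ _)
              · rw [mul_zero, mul_zero]
                exact T.zero_mem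
          have h1 := hle (ih G' hdeg (Ideal.mul_mem_mul hP (coeff_mem_contentIdeal G' j)))
          rwa [hG', coeff_C_mul, coeff_sub, coeff_monomial_of_ne _ hj.ne, sub_zero] at h1
        · exact top P hP
        · rw [coeff_eq_zero_of_natDegree_lt (hG.trans_lt hj), mul_zero, mul_zero]
          exact T.zero_mem
    rw [pow_succ (n := N + 1), mul_assoc, Ideal.mul_le]
    intro P hP
    have : F.contentIdeal * G.contentIdeal ≤ (Submodule.comap (LinearMap.mulLeft B P) T) := by
      refine mul_contentIdeal_le_of_forall fun x hx j => ?_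
      have : F.contentIdeal ≤ Submodule.comap (LinearMap.mulLeft B (P * G.coeff j)) T :=
        contentIdeal_le_iff.2 fun k => by
          have := key (F.natDegree + 1) k (by omega) P hP j
          rw [Submodule.mem_comap, LinearMap.mulLeft_apply]
          convert this using 1
          ring
      have := this hx
      rw [Submodule.mem_comap, LinearMap.mulLeft_apply] at this ⊢
      convert this using 1
      ring
    exact fun y hy => this hy

end Polynomial

section SegreMap

open MvPolynomial

variable {K : Type} [Field K] {n : ℕ}

lemma weight_sub_single {u : ℕ ⊕ ℕ →₀ ℕ} {v : ℕ ⊕ ℕ} (hv : u v ≠ 0) :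
    Finsupp.weight segreWt u = Finsupp.weight segreWt (u - Finsupp.single v 1) + segreWt v := by
  conv_lhs => rw [← tsub_add_cancel_of_le (Finsupp.single_le_iff.2 (Nat.one_le_iff_ne_zero.2 hv))]
  rw [map_add, Finsupp.weight_single, one_smul]

lemma exists_inl_inr {u : ℕ ⊕ ℕ →₀ ℕ} (hu : u ≠ 0) (hw : Finsupp.weight segreWt u = 0) :
    (∃ i, u (Sum.inl i) ≠ 0) ∧ ∃ j, u (Sum.inr j) ≠ 0 := by
  obtain ⟨v, hv⟩ := Finsupp.ne_iff.1 hu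
  rw [Finsupp.zero_apply] at hv
  have h1 := weight_sub_single hv
  rw [hw] at h1
  rcases v with i | j
  · refine ⟨⟨i, hv⟩, ?_⟩
    by_contra! h
    have := weight_segreWt_eq_zero_of_inr (u := u - Finsupp.single (Sum.inl i) 1)
      fun j => by simp [h]
    simp only [segreWt, Sum.elim_inl] at h1 this
    omega
  · refine ⟨?_, ⟨j, hv⟩⟩
    by_contra! h
    have := weight_segreWt_eq_zero_of_inl (u := u - Finsupp.single (Sum.inr j) 1)
      fun i => by simp [h]
    simp only [segreWt, Sum.elim_inr] at h1 this
    omega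

open Classical in
variable (K n) in
/-- The substitution of zero for the variables of index at least `n`. -/
noncomputable def segreTrunc : MvPolynomial (ℕ ⊕ ℕ) K →ₐ[K] MvPolynomial (ℕ ⊕ ℕ) K :=
  aeval fun v => if v ∈ segreVars n n then 0 else X v

lemma segreTrunc_X_of_mem {v : ℕ ⊕ ℕ} (hv : v ∈ segreVars n n) : segreTrunc K n (X v) = 0 := by
  simp [segreTrunc, hv]

lemma segreTrunc_X_of_notMem {v : ℕ ⊕ ℕ} (hv : v ∉ segreVars n n) :
    segreTrunc K n (X v) = X v := by
  simp [segreTrunc, hv]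

lemma segreTrunc_inl {i : ℕ} (hi : i < n) :
    segreTrunc K n (X (Sum.inl i)) = X (Sum.inl i) :=
  segreTrunc_X_of_notMem (by simpa [segreVars] using hi)

lemma segreTrunc_inr {i : ℕ} (hi : i < n) :
    segreTrunc K n (X (Sum.inr i)) = X (Sum.inr i) :=
  segreTrunc_X_of_notMem (by simpa [segreVars] using hi)

lemma segreTrunc_eq_zero {f : MvPolynomial (ℕ ⊕ ℕ) K} (hf : f ∈ segreIdeal K n n) :
    segreTrunc K n f = 0 := by
  suffices segreIdeal K n n ≤ RingHom.ker (segreTrunc K n) from this hf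
  rw [segreIdeal, Ideal.span_le]
  rintro _ ⟨v, hv, rfl⟩
  exact segreTrunc_X_of_mem hv

lemma sub_segreTrunc_mem (f : MvPolynomial (ℕ ⊕ ℕ) K) :
    f - segreTrunc K n f ∈ segreIdeal K n n := by
  have : Ideal.Quotient.mkₐ K (segreIdeal K n n) =
      (Ideal.Quotient.mkₐ K (segreIdeal K n n)).comp (segreTrunc K n) := by
    refine MvPolynomial.algHom_ext fun v => ?_
    by_cases hv : v ∈ segreVars n n
    · rw [AlgHom.comp_apply, segreTrunc_X_of_mem hv, map_zero]
      exact Ideal.Quotient.eq_zero_iff_mem.2 (Ideal.subset_span ⟨v, hv, rfl⟩)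
    · rw [AlgHom.comp_apply, segreTrunc_X_of_notMem hv]
  exact Ideal.Quotient.eq.1 (DFunLike.congr_fun this f)

lemma segreTrunc_monomial (u : ℕ ⊕ ℕ →₀ ℕ) (c : K) :
    ((∀ v, u v ≠ 0 → v ∉ segreVars n n) ∧ segreTrunc K n (monomial u c) = monomial u c) ∨
      segreTrunc K n (monomial u c) = 0 := by
  by_cases h : ∀ v, u v ≠ 0 → v ∉ segreVars n n
  · refine Or.inl ⟨h, ?_⟩
    rw [segreTrunc, aeval_monomial, monomial_eq]
    congr 1
    refine Finsupp.prod_congr fun v hv => ?_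
    rw [if_neg (h v (Finsupp.mem_support_iff.1 hv))]
  · push Not at h
    obtain ⟨v, hv, hv'⟩ := h
    refine Or.inr (segreTrunc_eq_zero ?_)
    rw [mem_ideal_span_X_image]
    intro u' hu'
    have := support_monomial_subset hu'
    rw [Finset.mem_singleton] at this
    exact ⟨v, hv', this ▸ hv⟩

lemma isWeightedHomogeneous_segreTrunc {f : MvPolynomial (ℕ ⊕ ℕ) K} {a : ℤ}
    (hf : IsWeightedHomogeneous segreWt f a) :
    IsWeightedHomogeneous segreWt (segreTrunc K n f) a := by
  rw [f.as_sum, map_sum]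
  refine IsWeightedHomogeneous.sum _ _ _ fun u hu => ?_
  rcases segreTrunc_monomial (n := n) u (coeff u f) with h | h
  · rw [h.2]
    exact isWeightedHomogeneous_monomial _ _ _ (hf (mem_support_iff.1 hu))
  · rw [h]
    exact isWeightedHomogeneous_zero _ _ _

variable (K n) in
/-- The embedding of the ring of the generic matrix of rank one in a polynomial ring. -/
noncomputable def segreMap : DetRing K n n (1 + 1) →ₐ[K] MvPolynomial (ℕ ⊕ ℕ) K :=
  (rename (Sum.map (fun p : Fin n × Fin 1 => (p.1 : ℕ)) fun p : Fin 1 × Fin n => (p.2 : ℕ))).comp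
    (detMap K n n 1)

variable (K n) in
lemma segreMap_injective : Function.Injective (segreMap K n) := by
  refine (rename_injective _ (Function.Injective.sumMap ?_ ?_)).comp (detMap_injective K n n 1)
  · exact fun p q h => Prod.ext (Fin.ext h) (Subsingleton.elim _ _)
  · exact fun p q h => Prod.ext (Subsingleton.elim _ _) (Fin.ext h)

lemma segreMap_X (p : Fin n × Fin n) :
    segreMap K n (Ideal.Quotient.mk _ (X p)) =
      X (Sum.inl (p.1 : ℕ)) * X (Sum.inr (p.2 : ℕ)) := by
  rw [segreMap, AlgHom.comp_apply, detMap_mk, prodMap, aeval_X]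
  simp

lemma segreTrunc_segreMap (f : DetRing K n n (1 + 1)) :
    segreTrunc K n (segreMap K n f) = segreMap K n f := by
  have : (segreTrunc K n).comp (segreMap K n) = segreMap K n := by
    refine Ideal.Quotient.algHom_ext _ (MvPolynomial.algHom_ext fun p => ?_)
    change segreTrunc K n (segreMap K n (Ideal.Quotient.mk _ (X p))) =
      segreMap K n (Ideal.Quotient.mk _ (X p))
    rw [segreMap_X, map_mul, segreTrunc_inl p.1.2, segreTrunc_inr p.2.2]
  exact DFunLike.congr_fun this f

lemma isWeightedHomogeneous_segreMap (f : DetRing K n n (1 + 1)) :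
    IsWeightedHomogeneous segreWt (segreMap K n f) 0 := by
  obtain ⟨f, rfl⟩ := Ideal.Quotient.mk_surjective f
  induction f using MvPolynomial.induction_on with
  | C a =>
    rw [show Ideal.Quotient.mk _ (C a) = algebraMap K (DetRing K n n (1 + 1)) a from rfl,
      AlgHom.commutes]
    exact isWeightedHomogeneous_C _ _
  | add f g hf hg =>
    rw [map_add, map_add]
    exact hf.add hg
  | mul_X f p hf =>
    rw [map_mul, map_mul, segreMap_X]
    simpa using hf.mul ((isWeightedHomogeneous_inl (K := K) p.1).mul
      (isWeightedHomogeneous_inr (K := K) p.2))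

lemma monomial_mem_range_segreMap (N : ℕ) : ∀ u : ℕ ⊕ ℕ →₀ ℕ, u.degree = N →
    (∀ v, u v ≠ 0 → v ∉ segreVars n n) → Finsupp.weight segreWt u = 0 →
    monomial u (1 : K) ∈ (segreMap K n).range := by
  induction N using Nat.strong_induction_on with
  | _ N ih =>
  intro u hN hu hw
  by_cases h0 : u = 0
  · rw [h0]
    exact one_mem _
  obtain ⟨⟨i, hi⟩, j, hj⟩ := exists_inl_inr h0 hw
  have hin : i < n := by simpa [segreVars] using hu _ hi
  have hjn : j < n := by simpa [segreVars] using hu _ hj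
  set u₁ := u - Finsupp.single (Sum.inl i) 1 with hu₁
  have hj₁ : u₁ (Sum.inr j) ≠ 0 := by simpa [hu₁] using hj
  set u₂ := u₁ - Finsupp.single (Sum.inr j) 1 with hu₂
  have e₁ : u = u₁ + Finsupp.single (Sum.inl i) 1 :=
    (tsub_add_cancel_of_le (Finsupp.single_le_iff.2 (Nat.one_le_iff_ne_zero.2 hi))).symm
  have e₂ : u₁ = u₂ + Finsupp.single (Sum.inr j) 1 :=
    (tsub_add_cancel_of_le (Finsupp.single_le_iff.2 (Nat.one_le_iff_ne_zero.2 hj₁))).symm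
  have hdeg : u₂.degree < N := by
    rw [← hN, e₁, e₂]
    simp
  have hmem := ih _ hdeg u₂ rfl (fun v hv => hu v ?_) ?_
  · have : monomial u (1 : K) = monomial u₂ 1 *
        segreMap K n (Ideal.Quotient.mk _ (X (⟨i, hin⟩, ⟨j, hjn⟩))) := by
      rw [segreMap_X, X, X, monomial_mul, monomial_mul, one_mul, one_mul, e₁, e₂, add_assoc,
        add_comm (Finsupp.single (Sum.inr j) 1)]
    rw [this]
    exact mul_mem hmem ⟨_, rfl⟩
  · rw [e₁, e₂]
    simp only [Finsupp.add_apply]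
    omega
  · rw [weight_sub_single hi, ← hu₁, weight_sub_single hj₁, ← hu₂] at hw
    simp only [segreWt, Sum.elim_inl, Sum.elim_inr] at hw ⊢
    omega

lemma exists_segreMap_eq {f : MvPolynomial (ℕ ⊕ ℕ) K} (hf : IsWeightedHomogeneous segreWt f 0) :
    ∃ s, segreMap K n s = segreTrunc K n f := by
  suffices segreTrunc K n f ∈ (segreMap K n).range from this
  rw [f.as_sum, map_sum]
  refine sum_mem fun u hu => ?_
  rcases segreTrunc_monomial (n := n) u (coeff u f) with h | h
  · rw [h.2, show monomial u (coeff u f) = coeff u f • monomial u (1 : K) by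
      rw [smul_monomial, smul_eq_mul, mul_one]]
    exact Subalgebra.smul_mem _
      (monomial_mem_range_segreMap _ u rfl h.1 (hf (mem_support_iff.1 hu))) _
  · rw [h]
    exact zero_mem _

/-- An ideal of the ring of the generic rank one matrix is the contraction of an ideal of the
polynomial ring. -/
structure SegreMatch (A : Ideal (DetRing K n n (1 + 1))) (B : Ideal (MvPolynomial (ℕ ⊕ ℕ) K)) :
    Prop where
  weighted : IsWeightedIdeal segreWt B
  le : segreIdeal K n n ≤ B
  mem_iff : ∀ f, f ∈ A ↔ segreMap K n f ∈ B

lemma segreMatch_bot : SegreMatch (⊥ : Ideal (DetRing K n n (1 + 1))) (segreIdeal K n n) where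
  weighted := isWeightedIdeal_span_X _
  le := le_rfl
  mem_iff f := by
    rw [Ideal.mem_bot]
    constructor
    · rintro rfl
      rw [map_zero]
      exact zero_mem _
    · intro h
      refine segreMap_injective K n ?_
      rw [map_zero, ← segreTrunc_segreMap, segreTrunc_eq_zero h]

lemma SegreMatch.sup {A : Ideal (DetRing K n n (1 + 1))} {B : Ideal (MvPolynomial (ℕ ⊕ ℕ) K)}
    (h : SegreMatch A B) {s : DetRing K n n (1 + 1)} {x : MvPolynomial (ℕ ⊕ ℕ) K}
    (hx : IsWeightedHomogeneous segreWt x 0) (hs : segreMap K n s = segreTrunc K n x) :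
    SegreMatch (A ⊔ Ideal.span {s}) (B ⊔ Ideal.span {x}) where
  weighted := h.weighted.sup_span hx
  le := h.le.trans le_sup_left
  mem_iff f := by
    have hxs : x - segreMap K n s ∈ B := by
      rw [hs]
      exact h.le (sub_segreTrunc_mem x)
    constructor
    · intro hf
      obtain ⟨a, ha, q, hq, rfl⟩ := Submodule.mem_sup.1 hf
      obtain ⟨t, rfl⟩ := Ideal.mem_span_singleton.1 hq
      rw [map_add, map_mul, show segreMap K n s = x - (x - segreMap K n s) by ring, sub_mul]
      exact add_mem (Ideal.mem_sup_left ((h.mem_iff a).1 ha))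
        (sub_mem (Ideal.mem_sup_right (Ideal.mem_span_singleton.2 (dvd_mul_right _ _)))
          (Ideal.mem_sup_left (Ideal.mul_mem_right _ _ hxs)))
    · intro hf
      obtain ⟨b, hb, g, hg, he⟩ :=
        h.weighted.exists_add_mul hx (isWeightedHomogeneous_segreMap f) hf
      rw [sub_zero] at hg
      obtain ⟨t, ht⟩ := exists_segreMap_eq (n := n) hg
      have : f - s * t ∈ A := by
        rw [h.mem_iff, map_sub, map_mul, he, show b + x * g - segreMap K n s * segreMap K n t =
          b + ((x - segreMap K n s) * segreMap K n t + x * (g - segreMap K n t)) by ring]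
        refine add_mem hb (add_mem (Ideal.mul_mem_right _ _ hxs) (Ideal.mul_mem_left _ _ ?_))
        rw [ht]
        exact h.le (sub_segreTrunc_mem g)
      rw [← sub_add_cancel f (s * t)]
      exact add_mem (Ideal.mem_sup_left this)
        (Ideal.mem_sup_right (Ideal.mem_span_singleton.2 (dvd_mul_right _ _)))

lemma SegreMatch.wReg {l : List (DetRing K n n (1 + 1))} {l' : List (MvPolynomial (ℕ ⊕ ℕ) K)}
    (hl : List.Forall₂ (fun s x => segreMap K n s = segreTrunc K n x) l l') :
    (∀ x ∈ l', IsWeightedHomogeneous segreWt x 0) →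
    ∀ {A : Ideal (DetRing K n n (1 + 1))} {B : Ideal (MvPolynomial (ℕ ⊕ ℕ) K)},
      SegreMatch A B → (RegOn segreWt 0 B l' → WReg A l) ∧
        SegreMatch (A ⊔ Ideal.span {x | x ∈ l}) (addList B l') := by
  induction hl with
  | nil =>
    intro _ A B h
    refine ⟨fun _ => trivial, ?_⟩
    have : {x : DetRing K n n (1 + 1) | x ∈ []} = ∅ := by ext; simp
    rw [this, Ideal.span_empty, sup_bot_eq]
    exact h
  | @cons s x l l' hs _ ih =>
    intro hl' A B h
    have hx := hl' x List.mem_cons_self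
    obtain ⟨h1, h2⟩ := ih (fun y hy => hl' y (List.mem_cons_of_mem _ hy)) (h.sup hx hs)
    refine ⟨fun hreg => ⟨fun f hf => ?_, h1 hreg.2⟩, ?_⟩
    · rw [h.mem_iff]
      refine hreg.1 _ (isWeightedHomogeneous_segreMap f) ?_
      rw [h.mem_iff, map_mul, hs] at hf
      rw [show x * segreMap K n f = segreTrunc K n x * segreMap K n f +
        (x - segreTrunc K n x) * segreMap K n f by ring]
      exact add_mem hf (Ideal.mul_mem_right _ _ (h.le (sub_segreTrunc_mem x)))
    · have : {y | y ∈ s :: l} = insert s {y | y ∈ l} := by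
        ext
        simp
      rw [this, Ideal.span_insert, ← sup_assoc]
      exact h2

lemma exists_forall₂_segreMap (l' : List (MvPolynomial (ℕ ⊕ ℕ) K))
    (hl' : ∀ x ∈ l', IsWeightedHomogeneous segreWt x 0) :
    ∃ l, List.Forall₂ (fun s x => segreMap K n s = segreTrunc K n x) l l' := by
  induction l' with
  | nil => exact ⟨[], List.Forall₂.nil⟩
  | cons x l' ih =>
    obtain ⟨l, hl⟩ := ih fun y hy => hl' y (List.mem_cons_of_mem _ hy)
    obtain ⟨s, hs⟩ := exists_segreMap_eq (n := n) (hl' x List.mem_cons_self)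
    exact ⟨s :: l, List.Forall₂.cons hs hl⟩

end SegreMap

section SegreContent

open MvPolynomial

variable {K : Type} [Field K]

lemma le_addList {σ R : Type} [CommRing R] (l : List (MvPolynomial σ R)) :
    ∀ I : Ideal (MvPolynomial σ R), I ≤ addList I l := by
  induction l with
  | nil => exact fun I => le_rfl
  | cons x t ih => exact fun I => le_sup_left.trans (ih _)

lemma mem_addList {σ R : Type} [CommRing R] {l : List (MvPolynomial σ R)}
    {x : MvPolynomial σ R} (hx : x ∈ l) : ∀ I : Ideal (MvPolynomial σ R), x ∈ addList I l := by
  induction l with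
  | nil => simp at hx
  | cons y t ih =>
    intro I
    rcases List.mem_cons.1 hx with rfl | h
    · exact le_addList t _ (Ideal.mem_sup_right (Ideal.mem_span_singleton_self x))
    · exact ih h _

lemma segreSum_mem_segreList {N s : ℕ} (hs : s < N) : segreSum K s ∈ segreList K N := by
  induction N with
  | zero => omega
  | succ N ih =>
    rcases Nat.lt_succ_iff_lt_or_eq.1 hs with h | rfl
    · exact List.mem_cons_of_mem _ (ih h)
    · exact List.mem_cons_self

variable (K) in
/-- The polynomial whose coefficients are the first `k + 2` variables of the sequence `v`. -/
noncomputable def segrePoly (v : ℕ → ℕ ⊕ ℕ) (k : ℕ) : Polynomial (MvPolynomial (ℕ ⊕ ℕ) K) :=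
  ∑ i ∈ Finset.range (k + 2), Polynomial.monomial i (X (v i))

lemma coeff_segrePoly (v : ℕ → ℕ ⊕ ℕ) (k j : ℕ) :
    (segrePoly K v k).coeff j = if j < k + 2 then X (v j) else 0 := by
  simp [segrePoly, Polynomial.coeff_monomial]

lemma natDegree_segrePoly_le (v : ℕ → ℕ ⊕ ℕ) (k : ℕ) : (segrePoly K v k).natDegree ≤ k + 1 := by
  rw [Polynomial.natDegree_le_iff_coeff_eq_zero]
  intro j hj
  rw [coeff_segrePoly, if_neg (by omega)]

lemma X_mem_contentIdeal_segrePoly (v : ℕ → ℕ ⊕ ℕ) {k j : ℕ} (hj : j < k + 2) :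
    (X (v j) : MvPolynomial (ℕ ⊕ ℕ) K) ∈ (segrePoly K v k).contentIdeal := by
  have := Polynomial.coeff_mem_contentIdeal (segrePoly K v k) j
  rwa [coeff_segrePoly, if_pos hj] at this

lemma contentIdeal_segrePoly_mul_le (k : ℕ) :
    (segrePoly K Sum.inl k * segrePoly K Sum.inr k).contentIdeal ≤
      addList (segreIdeal K (k + 2) (k + 2)) (segreList K (k + 1 + (k + 1) + 1)) := by
  rw [Polynomial.contentIdeal_le_iff]
  intro j
  by_cases hj : j < k + 1 + (k + 1) + 1
  · have h : (segrePoly K Sum.inl k * segrePoly K Sum.inr k).coeff j =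
        segreTrunc K (k + 2) (segreSum K j) := by
      rw [Polynomial.coeff_mul, segreSum, map_sum]
      refine Finset.sum_congr rfl fun p _ => ?_
      rw [map_mul, coeff_segrePoly, coeff_segrePoly]
      congr 1
      · split_ifs with h
        · rw [segreTrunc_inl h]
        · rw [segreTrunc_X_of_mem (by simpa [segreVars] using h)]
      · split_ifs with h
        · rw [segreTrunc_inr h]
        · rw [segreTrunc_X_of_mem (by simpa [segreVars] using h)]
    rw [h, ← sub_sub_cancel (segreSum K j) (segreTrunc K (k + 2) (segreSum K j))]
    exact sub_mem (mem_addList (segreSum_mem_segreList hj) _)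
      (le_addList _ _ (sub_segreTrunc_mem _))
  · rw [Polynomial.coeff_eq_zero_of_natDegree_lt]
    · exact zero_mem _
    · have := Polynomial.natDegree_mul_le (p := segrePoly K Sum.inl k) (q := segrePoly K Sum.inr k)
      have h1 := natDegree_segrePoly_le (K := K) Sum.inl k
      have h2 := natDegree_segrePoly_le (K := K) Sum.inr k
      omega

lemma pow_mul_mem_of_contentIdeal (v v' : ℕ → ℕ ⊕ ℕ) {k i j l : ℕ}
    {T : Ideal (MvPolynomial (ℕ ⊕ ℕ) K)}
    (h : (segrePoly K v k * segrePoly K v' k).contentIdeal ≤ T) (hi : i < k + 2) (hj : j < k + 2)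
    (hl : l < k + 2) : X (v i) ^ (k + 1) * X (v j) * X (v' l) ∈ T := by
  have h1 := (Polynomial.contentIdeal_pow_mul_le (segrePoly K v k) (k + 1) (segrePoly K v' k)
    (natDegree_segrePoly_le v' k)).trans (Ideal.mul_le_right.trans h)
  have hi' := X_mem_contentIdeal_segrePoly (K := K) v hi
  have hj' := X_mem_contentIdeal_segrePoly (K := K) v hj
  have hl' := X_mem_contentIdeal_segrePoly (K := K) v' hl
  generalize (segrePoly K v k).contentIdeal = I at *
  generalize (segrePoly K v' k).contentIdeal = I' at *
  have h2 := Ideal.mul_mem_mul (Ideal.mul_mem_mul (Ideal.pow_mem_pow hi' (k + 1)) hj') hl'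
  rw [← pow_succ] at h2
  exact h1 h2

lemma pow_mul_pow_mul_mem (k : ℕ) {c : ℤ} (hc : c ≠ 0) {g : MvPolynomial (ℕ ⊕ ℕ) K}
    (hg : IsWeightedHomogeneous segreWt g c) :
    X (Sum.inl (k + 1)) ^ (k + 1) * X (Sum.inr 0) ^ (k + 1) * g ∈
      addList (segreIdeal K (k + 2) (k + 2)) (segreList K (k + 1 + (k + 1) + 1)) := by
  set T := addList (segreIdeal K (k + 2) (k + 2)) (segreList K (k + 1 + (k + 1) + 1)) with hT
  set w : MvPolynomial (ℕ ⊕ ℕ) K := X (Sum.inl (k + 1)) ^ (k + 1) * X (Sum.inr 0) ^ (k + 1) with hw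
  have hout {v : ℕ ⊕ ℕ} (hv : v ∈ segreVars (k + 2) (k + 2)) :
      (X v : MvPolynomial (ℕ ⊕ ℕ) K) ∈ T :=
    le_addList _ _ (Ideal.subset_span ⟨v, hv, rfl⟩)
  have hspan (s : Set (ℕ ⊕ ℕ)) (hs : ∀ v ∈ s, w * X v ∈ T) (hg' : g ∈ Ideal.span (X '' s)) :
      w * g ∈ T := by
    have : Ideal.span (X '' s) ≤ (Submodule.comap (LinearMap.mulLeft _ w) T : Ideal _) := by
      rw [Ideal.span_le]
      rintro _ ⟨v, hv, rfl⟩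
      exact hs v hv
    exact this hg'
  have hFG := contentIdeal_segrePoly_mul_le (K := K) k
  rw [← hT] at hFG
  rcases hc.lt_or_gt with hc | hc
  · refine hspan _ ?_ (mem_span_inl hc hg)
    rintro _ ⟨i, rfl⟩
    by_cases hi : i < k + 2
    · rw [hw, show X (Sum.inl (k + 1)) ^ (k + 1) * X (Sum.inr 0) ^ (k + 1) * X (Sum.inl i) =
        X (Sum.inr 0) ^ k * (X (Sum.inl (k + 1)) ^ (k + 1) * X (Sum.inl i) *
          (X (Sum.inr 0) : MvPolynomial (ℕ ⊕ ℕ) K)) by ring]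
      exact T.mul_mem_left _ (pow_mul_mem_of_contentIdeal Sum.inl Sum.inr hFG (by omega) hi
        (by omega))
    · exact T.mul_mem_left _ (hout (by simpa [segreVars] using hi))
  · refine hspan _ ?_ (mem_span_inr hc hg)
    rintro _ ⟨i, rfl⟩
    by_cases hi : i < k + 2
    · rw [hw, show X (Sum.inl (k + 1)) ^ (k + 1) * X (Sum.inr 0) ^ (k + 1) * X (Sum.inr i) =
        X (Sum.inl (k + 1)) ^ k * (X (Sum.inr 0) ^ (k + 1) * X (Sum.inr i) *
          (X (Sum.inl (k + 1)) : MvPolynomial (ℕ ⊕ ℕ) K)) by ring]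
      rw [mul_comm (segrePoly K Sum.inl k)] at hFG
      exact T.mul_mem_left _ (pow_mul_mem_of_contentIdeal Sum.inr Sum.inl hFG (by omega) hi
        (by omega))
    · exact T.mul_mem_left _ (hout (by simpa [segreVars] using hi))

end SegreContent

section SegreDivisor

open MvPolynomial

variable {K : Type} [Field K] {n : ℕ}

lemma segreTrunc_segreTrunc (f : MvPolynomial (ℕ ⊕ ℕ) K) :
    segreTrunc K n (segreTrunc K n f) = segreTrunc K n f := by
  have := segreTrunc_eq_zero (sub_segreTrunc_mem (n := n) f)
  rw [map_sub, sub_eq_zero] at this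
  exact this.symm

lemma exists_segreMap_eq_self {f : MvPolynomial (ℕ ⊕ ℕ) K}
    (hf : IsWeightedHomogeneous segreWt f 0) (hf' : segreTrunc K n f = f) :
    ∃ s, segreMap K n s = f := by
  obtain ⟨s, hs⟩ := exists_segreMap_eq (n := n) hf
  exact ⟨s, hs.trans hf'⟩

lemma exists_eq_mul_of_dvd_segreMap {p : MvPolynomial (ℕ ⊕ ℕ) K} {d : ℤ}
    (hp : IsWeightedHomogeneous segreWt p d) (hp' : segreTrunc K n p = p)
    {f : DetRing K n n (1 + 1)} (h : p ∣ segreMap K n f) :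
    ∃ g, IsWeightedHomogeneous segreWt g (-d) ∧ segreTrunc K n g = g ∧
      segreMap K n f = p * g := by
  obtain ⟨q, hq⟩ := h
  refine ⟨segreTrunc K n (weightedHomogeneousComponent segreWt (-d) q),
    isWeightedHomogeneous_segreTrunc (weightedHomogeneousComponent_isWeightedHomogeneous _ _),
    segreTrunc_segreTrunc _, ?_⟩
  have h1 := weightedHomogeneousComponent_mul hp 0 q
  rw [← hq, (isWeightedHomogeneous_segreMap f).weightedHomogeneousComponent_same, zero_sub] at h1
  rw [← segreTrunc_segreMap, h1, map_mul, hp']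

lemma dvd_of_segreMap_dvd {s f : DetRing K n n (1 + 1)} (h : segreMap K n s ∣ segreMap K n f) :
    s ∣ f := by
  obtain ⟨g, hg, hg', he⟩ := exists_eq_mul_of_dvd_segreMap (isWeightedHomogeneous_segreMap s)
    (segreTrunc_segreMap s) h
  rw [neg_zero] at hg
  obtain ⟨t, rfl⟩ := exists_segreMap_eq_self hg hg'
  exact ⟨t, segreMap_injective K n (by rw [he, map_mul])⟩

lemma exists_mul_mem_not_dvd {J : Ideal (DetRing K n n (1 + 1))} {v v' : MvPolynomial (ℕ ⊕ ℕ) K}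
    {ε : ℤ} (hv : IsWeightedHomogeneous segreWt v ε) (hv' : IsWeightedHomogeneous segreWt v' ε)
    (hvt : segreTrunc K n v = v) (hvt' : segreTrunc K n v' = v') (hp : Prime v)
    (hvv' : ¬ v ∣ v') {a : ℕ} {f₁ : DetRing K n n (1 + 1)} (hf₁ : f₁ ∈ J)
    (hd : v ^ a ∣ segreMap K n f₁) (hnd : ¬ v ^ (a + 1) ∣ segreMap K n f₁)
    {f : DetRing K n n (1 + 1)} (hf : v ^ a ∣ segreMap K n f) :
    ∃ y, y * f ∈ J ∧ ¬ v ∣ segreMap K n y := by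
  obtain ⟨g₁, hg₁, hgt₁, he₁⟩ := exists_eq_mul_of_dvd_segreMap (hv.pow a) (by rw [map_pow, hvt]) hd
  obtain ⟨g, hg, hgt, he⟩ := exists_eq_mul_of_dvd_segreMap (hv.pow a) (by rw [map_pow, hvt]) hf
  obtain ⟨y, hy⟩ := exists_segreMap_eq_self (n := n) (f := g₁ * v' ^ a)
    (by simpa using hg₁.mul (hv'.pow a)) (by rw [map_mul, map_pow, hgt₁, hvt'])
  obtain ⟨z, hz⟩ := exists_segreMap_eq_self (n := n) (f := g * v' ^ a)
    (by simpa using hg.mul (hv'.pow a)) (by rw [map_mul, map_pow, hgt, hvt'])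
  refine ⟨y, ?_, fun h => ?_⟩
  · have : y * f = z * f₁ := segreMap_injective K n (by
      rw [map_mul, map_mul, hy, hz, he, he₁]
      ring)
    rw [this]
    exact J.mul_mem_left _ hf₁
  · rw [hy] at h
    rcases hp.dvd_or_dvd h with h | h
    · refine hnd ?_
      rw [he₁, pow_succ]
      exact mul_dvd_mul_left _ h
    · exact hvv' (hp.dvd_of_dvd_pow h)

lemma X_not_dvd_X {v v' : ℕ ⊕ ℕ} (h : v ≠ v') :
    ¬ (X v : MvPolynomial (ℕ ⊕ ℕ) K) ∣ X v' := by
  rw [X_dvd_X]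
  simpa using h

lemma exists_exponent {J : Ideal (DetRing K n n (1 + 1))} {v : MvPolynomial (ℕ ⊕ ℕ) K}
    (h : ∃ N, ∃ f ∈ J, ¬ v ^ (N + 1) ∣ segreMap K n f) :
    ∃ a, (∃ f ∈ J, ¬ v ^ (a + 1) ∣ segreMap K n f) ∧ ∀ f ∈ J, v ^ a ∣ segreMap K n f := by
  classical
  refine ⟨Nat.find h, Nat.find_spec h, fun f hf => ?_⟩
  rcases hN : Nat.find h with _ | N
  · simp
  · by_contra hcon
    exact Nat.find_min h (m := N) (by omega) ⟨f, hf, hcon⟩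

lemma DivSat.exists_segre {k N : ℕ} {J : Ideal (DetRing K (k + 2) (k + 2) (1 + 1))}
    (hJ : DivSat J) (hN : (Ideal.Quotient.mk _ (X (0, 0)) : DetRing K (k + 2) (k + 2) (1 + 1)) ^ N
      ∈ J) :
    ∃ a b : ℕ, ∀ f, f ∈ J ↔ X (Sum.inl 0) ^ a * X (Sum.inr 0) ^ b ∣ segreMap K (k + 2) f := by
  set x : DetRing K (k + 2) (k + 2) (1 + 1) := Ideal.Quotient.mk _ (X (0, 0)) with hx
  set y₀ : MvPolynomial (ℕ ⊕ ℕ) K := X (Sum.inl 0) with hy₀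
  set z₀ : MvPolynomial (ℕ ⊕ ℕ) K := X (Sum.inr 0) with hz₀
  have hxσ : segreMap K (k + 2) x = y₀ * z₀ := by
    rw [hx, segreMap_X]
    rfl
  have hyp : Prime y₀ := X_prime
  have hzp : Prime z₀ := X_prime
  have hyz : ¬ y₀ ∣ z₀ := X_not_dvd_X (by simp)
  have hzy : ¬ z₀ ∣ y₀ := X_not_dvd_X (by simp)
  have hmul {a b : ℕ} {g : MvPolynomial (ℕ ⊕ ℕ) K} (h1 : y₀ ^ a ∣ g) (h2 : z₀ ^ b ∣ g) :
      y₀ ^ a * z₀ ^ b ∣ g := by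
    obtain ⟨u, rfl⟩ := h1
    exact mul_dvd_mul_left _
      (hzp.pow_dvd_of_dvd_mul_left _ (fun h => hzy (hzp.dvd_of_dvd_pow h)) h2)
  obtain ⟨a, ⟨f₁, hf₁, hnd₁⟩, ha⟩ := exists_exponent (v := y₀) (J := J) ⟨N, x ^ N, hN, fun h => by
    rw [map_pow, hxσ, mul_pow, pow_succ] at h
    exact hyz (hyp.dvd_of_dvd_pow ((mul_dvd_mul_iff_left (pow_ne_zero N hyp.ne_zero)).1 h))⟩
  obtain ⟨b, ⟨f₂, hf₂, hnd₂⟩, hb⟩ := exists_exponent (v := z₀) (J := J) ⟨N, x ^ N, hN, fun h => by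
    rw [map_pow, hxσ, mul_pow, pow_succ, mul_comm (y₀ ^ N)] at h
    exact hzy (hzp.dvd_of_dvd_pow ((mul_dvd_mul_iff_left (pow_ne_zero N hzp.ne_zero)).1 h))⟩
  refine ⟨a, b, fun f => ⟨fun hf => hmul (ha f hf) (hb f hf), fun hf => ?_⟩⟩
  have hx0 : x ≠ 0 := fun h => by
    rw [h, map_zero] at hxσ
    exact mul_ne_zero hyp.ne_zero hzp.ne_zero hxσ.symm
  suffices ∃ y, y * f ∈ J ∧ ¬ y₀ ∣ segreMap K (k + 2) y ∧ ¬ z₀ ∣ segreMap K (k + 2) y by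
    obtain ⟨y, hyf, hy1, hy2⟩ := this
    refine hJ (x ^ N) hN (pow_ne_zero _ hx0) y (fun g hg => ?_) f hyf
    rw [Ideal.mem_span_singleton] at hg ⊢
    refine dvd_of_segreMap_dvd ?_
    have h1 := map_dvd (segreMap K (k + 2)) hg
    rw [map_mul, map_pow, hxσ, mul_pow] at h1
    rw [map_pow, hxσ, mul_pow]
    exact hmul (hyp.pow_dvd_of_dvd_mul_left _ hy1 ((dvd_mul_right _ _).trans h1))
      (hzp.pow_dvd_of_dvd_mul_left _ hy2 ((dvd_mul_left _ _).trans h1))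
  obtain ⟨y₁, hy₁, hd₁⟩ := exists_mul_mem_not_dvd (isWeightedHomogeneous_inl 0)
    (isWeightedHomogeneous_inl 1) (segreTrunc_inl (n := k + 2) (by omega))
    (segreTrunc_inl (by omega)) hyp (X_not_dvd_X (by simp)) hf₁ (ha _ hf₁) hnd₁
    ((dvd_mul_right _ _).trans hf)
  obtain ⟨y₂, hy₂, hd₂⟩ := exists_mul_mem_not_dvd (isWeightedHomogeneous_inr 0)
    (isWeightedHomogeneous_inr 1) (segreTrunc_inr (n := k + 2) (by omega))
    (segreTrunc_inr (by omega)) hzp (X_not_dvd_X (by simp)) hf₂ (hb _ hf₂) hnd₂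
    ((dvd_mul_left _ _).trans hf)
  by_cases h1 : z₀ ∣ segreMap K (k + 2) y₁
  · by_cases h2 : y₀ ∣ segreMap K (k + 2) y₂
    · refine ⟨y₁ + y₂, by rw [add_mul]; exact add_mem hy₁ hy₂, ?_, ?_⟩
      · rwa [map_add, dvd_add_left h2]
      · rwa [map_add, dvd_add_right h1]
    · exact ⟨y₂, hy₂, h2, hd₂⟩
  · exact ⟨y₁, hy₁, hd₁, h1⟩

lemma mem_of_mem_addList {J A : Ideal (DetRing K n n (1 + 1))} {p : MvPolynomial (ℕ ⊕ ℕ) K}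
    {d : ℤ} (hp : IsWeightedHomogeneous segreWt p d) (hp' : segreTrunc K n p = p)
    (hJ : ∀ f, p ∣ segreMap K n f → f ∈ J)
    {l : List (DetRing K n n (1 + 1))} {l' : List (MvPolynomial (ℕ ⊕ ℕ) K)}
    (hl : List.Forall₂ (fun s x => segreMap K n s = segreTrunc K n x) l l') :
    (∀ x ∈ l', IsWeightedHomogeneous segreWt x 0) → (∀ s ∈ l, ∀ f ∈ J, s * f ∈ A) →
    ∀ {B : Ideal (MvPolynomial (ℕ ⊕ ℕ) K)}, IsWeightedIdeal segreWt B →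
    (∀ g ∈ B, IsWeightedHomogeneous segreWt g (-d) →
      ∀ f, segreMap K n f = p * segreTrunc K n g → f ∈ A) →
    ∀ g ∈ addList B l', IsWeightedHomogeneous segreWt g (-d) →
      ∀ f, segreMap K n f = p * segreTrunc K n g → f ∈ A := by
  induction hl with
  | nil => exact fun _ _ B _ h => h
  | @cons s x l l' hs _ ih =>
    intro hl' hA B hB h
    have hx := hl' x List.mem_cons_self
    refine ih (fun y hy => hl' y (List.mem_cons_of_mem _ hy))
      (fun t ht => hA t (List.mem_cons_of_mem _ ht)) (hB.sup_span hx) ?_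
    intro g hg hgd f hf
    obtain ⟨b, hb, q, hq, he⟩ := hB.exists_add_mul hx hgd hg
    rw [sub_zero] at hq
    obtain ⟨f', hf'⟩ := exists_segreMap_eq_self (n := n) (f := p * segreTrunc K n q)
      (by simpa using hp.mul (isWeightedHomogeneous_segreTrunc hq))
      (by rw [map_mul, hp', segreTrunc_segreTrunc])
    have hb' : IsWeightedHomogeneous segreWt b (-d) := by
      rw [show b = g - x * q by rw [he]; ring]
      exact (weightedHomogeneousSubmodule K segreWt (-d)).sub_mem hgd
        (show IsWeightedHomogeneous segreWt (x * q) (-d) by simpa using hx.mul hq)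
    rw [← sub_add_cancel f (s * f')]
    refine add_mem (h b hb hb' _ ?_)
      (hA s List.mem_cons_self f' (hJ f' (by rw [hf']; exact dvd_mul_right _ _)))
    rw [map_sub, map_mul, hf, hf', hs, he, map_add, map_mul]
    ring

lemma SD.nonempty_equiv_of_segre {k N : ℕ} {J : Ideal (DetRing K (k + 2) (k + 2) (1 + 1))}
    (hJ : SD (DetRing K (k + 2) (k + 2) (1 + 1)) J)
    (hN : (Ideal.Quotient.mk _ (X (0, 0)) : DetRing K (k + 2) (k + 2) (1 + 1)) ^ N ∈ J) :
    Nonempty (J ≃ₗ[DetRing K (k + 2) (k + 2) (1 + 1)] DetRing K (k + 2) (k + 2) (1 + 1)) := by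
  obtain ⟨a, b, hab⟩ := hJ.divSat.exists_segre hN
  by_cases h : a = b
  · subst h
    set x : DetRing K (k + 2) (k + 2) (1 + 1) := Ideal.Quotient.mk _ (X (0, 0)) with hx
    have hxσ : segreMap K (k + 2) (x ^ a) = X (Sum.inl 0) ^ a * X (Sum.inr 0) ^ a := by
      rw [map_pow, hx, segreMap_X, mul_pow]
      rfl
    have hx0 : x ^ a ≠ 0 := fun h => by
      rw [h, map_zero] at hxσ
      exact mul_ne_zero (pow_ne_zero _ (X_ne_zero _)) (pow_ne_zero _ (X_ne_zero _)) hxσ.symm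
    refine ⟨(Submodule.topEquiv.symm.trans (Ideal.mulEquiv hx0 fun f => ?_)).symm⟩
    rw [hab, ← hxσ]
    constructor
    · intro hf
      obtain ⟨g, rfl⟩ := dvd_of_segreMap_dvd hf
      exact ⟨g, trivial, rfl⟩
    · rintro ⟨g, -, rfl⟩
      rw [map_mul]
      exact dvd_mul_right _ _
  · exfalso
    set p : MvPolynomial (ℕ ⊕ ℕ) K := X (Sum.inl 0) ^ a * X (Sum.inr 0) ^ b with hp
    have hpw : IsWeightedHomogeneous segreWt p ((b : ℤ) - a) := by
      have := ((isWeightedHomogeneous_inl (K := K) 0).pow a).mul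
        ((isWeightedHomogeneous_inr (K := K) 0).pow b)
      simpa [sub_eq_neg_add] using this
    have hpt : segreTrunc K (k + 2) p = p := by
      rw [hp, map_mul, map_pow, map_pow, segreTrunc_inl (by omega), segreTrunc_inr (by omega)]
    set l' := segreList K (k + 1 + (k + 1) + 1) with hl'
    have hhom : ∀ x ∈ l', IsWeightedHomogeneous segreWt x 0 :=
      fun x => isWeightedHomogeneous_of_mem_segreList
    obtain ⟨l, hl⟩ := exists_forall₂_segreMap (n := k + 2) l' hhom
    obtain ⟨hreg, hmatch⟩ := SegreMatch.wReg hl hhom segreMatch_bot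
    rw [bot_sup_eq] at hmatch
    set w : DetRing K (k + 2) (k + 2) (1 + 1) :=
      Ideal.Quotient.mk _ (X (Fin.last (k + 1), 0)) ^ (k + 1) with hw
    have hwσ : segreMap K (k + 2) w =
        X (Sum.inl (k + 1)) ^ (k + 1) * X (Sum.inr 0) ^ (k + 1) := by
      rw [hw, map_pow, segreMap_X, mul_pow]
      rfl
    refine pow_mul_pow_notMem (K := K) (k + 1) (k + 1) ?_
    rw [← hwσ]
    refine (hmatch.mem_iff w).1 (hJ.mem_of_forall_smul_mem
      (hreg (regOn_segre _ _ _ _ (by omega) (by omega) (by omega))) fun f => ?_)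
    rw [Submodule.mem_smul_top_iff]
    obtain ⟨g, hg, hgt, he⟩ := exists_eq_mul_of_dvd_segreMap hpw hpt ((hab f).1 f.2)
    have hwt : segreTrunc K (k + 2) (segreMap K (k + 2) w * g) = segreMap K (k + 2) w * g := by
      rw [map_mul, segreTrunc_segreMap, hgt]
    refine mem_of_mem_addList (A := Ideal.span {x | x ∈ l} • J) hpw hpt
      (fun f hf => (hab f).2 hf) hl hhom
      (fun s hs f hf => Ideal.mul_mem_mul (Ideal.subset_span hs) hf)
      (isWeightedIdeal_span_X (segreVars (k + 2) (k + 2)))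
      (fun g hg _ f hf => ?_) (segreMap K (k + 2) w * g) ?_ ?_ _ ?_
    · rw [segreTrunc_eq_zero hg, mul_zero] at hf
      rw [segreMap_injective K (k + 2) (hf.trans (map_zero _).symm)]
      exact zero_mem _
    · rw [hwσ]
      exact pow_mul_pow_mul_mem k (by omega) hg
    · simpa using (isWeightedHomogeneous_segreMap w).mul hg
    · rw [hwt]
      change segreMap K (k + 2) (w * f) = _
      rw [map_mul, he]
      ring

end SegreDivisor

section Localization

lemma SD.exists_ideal_of_isLocalization {S T : Type} [CommRing S] [IsDomain S] [IsNoetherianRing S]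
    [CommRing T] [Algebra S T] (M : Submonoid S) (hM : M ≤ nonZeroDivisors S) [IsLocalization M T]
    (hT : ∀ (E : Type) [AddCommGroup E] [Module T E], SD T E → Nonempty (E ≃ₗ[T] T))
    {D : Type} [AddCommGroup D] [Module S D] (h : SD S D) :
    ∃ J : Ideal S, Nonempty (D ≃ₗ[S] J) ∧ ∃ s ∈ M, s ∈ J := by
  obtain ⟨J₀, -, ⟨e₀⟩⟩ := h.exists_ideal
  have hflat : Module.Flat S T := IsLocalization.flat T M
  obtain ⟨e⟩ := hT _ ((h.of_linearEquiv e₀).baseChange T)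
  have hloc : IsLocalizedModule M (TensorProduct.mk S T J₀ 1) :=
    (isLocalizedModule_iff_isBaseChange M T _).2 (TensorProduct.isBaseChange S J₀ T)
  let ψ : J₀ →ₗ[S] T := (e.restrictScalars S).toLinearMap ∘ₗ TensorProduct.mk S T J₀ 1
  have hψ : Function.Injective ψ := by
    refine e.injective.comp fun x y hxy => ?_
    obtain ⟨c, hc⟩ := (IsLocalizedModule.eq_iff_exists M (TensorProduct.mk S T J₀ 1)).1 hxy
    refine Subtype.ext (mul_left_cancel₀ (nonZeroDivisors.ne_zero (hM c.2)) ?_)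
    exact congrArg Subtype.val hc
  obtain ⟨G, hG⟩ := (Module.Finite.fg_top : (⊤ : Submodule S J₀).FG)
  classical
  obtain ⟨s₀, hs₀⟩ := IsLocalization.exist_integer_multiples_of_finset M (G.image ψ)
  have hι : Function.Injective (Algebra.linearMap S T) := IsLocalization.injective T hM
  have hrange : ∀ d, (s₀ : S) • ψ d ∈ LinearMap.range (Algebra.linearMap S T) := by
    have : (⊤ : Submodule S J₀) ≤
        (LinearMap.range (Algebra.linearMap S T)).comap ((s₀ : S) • ψ) := by
      rw [← hG, Submodule.span_le]
      intro d hd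
      exact hs₀ _ (Finset.mem_image_of_mem _ hd)
    exact fun d => this (Submodule.mem_top : d ∈ ⊤)
  choose θ hθ using hrange
  have hadd (c : S) (x y : J₀) : θ (c • x + y) = c * θ x + θ y := hι (by
    rw [map_add, ← smul_eq_mul, map_smul, hθ, hθ, hθ, map_add, map_smul, smul_add, smul_comm])
  let Θ : J₀ →ₗ[S] S := {
    toFun := θ
    map_add' x y := by simpa using hadd 1 x y
    map_smul' c x := hι (by
      rw [RingHom.id_apply, map_smul, hθ, hθ, map_smul, smul_comm]) }
  have hΘ : Function.Injective Θ := fun x y hxy => by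
    refine hψ ?_
    have h1 : (s₀ : S) • ψ x = (s₀ : S) • ψ y := by
      rw [← hθ, ← hθ]
      exact congrArg _ hxy
    exact (IsLocalization.map_units T s₀).mul_left_cancel (by
      simpa only [Algebra.smul_def] using h1)
  refine ⟨LinearMap.range Θ, ⟨e₀.trans (LinearEquiv.ofInjective Θ hΘ)⟩, ?_⟩
  obtain ⟨⟨j, s⟩, hj⟩ := IsLocalizedModule.surj M (TensorProduct.mk S T J₀ 1) (e.symm 1)
  refine ⟨s₀ * s, mul_mem s₀.2 s.2, j, hι ?_⟩
  change Algebra.linearMap S T (θ j) = _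
  have h1 : ψ j = (s : S) • (1 : T) := by
    change e (TensorProduct.mk S T J₀ 1 j) = _
    rw [← hj]
    change (e.restrictScalars S) ((s : S) • e.symm 1) = _
    rw [map_smul]
    simp
  rw [hθ, h1, smul_smul, Algebra.linearMap_apply, Algebra.smul_def, mul_one]

open MvPolynomial

variable {A B : Type} [CommRing A] [CommRing B] [Algebra A B] {m n t : ℕ}

lemma map_minorsIdeal :
    (minorsIdeal A m n t).map (MvPolynomial.map (algebraMap A B)) = minorsIdeal B m n t := by
  rw [minorsIdeal, minorsIdeal, Ideal.map_span]
  congr 1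
  have (ρ : Fin t → Fin m) (γ : Fin t → Fin n) : MvPolynomial.map (algebraMap A B)
      (Matrix.of fun i j => X (ρ i, γ j)).det = (Matrix.of fun i j => X (ρ i, γ j)).det := by
    rw [RingHom.map_det]
    congr 1
    ext i j : 1
    simp
  ext f
  constructor
  · rintro ⟨_, ⟨ρ, γ, rfl⟩, rfl⟩
    exact ⟨ρ, γ, this ρ γ⟩
  · rintro ⟨ρ, γ, rfl⟩
    exact ⟨_, ⟨ρ, γ, rfl⟩, this ρ γ⟩

variable (A B m n t) in
/-- The extension of coefficients on determinantal rings. -/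
noncomputable def DetRing.map : DetRing A m n t →+* DetRing B m n t :=
  Ideal.quotientMap _ (MvPolynomial.map (algebraMap A B))
    (Ideal.map_le_iff_le_comap.1 map_minorsIdeal.le)

lemma DetRing.isLocalization_map (M : Submonoid A) [IsLocalization M B] :
    letI := (DetRing.map A B m n t).toAlgebra
    IsLocalization (M.map (algebraMap A (DetRing A m n t))) (DetRing B m n t) := by
  let : Algebra (DetRing A m n t) (DetRing B m n t) := (DetRing.map A B m n t).toAlgebra
  let : Algebra (MvPolynomial (Fin m × Fin n) A) (MvPolynomial (Fin m × Fin n) B) :=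
    algebraMvPolynomial
  have hker : RingHom.ker (Ideal.Quotient.mk (minorsIdeal B m n t)) ≤
      (RingHom.ker (Ideal.Quotient.mk (minorsIdeal A m n t))).map
        (algebraMap (MvPolynomial (Fin m × Fin n) A) (MvPolynomial (Fin m × Fin n) B)) := by
    rw [Ideal.mk_ker, Ideal.mk_ker, ← map_minorsIdeal (A := A) (B := B)]
    exact le_rfl
  have h := IsLocalization.of_surjective (M.map (C (σ := Fin m × Fin n)))
    (MvPolynomial (Fin m × Fin n) B) (Ideal.Quotient.mk (minorsIdeal A m n t))
    Ideal.Quotient.mk_surjective (Ideal.Quotient.mk (minorsIdeal B m n t))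
    Ideal.Quotient.mk_surjective rfl hker
  have hM : M.map (algebraMap A (DetRing A m n t)) =
      (M.map (C (σ := Fin m × Fin n))).map (Ideal.Quotient.mk (minorsIdeal A m n t)) := by
    ext x
    constructor
    · rintro ⟨a, ha, rfl⟩
      exact ⟨_, ⟨a, ha, rfl⟩, rfl⟩
    · rintro ⟨_, ⟨a, ha, rfl⟩, rfl⟩
      exact ⟨a, ha, rfl⟩
  rw [hM]
  exact h

end Localization

section Schur

lemma det_schur_eq_zero {L : Type} [CommRing L] {p q r : ℕ}
    (N : Matrix (Fin (p + 1)) (Fin (q + 1)) L) {u : L} (hu : N 0 0 * u = 1)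
    (hN : ∀ (ρ : Fin (r + 1) → Fin (p + 1)) (γ : Fin (r + 1) → Fin (q + 1)),
      (Matrix.of fun i j => N (ρ i) (γ j)).det = 0) (ρ : Fin r → Fin p) (γ : Fin r → Fin q) :
    (Matrix.of fun i j =>
      N (ρ i).succ (γ j).succ - N (ρ i).succ 0 * u * N 0 (γ j).succ).det = 0 := by
  have h0 := hN (Fin.cons 0 fun i => (ρ i).succ) (Fin.cons 0 fun j => (γ j).succ)
  set M : Matrix (Fin (r + 1)) (Fin (r + 1)) L := Matrix.of fun i j =>
    N ((Fin.cons 0 fun i => (ρ i).succ : Fin (r + 1) → Fin (p + 1)) i)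
      ((Fin.cons 0 fun j => (γ j).succ : Fin (r + 1) → Fin (q + 1)) j) with hM
  let c : Fin (r + 1) → L := Fin.cons 0 fun i => -(N (ρ i).succ 0 * u)
  have h1 : (Matrix.of fun i j => M i j + c i * M 0 j).det = M.det :=
    Matrix.det_eq_of_forall_row_eq_smul_add_const c 0 rfl fun i j => rfl
  rw [h0, Matrix.det_succ_column_zero, Fin.sum_univ_succ, Finset.sum_eq_zero, add_zero] at h1
  · simp only [Fin.val_zero, pow_zero, one_mul] at h1
    have h2 : (Matrix.of fun i j => M i j + c i * M 0 j) 0 0 = N 0 0 := by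
      simp [hM, c]
    rw [h2] at h1
    have h3 (d : L) (hd : N 0 0 * d = 0) : d = 0 := by
      rw [← one_mul d, ← hu, mul_comm (N 0 0), mul_assoc, hd, mul_zero]
    rw [← h3 _ h1]
    congr 1
    ext i j
    simp only [Matrix.of_apply, Matrix.submatrix_apply, hM, c, Fin.succAbove_zero, Fin.cons_succ,
      Fin.cons_zero]
    ring
  · intro i _
    have : (Matrix.of fun i j => M i j + c i * M 0 j) i.succ 0 = 0 := by
      simp only [Matrix.of_apply, hM, c, Fin.cons_succ, Fin.cons_zero]
      rw [neg_mul, mul_assoc, mul_comm u, hu, mul_one, add_neg_cancel]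
    rw [this]
    ring

end Schur

section Corner

open MvPolynomial

variable {K B : Type} [CommRing K] [CommRing B] [Algebra K B] {p q r : ℕ}

/-- The matrix with first row `(a, b)`, first column `(a, c)` and Schur complement `(X_ij)`. -/
noncomputable def cornerMatrix (r : ℕ) (a u : B) (b : Fin q → B) (c : Fin p → B) :
    Matrix (Fin (p + 1)) (Fin (q + 1)) (DetRing B p q (r + 1)) :=
  Matrix.of (Fin.cons (Fin.cons (algebraMap B _ a) fun j => algebraMap B _ (b j)) fun i =>
    (Fin.cons (algebraMap B _ (c i)) fun j =>
      Ideal.Quotient.mk _ (X (i, j)) + algebraMap B _ (c i * u * b j)))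

lemma det_cornerMatrix_eq_zero {a u : B} (hu : a * u = 1) (b : Fin q → B) (c : Fin p → B)
    (ρ : Fin (r + 2) → Fin (p + 1)) (γ : Fin (r + 2) → Fin (q + 1)) :
    (Matrix.of fun i j => cornerMatrix r a u b c (ρ i) (γ j)).det = 0 := by
  refine detMap_injective B p q r ?_
  rw [map_zero, AlgHom.map_det]
  let U : Matrix (Fin (p + 1)) (Fin (r + 1)) (YZPoly B p q r) :=
    Matrix.of (Fin.cons (Fin.cons 1 0) fun i =>
      (Fin.cons (C (c i * u)) fun k => X (Sum.inl (i, k))))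
  let V : Matrix (Fin (r + 1)) (Fin (q + 1)) (YZPoly B p q r) :=
    Matrix.of (Fin.cons (Fin.cons (C a) fun j => C (b j)) fun k =>
      (Fin.cons 0 fun j => X (Sum.inr (k, j))))
  have hUV (i : Fin (p + 1)) (j : Fin (q + 1)) :
      detMap B p q r (cornerMatrix r a u b c i j) = ∑ k, U i k * V k j := by
    rw [Fin.sum_univ_succ]
    cases i using Fin.cases with
    | zero =>
      cases j using Fin.cases with
      | zero => simp [cornerMatrix, U, V, algebraMap_eq]
      | succ j => simp [cornerMatrix, U, V, algebraMap_eq]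
    | succ i =>
      cases j using Fin.cases with
      | zero =>
        simp only [cornerMatrix, U, V, Matrix.of_apply, Fin.cons_succ, Fin.cons_zero, mul_zero,
          Finset.sum_const_zero, add_zero, AlgHom.commutes, algebraMap_eq]
        rw [← C_mul, mul_assoc, mul_comm u, hu, mul_one]
      | succ j =>
        simp only [cornerMatrix, U, V, Matrix.of_apply, Fin.cons_succ, Fin.cons_zero, map_add,
          AlgHom.commutes, algebraMap_eq]
        rw [detMap_mk, prodMap, aeval_X, ← C_mul, add_comm]
  convert det_mul_of_lt (Matrix.of fun i => U (ρ i)) (Matrix.of fun k j => V k (γ j)) using 2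
  ext i j : 1
  simp [Matrix.mul_apply, hUV]

/-- The map on determinantal rings given by a corner matrix. -/
noncomputable def cornerMap {a u : B} (hu : a * u = 1) (b : Fin q → B) (c : Fin p → B) :
    DetRing K (p + 1) (q + 1) (r + 2) →ₐ[K] DetRing B p q (r + 1) :=
  Ideal.Quotient.liftₐ _ (aeval fun e => cornerMatrix r a u b c e.1 e.2) (by
    suffices minorsIdeal K (p + 1) (q + 1) (r + 2) ≤
      RingHom.ker (aeval fun e => cornerMatrix r a u b c e.1 e.2 :
        MvPolynomial (Fin (p + 1) × Fin (q + 1)) K →ₐ[K] DetRing B p q (r + 1)) from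
      fun f hf => this hf
    rw [minorsIdeal, Ideal.span_le]
    rintro _ ⟨ρ, γ, rfl⟩
    rw [SetLike.mem_coe, RingHom.mem_ker, AlgHom.map_det, ← det_cornerMatrix_eq_zero hu b c ρ γ]
    congr 1
    ext i j : 1
    simp)

lemma cornerMap_X {a u : B} (hu : a * u = 1) (b : Fin q → B) (c : Fin p → B)
    (e : Fin (p + 1) × Fin (q + 1)) :
    cornerMap (K := K) (r := r) hu b c (Ideal.Quotient.mk _ (X e)) =
      cornerMatrix r a u b c e.1 e.2 :=
  aeval_X _ e

end Corner

section CornerLocalization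

open MvPolynomial

/-- The coordinate ring of the first row and column of a matrix with invertible corner. -/
abbrev CornerRing (K : Type) [Field K] (p q : ℕ) : Type :=
  Localization.Away (X none : MvPolynomial (Option (Fin p ⊕ Fin q)) K)

variable (K : Type) [Field K] (p q r : ℕ)

/-- The generic corner map. -/
noncomputable def cornerHom :
    DetRing K (p + 1) (q + 1) (r + 2) →ₐ[K] DetRing (CornerRing K p q) p q (r + 1) :=
  cornerMap (IsLocalization.Away.mul_invSelf (X none : MvPolynomial (Option (Fin p ⊕ Fin q)) K))
    (fun j => algebraMap _ _ (X (some (Sum.inr j)) : MvPolynomial (Option (Fin p ⊕ Fin q)) K))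
    (fun i => algebraMap _ _ (X (some (Sum.inl i)) : MvPolynomial (Option (Fin p ⊕ Fin q)) K))

lemma cornerHom_X_zero_zero : cornerHom K p q r (Ideal.Quotient.mk _ (X (0, 0))) =
    algebraMap (CornerRing K p q) _ (algebraMap _ _
      (X none : MvPolynomial (Option (Fin p ⊕ Fin q)) K)) :=
  cornerMap_X _ _ _ (0, 0)

lemma cornerHom_X_zero_succ (j : Fin q) :
    cornerHom K p q r (Ideal.Quotient.mk _ (X (0, j.succ))) =
    algebraMap (CornerRing K p q) _ (algebraMap _ _
      (X (some (Sum.inr j)) : MvPolynomial (Option (Fin p ⊕ Fin q)) K)) :=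
  cornerMap_X _ _ _ (0, j.succ)

lemma cornerHom_X_succ_zero (i : Fin p) :
    cornerHom K p q r (Ideal.Quotient.mk _ (X (i.succ, 0))) =
    algebraMap (CornerRing K p q) _ (algebraMap _ _
      (X (some (Sum.inl i)) : MvPolynomial (Option (Fin p ⊕ Fin q)) K)) :=
  cornerMap_X _ _ _ (i.succ, 0)

lemma cornerHom_X_succ_succ (i : Fin p) (j : Fin q) :
    cornerHom K p q r (Ideal.Quotient.mk _ (X (i.succ, j.succ))) =
    Ideal.Quotient.mk _ (X (i, j)) + algebraMap (CornerRing K p q) _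
      (algebraMap _ _ (X (some (Sum.inl i)) : MvPolynomial (Option (Fin p ⊕ Fin q)) K) *
        IsLocalization.Away.invSelf (X none : MvPolynomial (Option (Fin p ⊕ Fin q)) K) *
        algebraMap _ _ (X (some (Sum.inr j)) : MvPolynomial (Option (Fin p ⊕ Fin q)) K)) :=
  cornerMap_X _ _ _ (i.succ, j.succ)

instance CornerRing.isDomain : IsDomain (CornerRing K p q) :=
  IsLocalization.isDomain_localization
    (powers_le_nonZeroDivisors_of_noZeroDivisors (X_ne_zero _))

instance CornerRing.isNoetherianRing : IsNoetherianRing (CornerRing K p q) :=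
  IsLocalization.isNoetherianRing
    (Submonoid.powers (X none : MvPolynomial (Option (Fin p ⊕ Fin q)) K)) _ inferInstance

instance CornerRing.uniqueFactorizationMonoid : UniqueFactorizationMonoid (CornerRing K p q) :=
  inferInstance

lemma isUnit_cornerHom_X : IsUnit (cornerHom K p q r (Ideal.Quotient.mk _ (X (0, 0)))) := by
  rw [cornerHom_X_zero_zero]
  exact (IsLocalization.Away.algebraMap_isUnit _).map _

lemma corner_ne_zero :
    (Ideal.Quotient.mk _ (X (0, 0)) : DetRing K (p + 1) (q + 1) (r + 2)) ≠ 0 := by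
  intro h
  have := isUnit_cornerHom_X K p q r
  rw [h, map_zero] at this
  exact not_isUnit_zero this

lemma cornerHom_injective : Function.Injective (cornerHom K p q r) := by
  let L := FractionRing (DetRing K (p + 1) (q + 1) (r + 2))
  let N : Matrix (Fin (p + 1)) (Fin (q + 1)) L := Matrix.of fun i j =>
    algebraMap (DetRing K (p + 1) (q + 1) (r + 2)) L (Ideal.Quotient.mk _ (X (i, j)))
  have h0 : N 0 0 ≠ 0 := by
    refine (map_ne_zero_iff _ (IsFractionRing.injective _ L)).2 (corner_ne_zero K p q r)
  have hN (ρ : Fin (r + 2) → Fin (p + 1)) (γ : Fin (r + 2) → Fin (q + 1)) :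
      (Matrix.of fun i j => N (ρ i) (γ j)).det = 0 := by
    have h1 : (Ideal.Quotient.mk (minorsIdeal K (p + 1) (q + 1) (r + 2)))
        (Matrix.of fun i j => X (ρ i, γ j)).det = 0 :=
      Ideal.Quotient.eq_zero_iff_mem.2 (Ideal.subset_span ⟨ρ, γ, rfl⟩)
    have h2 := congrArg (algebraMap (DetRing K (p + 1) (q + 1) (r + 2)) L) h1
    rw [map_zero, RingHom.map_det, RingHom.map_det] at h2
    exact h2
  obtain ⟨α, hα0, hα1, hα2⟩ : ∃ α : MvPolynomial (Option (Fin p ⊕ Fin q)) K →ₐ[K] L,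
      α (X none) = N 0 0 ∧ (∀ i, α (X (some (Sum.inl i))) = N (Fin.succ i) 0) ∧
        ∀ j, α (X (some (Sum.inr j))) = N 0 (Fin.succ j) :=
    ⟨aeval fun e => e.elim (N 0 0) (Sum.elim (fun i => N i.succ 0) fun j => N 0 j.succ),
      aeval_X _ _, fun i => aeval_X _ _, fun j => aeval_X _ _⟩
  have hα : IsUnit ((α : MvPolynomial (Option (Fin p ⊕ Fin q)) K →+* L) (X none)) :=
    isUnit_iff_ne_zero.2 (hα0.trans_ne h0)
  obtain ⟨β, hβ⟩ : ∃ β : CornerRing K p q →+* L, ∀ x, β (algebraMap _ _ x) = α x :=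
    ⟨IsLocalization.Away.lift _ hα, IsLocalization.Away.lift_eq _ hα⟩
  have hβu : β (IsLocalization.Away.invSelf
      (X none : MvPolynomial (Option (Fin p ⊕ Fin q)) K)) = (N 0 0)⁻¹ := by
    refine eq_inv_of_mul_eq_one_right ?_
    rw [← hα0, ← hβ, ← map_mul, IsLocalization.Away.mul_invSelf, map_one]
  let ψ₀ : MvPolynomial (Fin p × Fin q) (CornerRing K p q) →+* L := eval₂Hom β fun e =>
    N e.1.succ e.2.succ - N e.1.succ 0 * (N 0 0)⁻¹ * N 0 e.2.succ
  let ψ : DetRing (CornerRing K p q) p q (r + 1) →+* L := Ideal.Quotient.lift _ ψ₀ (by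
    suffices minorsIdeal (CornerRing K p q) p q (r + 1) ≤ RingHom.ker ψ₀ from
      fun f hf => this hf
    rw [minorsIdeal, Ideal.span_le]
    rintro _ ⟨ρ, γ, rfl⟩
    rw [SetLike.mem_coe, RingHom.mem_ker, RingHom.map_det,
      ← det_schur_eq_zero N (mul_inv_cancel₀ h0) hN ρ γ]
    congr 1
    ext i j : 1
    simp [ψ₀])
  have hψB (b) : ψ (algebraMap (CornerRing K p q) _ b) = β b := eval₂_C _ _ _
  have hψX (e) : ψ (Ideal.Quotient.mk _ (X e)) =
    N e.1.succ e.2.succ - N e.1.succ 0 * (N 0 0)⁻¹ * N 0 e.2.succ := eval₂_X _ _ _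
  let φ : DetRing K (p + 1) (q + 1) (r + 2) →+* DetRing (CornerRing K p q) p q (r + 1) :=
    cornerHom K p q r
  have hcomp : ψ.comp φ = algebraMap _ L := by
    refine Ideal.Quotient.ringHom_ext (MvPolynomial.ringHom_ext (fun k => ?_) ?_)
    · have h1 : (Ideal.Quotient.mk _ (C k) : DetRing K (p + 1) (q + 1) (r + 2)) =
        algebraMap K _ k := rfl
      change ψ (cornerHom K p q r (Ideal.Quotient.mk _ (C k))) = _
      rw [h1, AlgHom.commutes, IsScalarTower.algebraMap_apply K (CornerRing K p q), hψB,
        IsScalarTower.algebraMap_apply K (MvPolynomial (Option (Fin p ⊕ Fin q)) K), hβ]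
      exact α.commutes k
    · rintro ⟨i, j⟩
      change ψ (cornerHom K p q r (Ideal.Quotient.mk _ (X (i, j)))) = _
      cases i using Fin.cases with
      | zero =>
        cases j using Fin.cases with
        | zero => rw [cornerHom_X_zero_zero, hψB, hβ]; exact hα0
        | succ j => rw [cornerHom_X_zero_succ, hψB, hβ]; exact hα2 j
      | succ i =>
        cases j using Fin.cases with
        | zero => rw [cornerHom_X_succ_zero, hψB, hβ]; exact hα1 i
        | succ j =>
          rw [cornerHom_X_succ_succ, map_add, hψX, hψB, map_mul, map_mul, hβ, hβ, hβu, hα1, hα2]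
          exact sub_add_cancel _ _
  have hinj : Function.Injective (ψ.comp φ) := by
    rw [hcomp]
    exact IsFractionRing.injective _ L
  exact Function.Injective.of_comp (f := ψ) hinj

lemma isLocalization_cornerHom :
    letI := (cornerHom K p q r).toRingHom.toAlgebra
    IsLocalization (Submonoid.powers (Ideal.Quotient.mk (minorsIdeal K (p + 1) (q + 1) (r + 2))
      (X (0, 0)))) (DetRing (CornerRing K p q) p q (r + 1)) := by
  let : Algebra (DetRing K (p + 1) (q + 1) (r + 2)) (DetRing (CornerRing K p q) p q (r + 1)) :=
    (cornerHom K p q r).toRingHom.toAlgebra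
  set x : DetRing K (p + 1) (q + 1) (r + 2) := Ideal.Quotient.mk _ (X (0, 0)) with hx
  let φ := cornerHom K p q r
  have hu : IsUnit (φ x) := isUnit_cornerHom_X K p q r
  let P : DetRing (CornerRing K p q) p q (r + 1) → Prop := fun z => ∃ k s, z * φ x ^ k = φ s
  have hφ (s) : P (φ s) := ⟨0, s, by rw [pow_zero, mul_one]⟩
  have hadd {z w} : P z → P w → P (z + w) := by
    rintro ⟨k, s, hs⟩ ⟨l, t, ht⟩
    exact ⟨k + l, s * x ^ l + t * x ^ k, by
      rw [map_add, map_mul, map_mul, ← hs, ← ht, map_pow, map_pow]; ring⟩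
  have hmul {z w} : P z → P w → P (z * w) := by
    rintro ⟨k, s, hs⟩ ⟨l, t, ht⟩
    exact ⟨k + l, s * t, by rw [map_mul, ← hs, ← ht]; ring⟩
  have hpoly (f : MvPolynomial (Option (Fin p ⊕ Fin q)) K) :
      P (algebraMap (CornerRing K p q) _ (algebraMap _ _ f)) := by
    induction f using MvPolynomial.induction_on with
    | C a =>
      convert hφ (algebraMap K _ a)
      rw [AlgHom.commutes, ← IsScalarTower.algebraMap_apply, IsScalarTower.algebraMap_apply K
        (MvPolynomial (Option (Fin p ⊕ Fin q)) K)]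
      rfl
    | add f g hf hg => rw [map_add, map_add]; exact hadd hf hg
    | mul_X f e hf =>
      rw [map_mul, map_mul]
      refine hmul hf ?_
      rcases e with _ | i | j
      · rw [← cornerHom_X_zero_zero]; exact hφ _
      · rw [← cornerHom_X_succ_zero]; exact hφ _
      · rw [← cornerHom_X_zero_succ]; exact hφ _
  have hB (b : CornerRing K p q) : P (algebraMap _ _ b) := by
    obtain ⟨⟨f, _, k, rfl⟩, hf⟩ := IsLocalization.surj
      (Submonoid.powers (X none : MvPolynomial (Option (Fin p ⊕ Fin q)) K)) b
    obtain ⟨l, s, hs⟩ := hpoly f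
    refine ⟨k + l, s, ?_⟩
    rw [← hs, ← hf, map_mul, map_pow, map_pow, ← cornerHom_X_zero_zero K p q r, pow_add,
      mul_assoc]
  have hneg {z} : P z → P (-z) := by
    rintro ⟨k, s, hs⟩
    exact ⟨k, -s, by rw [map_neg, ← hs]; exact neg_mul z (φ x ^ k)⟩
  have hP (z) : P z := by
    obtain ⟨f, rfl⟩ := Ideal.Quotient.mk_surjective z
    induction f using MvPolynomial.induction_on with
    | C b => exact hB b
    | add f g hf hg => rw [map_add]; exact hadd hf hg
    | mul_X f e hf =>
      rw [map_mul]
      refine hmul hf ?_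
      rw [← add_sub_cancel_right (Ideal.Quotient.mk _ (X e)), ← cornerHom_X_succ_succ,
        sub_eq_add_neg]
      exact hadd (hφ _) (hneg (hB _))
  exact {
    map_units := by
      rintro ⟨_, k, rfl⟩
      change IsUnit (φ (x ^ k))
      rw [map_pow]
      exact hu.pow k
    surj := fun z => by
      obtain ⟨k, s, hs⟩ := hP z
      refine ⟨(s, ⟨x ^ k, k, rfl⟩), ?_⟩
      change z * φ (x ^ k) = φ s
      rw [map_pow, hs]
    exists_of_eq := fun {s t} hst => ⟨1, by rw [cornerHom_injective K p q r hst]⟩ }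

end CornerLocalization

section Kronecker

open MvPolynomial in
lemma MvPolynomial.exists_kronecker {A : Type} [CommRing A] {σ : Type} [Fintype σ] (D : ℕ) :
    ∃ (s : MvPolynomial σ A →ₐ[A] Polynomial A) (w : (σ →₀ ℕ) → ℕ), ∀ F : MvPolynomial σ A,
      F.totalDegree < D → ∀ u ∈ F.support, (s F).coeff (w u) = F.coeff u := by
  classical
  let e := Fintype.equivFin σ
  let w : (σ →₀ ℕ) → ℕ := fun u => ∑ i, u i * D ^ (e i : ℕ)
  refine ⟨aeval fun i => Polynomial.X ^ (D ^ (e i : ℕ)), w, fun F hF u hu => ?_⟩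
  have hbox {v : σ →₀ ℕ} (hv : v ∈ F.support) (i : σ) : v i < D :=
    ((Finsupp.le_degree i v).trans (le_totalDegree hv)).trans_lt hF
  have hw {v : σ →₀ ℕ} (hv : v ∈ F.support) (h : w v = w u) : v = u := by
    let f {v : σ →₀ ℕ} (hv : v ∈ F.support) : Fin (Fintype.card σ) → Fin D :=
      fun k => ⟨v (e.symm k), hbox hv _⟩
    have hf {v : σ →₀ ℕ} (hv : v ∈ F.support) : (finFunctionFinEquiv (f hv) : ℕ) = w v := by
      rw [finFunctionFinEquiv_apply]
      exact Fintype.sum_equiv e.symm _ _ fun k => by simp [f]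
    have := finFunctionFinEquiv.injective (Fin.ext ((hf hv).trans (h.trans (hf hu).symm)))
    ext i
    simpa [f] using congrArg Fin.val (congrFun this (e i))
  have hmon (v : σ →₀ ℕ) : aeval (fun i => (Polynomial.X : Polynomial A) ^ (D ^ (e i : ℕ)))
      (monomial v (F.coeff v)) = Polynomial.monomial (w v) (F.coeff v) := by
    rw [aeval_monomial, Finsupp.prod_fintype _ _ fun i => pow_zero _]
    simp only [← pow_mul]
    rw [Finset.prod_pow_eq_pow_sum, Polynomial.algebraMap_eq, Polynomial.C_mul_X_pow_eq_monomial]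
    simp only [w, mul_comm]
  conv_lhs => rw [F.as_sum]
  rw [map_sum, Polynomial.finsetSum_coeff, Finset.sum_eq_single u]
  · rw [hmon, Polynomial.coeff_monomial_same]
  · intro v hv hvu
    rw [hmon, Polynomial.coeff_monomial_of_ne]
    exact fun h => hvu (hw hv h.symm)
  · exact fun h => absurd hu h

variable {A : Type} [CommRing A] [IsDomain A] [IsIntegrallyClosed A] [IsNoetherianRing A]

lemma dvd_of_forall_mul_mem {I : Ideal A} (hI : I ≠ ⊥) {c t : A} (hc : c ≠ 0)
    (h : ∀ i ∈ I, ∃ j ∈ I, t * i = c * j) : c ∣ t := by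
  let K := FractionRing A
  have hinj : Function.Injective (Algebra.linearMap A K) := IsFractionRing.injective A K
  have hc' : algebraMap A K c ≠ 0 := (map_ne_zero_iff _ (IsFractionRing.injective A K)).2 hc
  have hint : IsIntegral A (algebraMap A K t / algebraMap A K c) := by
    refine isIntegral_of_smul_mem_submodule (Submodule.map (Algebra.linearMap A K) I) ?_
      ((IsNoetherian.noetherian I).map _) _ ?_
    · intro h0
      exact hI (Submodule.map_injective_of_injective hinj (h0.trans (Submodule.map_bot _).symm))
    · rintro _ ⟨i, hi, rfl⟩
      obtain ⟨j, hj, hij⟩ := h i hi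
      refine ⟨j, hj, ?_⟩
      have := congrArg (algebraMap A K) hij
      rw [map_mul, map_mul] at this
      rw [Algebra.linearMap_apply, Algebra.linearMap_apply, smul_eq_mul, div_mul_eq_mul_div, this,
        mul_div_cancel_left₀ _ hc']
  obtain ⟨y, hy⟩ := IsIntegrallyClosed.isIntegral_iff.1 hint
  refine ⟨y, IsFractionRing.injective A K ?_⟩
  rw [map_mul, hy, mul_div_cancel₀ _ hc']

open Polynomial in
lemma Polynomial.dvd_coeff_mul_coeff {F G : A[X]} {c : A} (hc : c ≠ 0) (h : C c ∣ F * G) (i j : ℕ) :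
    c ∣ F.coeff i * G.coeff j := by
  by_cases hF : F = 0
  · simp [hF]
  refine dvd_of_forall_mul_mem (I := F.contentIdeal ^ G.natDegree) ?_ hc fun x hx => ?_
  · refine pow_ne_zero _ fun h0 => hF ?_
    ext k
    simpa using contentIdeal_le_iff.1 h0.le k
  · have h1 : x * F.coeff i * G.coeff j ∈ F.contentIdeal ^ (G.natDegree + 1) * G.contentIdeal := by
      refine Ideal.mul_mem_mul ?_ (contentIdeal_le_iff.1 le_rfl j)
      rw [pow_succ]
      exact Ideal.mul_mem_mul hx (contentIdeal_le_iff.1 le_rfl i)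
    have h2 : (F * G).contentIdeal ≤ Ideal.span {c} := contentIdeal_le_iff.2 fun k =>
      Ideal.mem_span_singleton.2 (C_dvd_iff_dvd_coeff _ _ |>.1 h k)
    have h3 := (contentIdeal_pow_mul_le F _ G le_rfl).trans (Ideal.mul_mono_right h2) h1
    obtain ⟨y, hy, hxy⟩ := Ideal.mem_mul_span_singleton.1 h3
    exact ⟨y, hy, by rw [mul_comm c, hxy]; ring⟩

open MvPolynomial

lemma MvPolynomial.dvd_coeff_mul_coeff {σ : Type} [Fintype σ] {F G : MvPolynomial σ A} {c : A}
    (hc : c ≠ 0) (h : C c ∣ F * G) (u v : σ →₀ ℕ) : c ∣ F.coeff u * G.coeff v := by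
  by_cases hu : F.coeff u = 0
  · simp [hu]
  by_cases hv : G.coeff v = 0
  · simp [hv]
  obtain ⟨s, w, hs⟩ := exists_kronecker (A := A) (σ := σ) (F.totalDegree + G.totalDegree + 1)
  rw [← hs F (by omega) u (mem_support_iff.2 hu), ← hs G (by omega) v (mem_support_iff.2 hv)]
  refine Polynomial.dvd_coeff_mul_coeff hc ?_ _ _
  have := map_dvd s h
  rwa [map_mul, ← algebraMap_eq, s.commutes] at this

end Kronecker

section Descent

open MvPolynomial

variable {A : Type} [CommRing A] [IsDomain A] [IsIntegrallyClosed A] [IsNoetherianRing A]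

lemma DivSat.le_map_comap {R σ : Type} [CommRing R] [IsDomain R] [Algebra A R] [Fintype σ]
    {Φ : R →ₐ[A] MvPolynomial σ A} (hΦ : Function.Injective Φ)
    (hcont : ∀ (I : Ideal A) (f : R), (∀ u, (Φ f).coeff u ∈ I) → f ∈ I.map (algebraMap A R))
    {x : R} {ε : MvPolynomial σ A →ₐ[A] Polynomial A} (hx : ε (Φ x) = Polynomial.X)
    {J : Ideal R} (hJ : DivSat J) {a : A} (ha : a ≠ 0) (haJ : algebraMap A R a ∈ J) :
    J ≤ (J.comap (algebraMap A R)).map (algebraMap A R) := by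
  intro f hf
  let I : Ideal A := Ideal.span (Set.range fun u => (Φ f).coeff u)
  have hfI : f ∈ I.map (algebraMap A R) := hcont I f fun u => Ideal.subset_span ⟨u, rfl⟩
  suffices hI : I ≤ J.comap (algebraMap A R) from Ideal.map_mono hI hfI
  by_cases hf0 : f = 0
  · refine Ideal.span_le.2 ?_
    rintro _ ⟨u, rfl⟩
    simp [hf0]
  obtain ⟨u₀, hb⟩ := exists_coeff_ne_zero ((map_ne_zero_iff Φ hΦ).2 hf0)
  set b : A := (Φ f).coeff u₀ with hbdef
  have hbI : b ∈ I := Ideal.subset_span ⟨u₀, rfl⟩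
  have hinj (c : A) (hc : c ≠ 0) : algebraMap A R c ≠ 0 := fun h => by
    have := Φ.commutes c
    rw [h, map_zero, algebraMap_eq] at this
    exact hc (C_eq_zero.1 this.symm)
  let I' : Ideal A := (Ideal.span {b}).colon (I : Set A)
  have hI' {β : A} : β ∈ I' ↔ ∀ i ∈ I, b ∣ β * i := by
    simp only [I', Submodule.mem_colon, SetLike.mem_coe, smul_eq_mul, Ideal.mem_span_singleton]
  obtain ⟨N, β, hβ⟩ := Submodule.fg_iff_exists_fin_generating_family.1
    (IsNoetherian.noetherian I')
  have hβI (k : Fin N) : β k ∈ I' := hβ ▸ Submodule.subset_span ⟨k, rfl⟩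
  have hmulf (k : Fin N) : algebraMap A R b ∣ algebraMap A R (β k) * f := by
    have h1 : algebraMap A R (β k) * f ∈
        (Ideal.span {β k}).map (algebraMap A R) * I.map (algebraMap A R) :=
      Ideal.mul_mem_mul (Ideal.mem_map_of_mem _ (Ideal.mem_span_singleton_self _)) hfI
    have h2 : Ideal.span {β k} * I ≤ Ideal.span {b} := by
      rw [Ideal.span_singleton_mul_le_iff]
      exact fun i hi => Ideal.mem_span_singleton.2 (hI'.1 (hβI k) i hi)
    rw [← Ideal.map_mul] at h1
    have h3 := Ideal.map_mono h2 h1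
    rwa [Ideal.map_span, Set.image_singleton, Ideal.mem_span_singleton] at h3
  let g : R := ∑ k, algebraMap A R (β k) * x ^ (k : ℕ)
  obtain ⟨h, hh⟩ : algebraMap A R b ∣ g * f := by
    rw [Finset.sum_mul]
    refine Finset.dvd_sum fun k _ => ?_
    rw [mul_right_comm]
    exact (hmulf k).mul_right _
  have hεC (I₀ : Ideal A) (hg : ∀ u, (Φ g).coeff u ∈ I₀) (k : Fin N) : β k ∈ I₀ := by
    have h1 : Φ g ∈ I₀.map C := mem_map_C_iff.2 hg
    have h2 := Ideal.mem_map_of_mem (ε : MvPolynomial σ A →+* Polynomial A) h1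
    rw [Ideal.map_map] at h2
    have h3 : (ε : MvPolynomial σ A →+* Polynomial A).comp C = Polynomial.C :=
      RingHom.ext fun c => ε.commutes c
    rw [h3] at h2
    have h4 := Ideal.mem_map_C_iff.1 h2 k
    have h5 : ε (Φ g) = ∑ k, Polynomial.C (β k) * Polynomial.X ^ (k : ℕ) := by
      simp only [g, map_sum, map_mul, map_pow, hx, AlgHom.commutes]
      rfl
    rw [RingHom.coe_coe, h5, Polynomial.finsetSum_coeff, Finset.sum_eq_single k] at h4
    · simpa using h4
    · intro l _ hl
      rw [Polynomial.coeff_C_mul_X_pow, if_neg]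
      exact fun h => hl (Fin.ext h.symm)
    · exact fun h => absurd (Finset.mem_univ k) h
  have hreg (φ : R) (hφ : h * φ ∈ Ideal.span {algebraMap A R a}) :
      φ ∈ Ideal.span {algebraMap A R a} := by
    obtain ⟨z, hz⟩ := Ideal.mem_span_singleton.1 hφ
    have hab : a * b ≠ 0 := mul_ne_zero ha hb
    have h1 : Φ f * (Φ g * Φ φ) = C (a * b) * Φ z := by
      rw [← algebraMap_eq, ← Φ.commutes, ← map_mul, ← map_mul, ← map_mul]
      refine congrArg Φ ?_
      calc f * (g * φ) = (g * f) * φ := by ring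
        _ = algebraMap A R b * (h * φ) := by rw [hh, mul_assoc]
        _ = _ := by rw [hz, map_mul]; ring
    have h2 (i : A) (hi : i ∈ I) (v) : a * b ∣ i * (Φ g * Φ φ).coeff v := by
      induction hi using Submodule.span_induction with
      | mem i hi =>
        obtain ⟨u, rfl⟩ := hi
        exact MvPolynomial.dvd_coeff_mul_coeff hab ⟨_, h1⟩ u v
      | zero => rw [zero_mul]; exact dvd_zero _
      | add i j _ _ hi hj => rw [add_mul]; exact dvd_add hi hj
      | smul c i _ hi => rw [smul_eq_mul, mul_assoc]; exact hi.mul_left _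
    have h3 (i : A) (hi : i ∈ I) (u v) : a * b ∣ i * (Φ g).coeff u * (Φ φ).coeff v := by
      rw [← coeff_C_mul u i]
      refine MvPolynomial.dvd_coeff_mul_coeff hab ?_ u v
      rw [C_dvd_iff_dvd_coeff]
      intro w
      rw [mul_assoc, coeff_C_mul]
      exact h2 i hi w
    have h4 (i : A) (hi : i ∈ I) (γ : A) (hγ : γ ∈ I') (v) :
        a * b ∣ i * γ * (Φ φ).coeff v := by
      let I₀ : Ideal A := (Ideal.span {a * b}).colon {i * (Φ φ).coeff v}
      have hI₀ (γ : A) : γ ∈ I₀ ↔ a * b ∣ i * γ * (Φ φ).coeff v := by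
        simp only [I₀, Submodule.mem_colon_singleton, smul_eq_mul, Ideal.mem_span_singleton,
          mul_right_comm, mul_comm γ]
      have h5 : I' ≤ I₀ := by
        rw [← hβ, Submodule.span_le]
        rintro _ ⟨k, rfl⟩
        exact hεC I₀ (fun u => (hI₀ _).2 (h3 i hi u v)) k
      exact (hI₀ γ).1 (h5 hγ)
    have h5 (v) : a ∣ (Φ φ).coeff v := by
      refine dvd_of_forall_mul_mem (I := I') ?_ ha fun γ hγ => ?_
      · exact fun h0 => hb (h0.le (hI'.2 fun i _ => dvd_mul_right b i))
      · obtain ⟨γ', hγ'⟩ := h4 b hbI γ hγ v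
        have h6 : (Φ φ).coeff v * γ = a * γ' := mul_left_cancel₀ hb (by linear_combination hγ')
        refine ⟨γ', hI'.2 fun i hi => ?_, h6⟩
        refine (mul_dvd_mul_iff_left ha).1 ?_
        convert h4 i hi γ hγ v using 1
        linear_combination -i * h6
    have h6 := hcont (Ideal.span {a}) φ fun v => Ideal.mem_span_singleton.2 (h5 v)
    rwa [Ideal.map_span, Set.image_singleton] at h6
  intro α hα
  refine hJ _ haJ (hinj a ha) h hreg _ ?_
  choose γ hγ using fun k => hI'.1 (hβI k) α hα
  have : h * algebraMap A R α = (∑ k, algebraMap A R (γ k) * x ^ (k : ℕ)) * f := by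
    refine mul_left_cancel₀ (hinj b hb) ?_
    rw [← mul_assoc, ← hh, mul_right_comm, ← mul_assoc, Finset.mul_sum]
    congr 1
    rw [Finset.sum_mul]
    refine Finset.sum_congr rfl fun k _ => ?_
    rw [mul_right_comm, ← map_mul, hγ, map_mul, mul_assoc]
  rw [this]
  exact J.mul_mem_left _ hf

end Descent

section Induction

open MvPolynomial TensorProduct

lemma DetRing.mem_map_of_detMap {A : Type} [CommRing A] {m n r : ℕ} {I : Ideal A}
    {f : DetRing A m n (r + 1)} (h : ∀ u, (detMap A m n r f).coeff u ∈ I) :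
    f ∈ I.map (algebraMap A (DetRing A m n (r + 1))) := by
  obtain ⟨g, hg, rfl⟩ := DetRing.exists_std f
  have h1 : g ∈ I.map C :=
    mem_map_C_iff.2 (coeff_mem_of_lead (r := r) I hg fun u _ e _ => h e)
  have h2 := Ideal.mem_map_of_mem (Ideal.Quotient.mk (minorsIdeal A m n (r + 1))) h1
  rwa [Ideal.map_map] at h2

lemma exists_detMap_X_eq {A : Type} [CommRing A] {m n r : ℕ} (p : Fin m × Fin n) (k : Fin r) :
    ∃ ε : YZPoly A m n r →ₐ[A] Polynomial A,
      ε (detMap A m n r (Ideal.Quotient.mk _ (X p))) = Polynomial.X := by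
  classical
  refine ⟨aeval (Sum.elim (fun e => if e.2 = k then Polynomial.X else 0) fun _ => 1), ?_⟩
  rw [detMap_mk, prodMap, aeval_X, map_sum]
  simp

lemma DetRing.algebraMap_injective (A : Type) [CommRing A] (m n r : ℕ) :
    Function.Injective (algebraMap A (DetRing A m n (r + 1))) := by
  intro a b h
  have := congrArg (detMap A m n r) h
  rw [AlgHom.commutes, AlgHom.commutes] at this
  exact C_injective _ _ this

lemma DetRing.algebraMap_surjective (A : Type) [CommRing A] (m n : ℕ) :
    Function.Surjective (algebraMap A (DetRing A m n (0 + 1))) := by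
  intro f
  obtain ⟨f, rfl⟩ := Ideal.Quotient.mk_surjective f
  induction f using MvPolynomial.induction_on with
  | C a => exact ⟨a, rfl⟩
  | add f g hf hg =>
    obtain ⟨a, ha⟩ := hf
    obtain ⟨b, hb⟩ := hg
    exact ⟨a + b, by rw [map_add, map_add, ha, hb]⟩
  | mul_X f p =>
    refine ⟨0, ?_⟩
    rw [map_zero, eq_comm, Ideal.Quotient.eq_zero_iff_mem]
    refine Ideal.mul_mem_left _ _ (Ideal.subset_span ⟨fun _ => p.1, fun _ => p.2, ?_⟩)
    exact (Matrix.det_fin_one (Matrix.of fun _ _ : Fin 1 => X p)).symm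

/-- The extension of an ideal along a flat algebra is its base change. -/
noncomputable def Ideal.tensorEquivMap {A R : Type} [CommRing A] [CommRing R] [Algebra A R]
    [Module.Flat A R] (I : Ideal A) : R ⊗[A] I ≃ₗ[R] I.map (algebraMap A R) := by
  let φ : R ⊗[A] I →ₗ[R] R :=
    (TensorProduct.AlgebraTensorModule.rid A R R).toLinearMap ∘ₗ I.subtype.baseChange R
  have hφ : Function.Injective φ :=
    (TensorProduct.AlgebraTensorModule.rid A R R).injective.comp
      (Module.Flat.lTensor_preserves_injective_linearMap I.subtype I.subtype_injective)
  have hr : LinearMap.range φ = I.map (algebraMap A R) := by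
    refine le_antisymm ?_ (Ideal.map_le_iff_le_comap.2 fun i hi => ⟨1 ⊗ₜ ⟨i, hi⟩, ?_⟩)
    · rintro _ ⟨t, rfl⟩
      induction t with
      | zero => rw [map_zero]; exact zero_mem _
      | add s t hs ht => rw [map_add]; exact add_mem hs ht
      | tmul c i =>
        have : φ (c ⊗ₜ i) = algebraMap A R i * c := by
          simp [φ, Algebra.smul_def]
        rw [this]
        exact Ideal.mul_mem_right _ _ (Ideal.mem_map_of_mem _ i.2)
    · simp [φ, Algebra.smul_def]
  exact (LinearEquiv.ofInjective φ hφ).trans (LinearEquiv.ofEq _ _ hr)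

lemma DivSat.nonempty_equiv_of_prime {R : Type} [CommRing R] [IsDomain R] {J : Ideal R}
    (hJ : DivSat J) {x : R} (hx : Prime x) {N : ℕ} (hN : x ^ N ∈ J) : Nonempty (J ≃ₗ[R] R) := by
  classical
  have hex : ∃ j, x ^ j ∈ J := ⟨N, hN⟩
  set j := Nat.find hex
  have hj : x ^ j ∈ J := Nat.find_spec hex
  have hdvd (f : R) (hf : f ∈ J) (i : ℕ) (hi : i ≤ j) : x ^ i ∣ f := by
    induction i with
    | zero => simp
    | succ i ih =>
      obtain ⟨h, rfl⟩ := ih (by omega)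
      rw [pow_succ]
      refine mul_dvd_mul_left _ ?_
      by_contra hxh
      refine Nat.find_min hex (m := i) (by omega) ?_
      refine hJ _ hj (pow_ne_zero _ hx.ne_zero) h (fun g hg => ?_) _ (mul_comm h _ ▸ hf)
      rw [Ideal.mem_span_singleton] at hg ⊢
      exact hx.pow_dvd_of_dvd_mul_left _ hxh hg
  exact ⟨(Ideal.mulEquiv (pow_ne_zero j hx.ne_zero) (J' := ⊤) fun f =>
    ⟨fun hf => by
      obtain ⟨g, hg⟩ := hdvd f hf j le_rfl
      exact ⟨g, trivial, hg⟩,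
    fun ⟨g, _, hg⟩ => hg ▸ J.mul_mem_right _ hj⟩).symm.trans Submodule.topEquiv⟩

/-- Every semidualizing module is free. -/
def SDFree (R : Type) [CommRing R] : Prop :=
  ∀ (D : Type) [AddCommGroup D] [Module R D], SD R D → Nonempty (D ≃ₗ[R] R)

lemma exists_ideal_of_sdFree_fractionRing {A : Type} [CommRing A] [IsDomain A]
    [IsIntegrallyClosed A] [IsNoetherianRing A] {m n r : ℕ} (hm : r < m) (hn : r < n)
    (hF : SDFree (DetRing (FractionRing A) m n (r + 1))) {D : Type} [AddCommGroup D]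
    [Module (DetRing A m n (r + 1)) D] (hD : SD (DetRing A m n (r + 1)) D) :
    ∃ I : Ideal A, SD A I ∧
      Nonempty (D ≃ₗ[DetRing A m n (r + 1)] DetRing A m n (r + 1) ⊗[A] I) := by
  let : Algebra (DetRing A m n (r + 1)) (DetRing (FractionRing A) m n (r + 1)) :=
    (DetRing.map A (FractionRing A) m n (r + 1)).toAlgebra
  have hinj := DetRing.algebraMap_injective A m n r
  have hloc := DetRing.isLocalization_map (A := A) (B := FractionRing A) (m := m) (n := n)
    (t := r + 1) (nonZeroDivisors A)
  obtain ⟨J, ⟨e⟩, _, ⟨a, ha, rfl⟩, haJ⟩ := SD.exists_ideal_of_isLocalization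
    ((nonZeroDivisors A).map (algebraMap A (DetRing A m n (r + 1))))
    (map_le_nonZeroDivisors_of_injective _ hinj le_rfl) hF hD
  have hJ := hD.of_linearEquiv e
  have hle : (J.comap (algebraMap A _)).map (algebraMap A (DetRing A m n (r + 1))) = J := by
    rcases r with _ | r
    · exact Ideal.map_comap_of_surjective _ (DetRing.algebraMap_surjective A m n) J
    · obtain ⟨ε, hε⟩ := exists_detMap_X_eq (A := A) (r := r + 1) ((⟨0, by omega⟩, ⟨0, by omega⟩) :
        Fin m × Fin n) 0
      exact le_antisymm Ideal.map_comap_le (hJ.divSat.le_map_comap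
        (detMap_injective A m n (r + 1)) (fun I f => DetRing.mem_map_of_detMap) hε
        (nonZeroDivisors.ne_zero ha) haJ)
  let e' : D ≃ₗ[DetRing A m n (r + 1)] DetRing A m n (r + 1) ⊗[A] (J.comap (algebraMap A _)) :=
    e.trans ((LinearEquiv.ofEq _ _ hle.symm).trans (Ideal.tensorEquivMap _).symm)
  exact ⟨_, SD.of_baseChange _ (hD.of_linearEquiv e'), ⟨e'⟩⟩

lemma sdFree_detRing_of_ufd {B : Type} [CommRing B] [IsDomain B] [UniqueFactorizationMonoid B]
    [IsNoetherianRing B] {m n r : ℕ} (hm : r < m) (hn : r < n)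
    (hF : SDFree (DetRing (FractionRing B) m n (r + 1))) : SDFree (DetRing B m n (r + 1)) := by
  intro D _ _ hD
  obtain ⟨I, hI, ⟨e⟩⟩ := exists_ideal_of_sdFree_fractionRing hm hn hF hD
  obtain ⟨e'⟩ := hI.nonempty_equiv_of_ufd
  exact ⟨e.trans ((e'.baseChange B (DetRing B m n (r + 1)) _ _).trans
    (TensorProduct.AlgebraTensorModule.rid _ _ _))⟩

lemma sdFree_detRing_zero (K : Type) [Field K] (m n : ℕ) : SDFree (DetRing K m n (0 + 1)) := by
  intro D _ _ hD
  let e : K ≃+* DetRing K m n (0 + 1) := RingEquiv.ofBijective (algebraMap _ _)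
    ⟨DetRing.algebraMap_injective K m n 0, DetRing.algebraMap_surjective K m n⟩
  have : UniqueFactorizationMonoid (DetRing K m n (0 + 1)) :=
    e.toMulEquiv.uniqueFactorizationMonoid inferInstance
  exact hD.nonempty_equiv_of_ufd

lemma sdFree_detRing_square (r : ℕ) : ∀ (K : Type) [Field K] (n : ℕ), r < n →
    SDFree (DetRing K n n (r + 1)) := by
  induction r with
  | zero => exact fun K _ n _ => sdFree_detRing_zero K n n
  | succ r ih =>
    intro K _ n hn
    obtain ⟨p, rfl⟩ : ∃ p, n = p + 1 := ⟨n - 1, by omega⟩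
    have hp : r < p := by omega
    have hT : SDFree (DetRing (CornerRing K p p) p p (r + 1)) :=
      sdFree_detRing_of_ufd hp hp (ih _ p hp)
    intro D _ _ hD
    let : Algebra (DetRing K (p + 1) (p + 1) (r + 2)) (DetRing (CornerRing K p p) p p (r + 1)) :=
      (cornerHom K p p r).toRingHom.toAlgebra
    have hloc := isLocalization_cornerHom K p p r
    obtain ⟨J, ⟨e⟩, _, ⟨N, rfl⟩, hN⟩ := SD.exists_ideal_of_isLocalization
      (Submonoid.powers (Ideal.Quotient.mk (minorsIdeal K (p + 1) (p + 1) (r + 2)) (X (0, 0))))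
      (powers_le_nonZeroDivisors_of_noZeroDivisors (corner_ne_zero K p p r)) hT hD
    have hJ := hD.of_linearEquiv e
    suffices Nonempty (J ≃ₗ[DetRing K (p + 1) (p + 1) (r + 2)] DetRing K (p + 1) (p + 1) (r + 2)) by
      obtain ⟨e'⟩ := this
      exact ⟨e.trans e'⟩
    rcases r with _ | r
    · obtain ⟨k, rfl⟩ : ∃ k, p = k + 1 := ⟨p - 1, by omega⟩
      exact hJ.nonempty_equiv_of_segre hN
    · exact hJ.divSat.nonempty_equiv_of_prime
        (prime_corner (K := K) (r := r) (i := (0 : Fin (p + 1))) (j := 0) rfl rfl) hN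

end Induction

section BaseChange

open MvPolynomial TensorProduct

lemma nonempty_equiv_of_baseChange {A R C C' : Type} [CommRing A] [CommRing R] [Algebra A R]
    [AddCommGroup C] [Module A C] [AddCommGroup C'] [Module A C'] (π : R →ₐ[A] A)
    (e : R ⊗[A] C ≃ₗ[R] R ⊗[A] C') : Nonempty (C ≃ₗ[A] C') := by
  let : Algebra R A := π.toRingHom.toAlgebra
  have : IsScalarTower A R A := IsScalarTower.of_algebraMap_eq fun a => (π.commutes a).symm
  let f (C : Type) [AddCommGroup C] [Module A C] : A ⊗[R] (R ⊗[A] C) ≃ₗ[A] C :=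
    (AlgebraTensorModule.cancelBaseChange A R A A C).trans (TensorProduct.lid A C)
  exact ⟨(f C).symm.trans ((e.baseChange R A _ _).trans (f C'))⟩

lemma DetRing.nonempty_retraction (A : Type) [CommRing A] (m n r : ℕ) :
    Nonempty (DetRing A m n (r + 1) →ₐ[A] A) :=
  ⟨(aeval (0 : YZIdx m n r → A) : YZPoly A m n r →ₐ[A] A).comp (detMap A m n r)⟩

end BaseChange

/-- for a normal domain `A` and `r = 0` or `m = n`, base change along the
natural map `A → R = R_{r+1}(A;m,n)` induces a bijection on isomorphism classes of
semidualizing modules. -/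
theorem statement18
    (A : Type) [CommRing A] [IsDomain A] [IsNoetherianRing A] [IsIntegrallyClosed A]
    (m n r : ℕ) (hm : r < m) (hn : r < n) (h : r = 0 ∨ m = n) :
    (∀ (C : Type) [AddCommGroup C] [Module A C], IsSemidualizing A C →
       IsSemidualizing (DetRing A m n (r + 1))
         (TensorProduct A (DetRing A m n (r + 1)) C)) ∧
    (∀ (D : Type) [AddCommGroup D] [Module (DetRing A m n (r + 1)) D],
       IsSemidualizing (DetRing A m n (r + 1)) D →
       ∃ C : ModuleCat.{0} A, IsSemidualizing A ↥C ∧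
         Nonempty (D ≃ₗ[DetRing A m n (r + 1)]
           TensorProduct A (DetRing A m n (r + 1)) ↥C)) ∧
    (∀ (C C' : Type) [AddCommGroup C] [Module A C] [AddCommGroup C'] [Module A C'],
       IsSemidualizing A C → IsSemidualizing A C' →
       Nonempty ((TensorProduct A (DetRing A m n (r + 1)) C)
         ≃ₗ[DetRing A m n (r + 1)] (TensorProduct A (DetRing A m n (r + 1)) C')) →
       Nonempty (C ≃ₗ[A] C')) := by
  refine ⟨fun C _ _ hC => ?_, fun D _ _ hD => ?_, fun C C' _ _ _ _ _ _ ⟨e⟩ => ?_⟩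
  · exact isSemidualizing_iff_sd.2 ((isSemidualizing_iff_sd.1 hC).baseChange _)
  · have hF : SDFree (DetRing (FractionRing A) m n (r + 1)) := by
      rcases h with rfl | rfl
      · exact sdFree_detRing_zero _ m n
      · exact sdFree_detRing_square r _ m hm
    obtain ⟨I, hI, he⟩ := exists_ideal_of_sdFree_fractionRing hm hn hF
      (isSemidualizing_iff_sd.1 hD)
    exact ⟨ModuleCat.of A I, isSemidualizing_iff_sd.2 hI, he⟩
  · obtain ⟨π⟩ := DetRing.nonempty_retraction A m n r
    exact nonempty_equiv_of_baseChange π e
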